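/- Let f, h ∈ O_n with μ_X(f) < ∞ and μ_Y(h) < ∞, where X = h^{-1}(0) and Y = f^{-1}(0) are hypersurface germs with isolated singularities. Then μ_X(f) − τ_X(f) = dim_ℂ O_n/(⟨f⟩ + J(f,h)) − τ(f) + μ(h) − τ(h) − dim_ℂ Θ/(Θ_X + Θ_Y). -/

import Mathlib

open Filter Topology Polynomial

set_option maxHeartbeats 1000000
set_option synthInstance.maxHeartbeats 1000000

noncomputable section

/-- The algebra structure on germs of complex valued functions. -/
instance Filter.Germ.instAlgebraComplex {α : Type*} (l : Filter α) :
    Algebra ℂ (Filter.Germ l ℂ) where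
  algebraMap := (Filter.Germ.coeRingHom l).comp (algebraMap ℂ (α → ℂ))
  commutes' := fun c g => mul_comm _ _
  smul_def' := fun c g => Filter.Germ.inductionOn g fun f => rfl

/-- The local algebra `𝒪ₙ` of germs at `0 ∈ ℂⁿ` of holomorphic functions,
realized as the subalgebra of germs at `0` admitting an analytic representative. -/
def On (n : ℕ) : Subalgebra ℂ (Filter.Germ (𝓝 (0 : Fin n → ℂ)) ℂ) where
  carrier := {g | ∃ f : (Fin n → ℂ) → ℂ,
    AnalyticAt ℂ f 0 ∧ (f : Filter.Germ (𝓝 (0 : Fin n → ℂ)) ℂ) = g}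
  mul_mem' := by
    rintro a b ⟨f, hf, rfl⟩ ⟨g, hg, rfl⟩
    exact ⟨f * g, hf.mul hg, rfl⟩
  add_mem' := by
    rintro a b ⟨f, hf, rfl⟩ ⟨g, hg, rfl⟩
    exact ⟨f + g, hf.add hg, rfl⟩
  algebraMap_mem' := fun c => ⟨fun _ => c, analyticAt_const, rfl⟩

variable {n : ℕ}

/-- Existence of an analytic representative for an element of `𝒪ₙ`. -/
lemma On.exists_rep (g : On n) : ∃ f : (Fin n → ℂ) → ℂ,
    AnalyticAt ℂ f 0 ∧ (f : Filter.Germ (𝓝 (0 : Fin n → ℂ)) ℂ) = (g : Filter.Germ _ ℂ) :=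
  g.2

/-- A chosen analytic representative of a germ in `𝒪ₙ`. -/
def On.rep (g : On n) : (Fin n → ℂ) → ℂ := (On.exists_rep g).choose

lemma On.rep_analyticAt (g : On n) : AnalyticAt ℂ (On.rep g) 0 :=
  (On.exists_rep g).choose_spec.1

lemma On.rep_spec (g : On n) :
    (On.rep g : Filter.Germ (𝓝 (0 : Fin n → ℂ)) ℂ) = (g : Filter.Germ _ ℂ) :=
  (On.exists_rep g).choose_spec.2

/-- Build an element of `𝒪ₙ` from an analytic function. -/
def mkOn {n : ℕ} (f : (Fin n → ℂ) → ℂ) (hf : AnalyticAt ℂ f 0) : On n :=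
  ⟨(f : Filter.Germ (𝓝 (0 : Fin n → ℂ)) ℂ), ⟨f, hf, rfl⟩⟩

/-- The `i`-th partial derivative, as an operation on `𝒪ₙ`. -/
def pd (i : Fin n) (g : On n) : On n :=
  mkOn (fun x => fderiv ℂ (On.rep g) x (Pi.single i 1)) (by
    have h := ((ContinuousLinearMap.apply ℂ ℂ (Pi.single i 1)).analyticAt
      (fderiv ℂ (On.rep g) 0)).comp (On.rep_analyticAt g).fderiv
    exact h)

/-- Restriction of germs at `0` to germs along a finer filter. -/
def restrictGerm {l : Filter (Fin n → ℂ)} (hl : l ≤ 𝓝 (0 : Fin n → ℂ)) :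
    Filter.Germ (𝓝 (0 : Fin n → ℂ)) ℂ →+* Filter.Germ l ℂ where
  toFun g := g.compTendsto id (Filter.tendsto_id'.2 hl)
  map_one' := rfl
  map_mul' a b := Filter.Germ.inductionOn₂ a b fun f g => rfl
  map_zero' := rfl
  map_add' a b := Filter.Germ.inductionOn₂ a b fun f g => rfl

/-- Evaluation of germs restricted along `l ≤ 𝓝 0`, as a ring homomorphism on `𝒪ₙ`. -/
def restrictOn (n : ℕ) {l : Filter (Fin n → ℂ)} (hl : l ≤ 𝓝 (0 : Fin n → ℂ)) :
    On n →+* Filter.Germ l ℂ :=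
  (restrictGerm hl).comp (On n).val.toRingHom

/-- The ideal `I_X ⊆ 𝒪ₙ` of germs vanishing on a set `X` near `0`. -/
def IX (n : ℕ) (X : Set (Fin n → ℂ)) : Ideal (On n) :=
  RingHom.ker (restrictOn n (nhdsWithin_le_nhds (s := X)))

/-- The maximal ideal `𝔪 ⊂ 𝒪ₙ` of germs vanishing at the origin. -/
def mId (n : ℕ) : Ideal (On n) :=
  RingHom.ker (restrictOn n (pure_le_nhds (0 : Fin n → ℂ)))

/-- `X` is the germ at `0` of an analytic variety: `0 ∈ X` and, near `0`, `X` coincides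
with the common zero locus of finitely many holomorphic functions. -/
def IsAnalyticGermAt0 (n : ℕ) (X : Set (Fin n → ℂ)) : Prop :=
  (0 : Fin n → ℂ) ∈ X ∧
    ∃ (m : ℕ) (g : Fin m → (Fin n → ℂ) → ℂ),
      (∀ j, AnalyticAt ℂ (g j) 0) ∧
      ∀ᶠ x in 𝓝 (0 : Fin n → ℂ), (x ∈ X ↔ ∀ j, g j x = 0)

/-- The action `δ(g) = Σ δᵢ ∂g/∂xᵢ` of a vector field `δ ∈ Θ ≅ 𝒪ₙⁿ` on `g ∈ 𝒪ₙ`. -/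
def applyVF (δ : Fin n → On n) (g : On n) : On n := ∑ i, δ i * pd i g

lemma applyVF_add (a b : Fin n → On n) (g : On n) :
    applyVF (a + b) g = applyVF a g + applyVF b g := by
  simp [applyVF, add_mul, Finset.sum_add_distrib]

lemma applyVF_smul (c : On n) (a : Fin n → On n) (g : On n) :
    applyVF (c • a) g = c * applyVF a g := by
  simp [applyVF, Finset.mul_sum, smul_eq_mul, mul_assoc]

/-- For fixed `f`, the map `δ ↦ δ(f)` as an `𝒪ₙ`-linear map `Θ → 𝒪ₙ`. -/
def gradMap (n : ℕ) (f : On n) : (Fin n → On n) →ₗ[On n] On n where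
  toFun δ := applyVF δ f
  map_add' a b := applyVF_add a b f
  map_smul' c a := applyVF_smul c a f

/-- The module `Θ_X` of logarithmic vector fields of `X`, i.e. vector fields
preserving the ideal `I_X`. -/
def ThetaX (n : ℕ) (X : Set (Fin n → ℂ)) : Submodule (On n) (Fin n → On n) where
  carrier := {δ | ∀ g ∈ IX n X, applyVF δ g ∈ IX n X}
  add_mem' := by
    intro a b ha hb g hg
    rw [applyVF_add]
    exact Ideal.add_mem _ (ha g hg) (hb g hg)
  zero_mem' := by
    intro g hg
    have h0 : applyVF (0 : Fin n → On n) g = 0 := by simp [applyVF]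
    rw [h0]; exact Ideal.zero_mem _
  smul_mem' := by
    intro c a ha g hg
    rw [applyVF_smul]
    exact Ideal.mul_mem_left _ _ (ha g hg)

/-- The module `Θ_Y` of vector fields tangent to the hypersurface `Y = f⁻¹(0)`,
i.e. `δ(f) ∈ ⟨f⟩`. -/
def ThetaF (n : ℕ) (f : On n) : Submodule (On n) (Fin n → On n) :=
  Submodule.comap (gradMap n f) (Ideal.span {f})

/-- The module `H_Y` of Hamiltonian vector fields of `f`, i.e. `δ(f) = 0`. -/
def HamF (n : ℕ) (f : On n) : Submodule (On n) (Fin n → On n) :=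
  LinearMap.ker (gradMap n f)

/-- The Bruce–Roberts ideal `df(Θ_X) ⊆ 𝒪ₙ`. -/
def BRIdeal (n : ℕ) (X : Set (Fin n → ℂ)) (f : On n) : Ideal (On n) :=
  Submodule.map (gradMap n f) (ThetaX n X)

/-- The Jacobian ideal `J(f) = ⟨∂f/∂x₁, …, ∂f/∂xₙ⟩`. -/
def Jac (n : ℕ) (f : On n) : Ideal (On n) :=
  Ideal.span (Set.range fun i => pd i f)

/-- The ideal `J(f,h)` generated by the `2×2` minors of the Jacobian matrix of `(f,h)`. -/
def Jmin (n : ℕ) (f h : On n) : Ideal (On n) :=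
  Ideal.span (Set.range fun p : Fin n × Fin n => pd p.1 f * pd p.2 h - pd p.2 f * pd p.1 h)

/-- The Milnor number `μ(f)`. -/
def mu (n : ℕ) (f : On n) : ℕ := Module.finrank ℂ (On n ⧸ Jac n f)

/-- The Tjurina number `τ(f)`. -/
def tau (n : ℕ) (f : On n) : ℕ :=
  Module.finrank ℂ (On n ⧸ (Jac n f + Ideal.span {f}))

/-- The Bruce–Roberts Milnor number `μ_X(f)`. -/
def muX (n : ℕ) (X : Set (Fin n → ℂ)) (f : On n) : ℕ :=
  Module.finrank ℂ (On n ⧸ BRIdeal n X f)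

/-- The Bruce–Roberts Tjurina number `τ_X(f)`. -/
def tauX (n : ℕ) (X : Set (Fin n → ℂ)) (f : On n) : ℕ :=
  Module.finrank ℂ (On n ⧸ (BRIdeal n X f + Ideal.span {f}))

/-- The value at the origin of a germ in `𝒪ₙ`. -/
def ev0 (g : On n) : ℂ := On.rep g 0

/-- The linear part `j¹δ` of a vector field `δ`, as the matrix `(∂δⱼ/∂xᵢ)(0)`. -/
def linPart (δ : Fin n → On n) : Matrix (Fin n) (Fin n) ℂ :=
  Matrix.of fun i j => ev0 (pd i (δ j))

/-- The eigenvalues (with multiplicities) of the linear part of `δ` are given by `w`. -/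
def EigsEq (δ : Fin n → On n) (w : Fin n → ℚ) : Prop :=
  (linPart δ).charpoly = ∏ i, (Polynomial.X - Polynomial.C ((w i : ℂ)))

/-- The germ at `0` of the coordinate function `xᵢ`. -/
def coordG (i : Fin n) : On n :=
  mkOn (fun x : Fin n → ℂ => x i)
    ((ContinuousLinearMap.proj (R := ℂ) (φ := fun _ : Fin n => ℂ) i).analyticAt _)

/-- `g` is quasihomogeneous of degree `d` with respect to the weights `w` (in the given
coordinates): the Euler identity `Σ wᵢ xᵢ ∂g/∂xᵢ = d g` holds. -/
def IsQH (n : ℕ) (w : Fin n → ℚ) (d : ℚ) (g : On n) : Prop :=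
  ∑ i, (w i : ℂ) • (coordG i * pd i g) = (d : ℂ) • g

/-- A germ of a biholomorphic change of coordinates at `0 ∈ ℂⁿ`. -/
structure CoordChange (n : ℕ) where
  toFun : (Fin n → ℂ) → (Fin n → ℂ)
  invFun : (Fin n → ℂ) → (Fin n → ℂ)
  analyticAt : AnalyticAt ℂ toFun 0
  inv_analyticAt : AnalyticAt ℂ invFun 0
  map_zero : toFun 0 = 0
  inv_map_zero : invFun 0 = 0
  left_inv : ∀ᶠ x in 𝓝 (0 : Fin n → ℂ), invFun (toFun x) = x
  right_inv : ∀ᶠ x in 𝓝 (0 : Fin n → ℂ), toFun (invFun x) = x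

lemma CoordChange.tendsto (φ : CoordChange n) :
    Filter.Tendsto φ.toFun (𝓝 (0 : Fin n → ℂ)) (𝓝 (0 : Fin n → ℂ)) := by
  have h := φ.analyticAt.continuousAt
  rwa [ContinuousAt, φ.map_zero] at h

/-- The pullback (composition) of a germ `g ∈ 𝒪ₙ` under a change of coordinates. -/
def pullback (φ : CoordChange n) (g : On n) : On n :=
  ⟨(g : Filter.Germ (𝓝 (0 : Fin n → ℂ)) ℂ).compTendsto φ.toFun φ.tendsto, by
    refine ⟨On.rep g ∘ φ.toFun, ?_, ?_⟩
    · have h := On.rep_analyticAt g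
      rw [← φ.map_zero] at h
      exact h.comp φ.analyticAt
    · rw [← On.rep_spec g]
      exact (Filter.Germ.coe_compTendsto _ φ.tendsto).symm⟩

/-- Definition 1.1: the pair `(f, X)` is relatively quasihomogeneous with respect to the
weights `w`: in suitable coordinates, `f` is quasihomogeneous of degree `1` and `I_X` admits
a system of quasihomogeneous generators of positive degrees, all with respect to `w`. -/
def RelQH (n : ℕ) (X : Set (Fin n → ℂ)) (f : On n) (w : Fin n → ℚ) : Prop :=
  ∃ φ : CoordChange n,
    IsQH n w 1 (pullback φ f) ∧
    ∃ (m : ℕ) (h : Fin m → On n) (d : Fin m → ℚ),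
      Ideal.span (Set.range h) = IX n X ∧ (∀ j, 0 < d j) ∧
      ∀ j, IsQH n w (d j) (pullback φ (h j))

/-- The variety `X` is quasihomogeneous with respect to the weights `w`: in suitable
coordinates, `I_X` admits a system of quasihomogeneous generators of positive degrees. -/
def VarQH (n : ℕ) (X : Set (Fin n → ℂ)) (w : Fin n → ℚ) : Prop :=
  ∃ φ : CoordChange n,
    ∃ (m : ℕ) (h : Fin m → On n) (d : Fin m → ℚ),
      Ideal.span (Set.range h) = IX n X ∧ (∀ j, 0 < d j) ∧
      ∀ j, IsQH n w (d j) (pullback φ (h j))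

instance (f : On n) : HasQuotient (↥(ThetaF n f)) (Submodule ↥(On n) ↥(ThetaF n f)) :=
  Submodule.hasQuotient (R := ↥(On n)) (M := ↥(ThetaF n f))

-- BEGIN HELPERS
set_option linter.unusedVariables false
set_option linter.unusedSectionVars false
set_option linter.unusedSimpArgs false

section
namespace Ext

/-- Koszul sign. -/
def sg (R : Type*) [CommRing R] (i : Fin n) (T : Fin n → Bool) : R :=
  ∏ j ∈ Finset.univ.filter (· < i), if T j then -1 else 1

variable {R : Type*} [CommRing R]

lemma sg_update_of_le (i j : Fin n) (h : i ≤ j) (T : Fin n → Bool) (b : Bool) :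
    sg R i (Function.update T j b) = sg R i T := by
  unfold sg
  refine Finset.prod_congr rfl fun k hk => ?_
  have : k ≠ j := by
    have := (Finset.mem_filter.1 hk).2
    exact (lt_of_lt_of_le this h).ne
  rw [Function.update_of_ne this]

lemma sg_update_of_lt (i j : Fin n) (h : j < i) (T : Fin n → Bool) :
    sg R i (Function.update T j (!(T j))) = - sg R i T := by
  unfold sg
  have hj : j ∈ Finset.univ.filter (· < i) := by simp [h]
  rw [← Finset.mul_prod_erase _ _ hj, ← Finset.mul_prod_erase _ _ hj]
  have : ∏ x ∈ (Finset.univ.filter (· < i)).erase j,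
      (if Function.update T j (!(T j)) x = true then (-1 : R) else 1) =
      ∏ x ∈ (Finset.univ.filter (· < i)).erase j, (if T x = true then (-1 : R) else 1) := by
    refine Finset.prod_congr rfl fun k hk => ?_
    rw [Function.update_of_ne (Finset.ne_of_mem_erase hk)]
  rw [this]
  cases hT : T j <;> simp

lemma sg_update_lt_false (i j : Fin n) (h : j < i) (T : Fin n → Bool) (hT : T j = true) :
    sg R i (Function.update T j false) = - sg R i T := by
  have := sg_update_of_lt (R := R) i j h T
  simpa [hT] using this

lemma sg_update_lt_true (i j : Fin n) (h : j < i) (T : Fin n → Bool) (hT : T j = false) :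
    sg R i (Function.update T j true) = - sg R i T := by
  have := sg_update_of_lt (R := R) i j h T
  simpa [hT] using this

lemma sg_mul_self (i : Fin n) (T : Fin n → Bool) : sg R i T * sg R i T = 1 := by
  unfold sg
  rw [← Finset.prod_mul_distrib]
  refine Finset.prod_eq_one fun k _ => ?_
  split_ifs <;> simp

/-- creation operator -/
def X (i : Fin n) : ((Fin n → Bool) → R) →ₗ[R] ((Fin n → Bool) → R) where
  toFun β T := if T i then sg R i T * β (Function.update T i false) else 0
  map_add' a b := by ext T; simp only [Pi.add_apply]; split_ifs <;> ring
  map_smul' c a := by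
    ext T; simp only [Pi.smul_apply, smul_eq_mul, RingHom.id_apply]; split_ifs <;> ring

/-- annihilation operator -/
def Y (i : Fin n) : ((Fin n → Bool) → R) →ₗ[R] ((Fin n → Bool) → R) where
  toFun β T := if T i then 0 else sg R i T * β (Function.update T i true)
  map_add' a b := by ext T; simp only [Pi.add_apply]; split_ifs <;> ring
  map_smul' c a := by
    ext T; simp only [Pi.smul_apply, smul_eq_mul, RingHom.id_apply]; split_ifs <;> ring

lemma X_apply (i : Fin n) (β : (Fin n → Bool) → R) (T) :
    X i β T = if T i then sg R i T * β (Function.update T i false) else 0 := rfl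
lemma Y_apply (i : Fin n) (β : (Fin n → Bool) → R) (T) :
    Y i β T = if T i then 0 else sg R i T * β (Function.update T i true) := rfl

lemma XX_lt (i j : Fin n) (h : i < j) (β : (Fin n → Bool) → R) :
    X i (X j β) = - X j (X i β) := by
  ext T
  simp only [X_apply, Pi.neg_apply, Function.update_of_ne h.ne, Function.update_of_ne h.ne']
  by_cases hi : T i = true
  · by_cases hj : T j = true
    · rw [sg_update_lt_false j i h T hi, sg_update_of_le i j h.le, Function.update_comm h.ne]
      simp [hi, hj]; ring
    · simp [hi, hj]
  · simp [hi]

lemma XX (i j : Fin n) (β : (Fin n → Bool) → R) :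
    X i (X j β) = - X j (X i β) := by
  rcases lt_trichotomy i j with h | h | h
  · exact XX_lt i j h β
  · subst h
    ext T
    simp [X_apply]
  · rw [XX_lt j i h β, neg_neg]

lemma XX_self (i : Fin n) (β : (Fin n → Bool) → R) : X i (X i β) = 0 := by
  ext T
  simp [X_apply]

lemma YX (i j : Fin n) (β : (Fin n → Bool) → R) :
    Y i (X j β) = (if i = j then β else 0) - X j (Y i β) := by
  rcases lt_trichotomy i j with h | h | h
  · rw [if_neg h.ne]
    ext T
    simp only [X_apply, Y_apply, Pi.sub_apply, Pi.zero_apply, Function.update_of_ne h.ne, Function.update_of_ne h.ne']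
    by_cases hi : T i = true
    · simp [hi]
    · by_cases hj : T j = true
      · rw [sg_update_lt_true j i h T (by simpa using hi), sg_update_of_le i j h.le, Function.update_comm h.ne]
        simp [hi, hj]; ring
      · simp [hi, hj]
  · subst h
    ext T
    simp only [X_apply, Y_apply, Pi.sub_apply]
    by_cases hi : T i = true
    · have hup : Function.update T i true = T := by
        conv_lhs => rw [← hi]
        exact Function.update_eq_self i T
      simp [hi, sg_update_of_le i i le_rfl, hup, ← mul_assoc, sg_mul_self]
    · have hi' : T i = false := by simpa using hi
      simp only [hi', if_true, Function.update_self, sg_update_of_le i i le_rfl, Function.update_idem]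
      rw [← hi', Function.update_eq_self]
      simp [← mul_assoc, sg_mul_self, hi']
  · rw [if_neg h.ne']
    ext T
    simp only [X_apply, Y_apply, Pi.sub_apply, Pi.zero_apply, Function.update_of_ne h.ne, Function.update_of_ne h.ne']
    by_cases hi : T i = true
    · simp [hi]
    · by_cases hj : T j = true
      · rw [sg_update_lt_false i j h T hj, sg_update_of_le j i h.le, Function.update_comm h.ne]
        simp [hi, hj]; ring
      · simp [hi, hj]

/-- degree -/
def dg (T : Fin n → Bool) : ℤ := ∑ i, if T i then 1 else 0

lemma dg_nonneg (T : Fin n → Bool) : 0 ≤ dg T :=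
  Finset.sum_nonneg fun i _ => by split_ifs <;> simp

lemma dg_update_true (T : Fin n → Bool) (i : Fin n) (h : T i = false) :
    dg (Function.update T i true) = dg T + 1 := by
  unfold dg
  rw [← Finset.add_sum_erase _ _ (Finset.mem_univ i), ← Finset.add_sum_erase _ _ (Finset.mem_univ i)]
  have : ∑ x ∈ Finset.univ.erase i, (if Function.update T i true x = true then (1 : ℤ) else 0) =
      ∑ x ∈ Finset.univ.erase i, (if T x = true then (1 : ℤ) else 0) :=
    Finset.sum_congr rfl fun k hk => by rw [Function.update_of_ne (Finset.ne_of_mem_erase hk)]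
  rw [this]; simp [h]; ring

lemma dg_update_false (T : Fin n → Bool) (i : Fin n) (h : T i = true) :
    dg (Function.update T i false) = dg T - 1 := by
  have := dg_update_true (Function.update T i false) i (by simp)
  rw [Function.update_idem, ← h, Function.update_eq_self] at this
  linarith

/-- homogeneous elements -/
def Hom (R : Type*) [CommRing R] (n : ℕ) (p : ℤ) : Submodule R ((Fin n → Bool) → R) where
  carrier := {β | ∀ T, dg T ≠ p → β T = 0}
  add_mem' ha hb T hT := by simp [ha T hT, hb T hT]
  zero_mem' := by simp
  smul_mem' c a ha T hT := by simp [ha T hT]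

lemma X_hom {p : ℤ} (i : Fin n) {β : (Fin n → Bool) → R} (h : β ∈ Hom R n p) :
    X i β ∈ Hom R n (p + 1) := by
  intro T hT
  rw [X_apply]
  split_ifs with hi
  · rw [h _ (by rw [dg_update_false T i hi]; omega), mul_zero]
  · rfl

lemma Y_hom {p : ℤ} (i : Fin n) {β : (Fin n → Bool) → R} (h : β ∈ Hom R n p) :
    Y i β ∈ Hom R n (p - 1) := by
  intro T hT
  rw [Y_apply]
  split_ifs with hi
  · rfl
  · rw [h _ (by rw [dg_update_true T i (by simpa using hi)]; omega), mul_zero]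

lemma hom_neg {p : ℤ} (hp : p < 0) {β : (Fin n → Bool) → R} (h : β ∈ Hom R n p) : β = 0 := by
  ext T
  exact h T (by have := dg_nonneg T; omega)

/-- wedge with a vector -/
def W (a : Fin n → R) : ((Fin n → Bool) → R) →ₗ[R] ((Fin n → Bool) → R) := ∑ i, a i • X i

lemma W_apply (a : Fin n → R) (β : (Fin n → Bool) → R) : W a β = ∑ i, a i • X i β := by
  simp [W, LinearMap.sum_apply]

lemma W_hom {p : ℤ} (a : Fin n → R) {β : (Fin n → Bool) → R} (h : β ∈ Hom R n p) :
    W a β ∈ Hom R n (p + 1) := by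
  rw [W_apply]
  exact Submodule.sum_mem _ fun i _ => Submodule.smul_mem _ _ (X_hom i h)

lemma WX (a : Fin n → R) (j : Fin n) (β : (Fin n → Bool) → R) : W a (X j β) = - X j (W a β) := by
  rw [W_apply, W_apply, map_sum, ← Finset.sum_neg_distrib]
  refine Finset.sum_congr rfl fun i _ => ?_
  rw [XX, map_smul, smul_neg]

lemma WW (a b : Fin n → R) (β : (Fin n → Bool) → R) : W a (W b β) = - W b (W a β) := by
  rw [W_apply b, W_apply b, map_sum, ← Finset.sum_neg_distrib]
  refine Finset.sum_congr rfl fun i _ => ?_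
  rw [map_smul, WX, smul_neg]

lemma WW_expand (a b : Fin n → R) (β : (Fin n → Bool) → R) :
    W a (W b β) = ∑ i, ∑ j, (a i * b j) • X i (X j β) := by
  rw [W_apply]
  refine Finset.sum_congr rfl fun i _ => ?_
  rw [W_apply, map_sum, Finset.smul_sum]
  refine Finset.sum_congr rfl fun j _ => ?_
  rw [map_smul, smul_smul]

lemma YW (a : Fin n → R) (k : Fin n) (β : (Fin n → Bool) → R) :
    Y k (W a β) = a k • β - W a (Y k β) := by
  rw [W_apply, W_apply, map_sum]
  simp only [map_smul, YX, smul_sub, Finset.sum_sub_distrib]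
  simp

end Ext
end

section
namespace Ext
variable {R : Type*} [CommRing R]

/-- functions with values in an ideal -/
def LI (n : ℕ) (I : Ideal R) : Submodule R ((Fin n → Bool) → R) where
  carrier := {β | ∀ T, β T ∈ I}
  add_mem' ha hb T := I.add_mem (ha T) (hb T)
  zero_mem' T := I.zero_mem
  smul_mem' c a ha T := I.mul_mem_left _ (ha T)

lemma X_LI {I : Ideal R} (i : Fin n) {β : (Fin n → Bool) → R} (h : β ∈ LI n I) :
    X i β ∈ LI n I := by
  intro T
  rw [X_apply]
  split_ifs
  · exact I.mul_mem_left _ (h _)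
  · exact I.zero_mem

lemma Y_LI {I : Ideal R} (i : Fin n) {β : (Fin n → Bool) → R} (h : β ∈ LI n I) :
    Y i β ∈ LI n I := by
  intro T
  rw [Y_apply]
  split_ifs
  · exact I.zero_mem
  · exact I.mul_mem_left _ (h _)

lemma W_LI {I : Ideal R} (a : Fin n → R) {β : (Fin n → Bool) → R} (h : β ∈ LI n I) :
    W a β ∈ LI n I := by
  rw [W_apply]
  exact Submodule.sum_mem _ fun i _ => Submodule.smul_mem _ _ (X_LI i h)

lemma WW_self (h2 : IsUnit (2 : R)) (a : Fin n → R) (β : (Fin n → Bool) → R) :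
    W a (W a β) = 0 := by
  have h := WW a a β
  have h' : (2 : R) • W a (W a β) = 0 := by
    rw [two_smul]; nth_rewrite 1 [h]; simp
  exact (h2.smul_eq_zero).1 h'

def ExI (a b : Fin n → R) (I : Ideal R) (q : ℕ) (p : ℤ) : Prop :=
  ∀ β : ℕ → ((Fin n → Bool) → R), (∀ i ≤ q, β i ∈ Hom R n p) →
    (∀ i < q, W a (β i) + W b (β (i + 1)) ∈ LI n I) →
    (W a (W b (β q)) ∈ LI n I) →
    ∃ γ : ℕ → ((Fin n → Bool) → R), (∀ i ≤ q + 1, γ i ∈ Hom R n (p - 1)) ∧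
      ∀ i ≤ q, β i - (W a (γ i) + W b (γ (i + 1))) ∈ LI n I

lemma cyc (h2 : IsUnit (2 : R)) (a b : Fin n → R) (I : Ideal R) (q : ℕ)
    (β : ℕ → ((Fin n → Bool) → R))
    (h : ∀ i < q + 1, W a (β i) + W b (β (i + 1)) ∈ LI n I) :
    W a (W b (β (q + 1))) ∈ LI n I := by
  have := W_LI a (h q (Nat.lt_succ_self q))
  rw [map_add, WW_self h2, zero_add] at this
  exact this

lemma homotopy (a b : Fin n → R) (I : Ideal R) (q : ℕ) (p : ℤ) (k l : Fin n)
    (β : ℕ → ((Fin n → Bool) → R)) (hβ : ∀ i ≤ q, β i ∈ Hom R n p)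
    (h1 : ∀ i < q, W a (β i) + W b (β (i + 1)) ∈ LI n I)
    (h2 : W a (W b (β q)) ∈ LI n I) :
    ∃ γ : ℕ → ((Fin n → Bool) → R), (∀ i ≤ q + 1, γ i ∈ Hom R n (p - 1)) ∧
      ∀ i ≤ q, ((a k * b l - a l * b k) ^ 2) • β i - (W a (γ i) + W b (γ (i + 1))) ∈ LI n I := by
  set D := a k * b l - a l * b k with hD
  let u : ((Fin n → Bool) → R) →ₗ[R] ((Fin n → Bool) → R) := b l • Y k - b k • Y l
  let v : ((Fin n → Bool) → R) →ₗ[R] ((Fin n → Bool) → R) := a k • Y l - a l • Y k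
  have hu : ∀ x, u x = b l • Y k x - b k • Y l x := fun x => rfl
  have hv : ∀ x, v x = a k • Y l x - a l • Y k x := fun x => rfl
  have uA : ∀ x, W a (u x) = D • x - u (W a x) := by
    intro x
    simp only [hu, YW, map_sub, map_smul, hD]
    module
  have uB : ∀ x, W b (u x) = - u (W b x) := by
    intro x
    simp only [hu, YW, map_sub, map_smul]
    module
  have vB : ∀ x, W b (v x) = D • x - v (W b x) := by
    intro x
    simp only [hv, YW, map_sub, map_smul, hD]
    module
  have uH : ∀ p x, x ∈ Hom R n p → u x ∈ Hom R n (p - 1) := fun p x hx =>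
    Submodule.sub_mem _ (Submodule.smul_mem _ _ (Y_hom _ hx)) (Submodule.smul_mem _ _ (Y_hom _ hx))
  have vH : ∀ p x, x ∈ Hom R n p → v x ∈ Hom R n (p - 1) := fun p x hx =>
    Submodule.sub_mem _ (Submodule.smul_mem _ _ (Y_hom _ hx)) (Submodule.smul_mem _ _ (Y_hom _ hx))
  have uL : ∀ x, x ∈ LI n I → u x ∈ LI n I := fun x hx =>
    Submodule.sub_mem _ (Submodule.smul_mem _ _ (Y_LI _ hx)) (Submodule.smul_mem _ _ (Y_LI _ hx))
  have vL : ∀ x, x ∈ LI n I → v x ∈ LI n I := fun x hx =>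
    Submodule.sub_mem _ (Submodule.smul_mem _ _ (Y_LI _ hx)) (Submodule.smul_mem _ _ (Y_LI _ hx))
  refine ⟨fun i => if i ≤ q then D • u (β i) else v (u (W a (β q))), ?_, ?_⟩
  · intro i hi
    by_cases hiq : i ≤ q
    · simp only [hiq, if_true]
      exact Submodule.smul_mem _ _ (uH _ _ (hβ i hiq))
    · simp only [hiq, if_false]
      have := vH _ _ (uH _ _ (W_hom a (hβ q le_rfl)))
      convert this using 2
      ring
  · intro i hi
    rcases hi.lt_or_eq with hlt | rfl
    · have h3 : i + 1 ≤ q := hlt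
      simp only [hi, h3, if_true, map_smul, uA, uB]
      have h4 := uL _ (h1 i hlt)
      rw [map_add] at h4
      have := Submodule.smul_mem _ D h4
      convert this using 1
      module
    · have h3 : ¬ (i + 1 ≤ i) := by omega
      simp only [le_refl, h3, if_true, if_false, map_smul, uA, vB, uB]
      have h4 := vL _ (uL _ h2)
      rw [WW] at h4
      have := h4
      convert this using 1
      simp only [map_neg, map_sub, map_smul]
      module

lemma step (h2 : IsUnit (2 : R)) (a b : Fin n → R) (I : Ideal R) (s : R)
    (hs : ∀ x, s * x ∈ I → x ∈ I) (q : ℕ) (p : ℤ)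
    (hrad : ∃ N : ℕ, s ^ N ∈ Ideal.span (Set.range fun kl : Fin n × Fin n =>
      (a kl.1 * b kl.2 - a kl.2 * b kl.1) ^ 2) ⊔ I)
    (hE : ExI a b (I ⊔ Ideal.span {s}) (q + 1) (p - 1)) : ExI a b I q p := by
  intro β hβ h1 h1'
  let G : Ideal R :=
    { carrier := {c | ∃ γ : ℕ → ((Fin n → Bool) → R), (∀ i ≤ q + 1, γ i ∈ Hom R n (p - 1)) ∧
        ∀ i ≤ q, c • β i - (W a (γ i) + W b (γ (i + 1))) ∈ LI n I}
      add_mem' := by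
        rintro c d ⟨γ, g1, g2⟩ ⟨γ', g1', g2'⟩
        refine ⟨γ + γ', fun i hi => Submodule.add_mem _ (g1 i hi) (g1' i hi), fun i hi => ?_⟩
        convert Submodule.add_mem _ (g2 i hi) (g2' i hi) using 1
        simp only [Pi.add_apply, map_add]
        module
      zero_mem' := ⟨0, fun i hi => Submodule.zero_mem _, fun i hi => by simp⟩
      smul_mem' := by
        rintro c d ⟨γ, g1, g2⟩
        refine ⟨c • γ, fun i hi => Submodule.smul_mem _ _ (g1 i hi), fun i hi => ?_⟩
        convert Submodule.smul_mem _ c (g2 i hi) using 1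
        simp only [Pi.smul_apply, map_smul, smul_eq_mul]
        module }
  have hG : Ideal.span (Set.range fun kl : Fin n × Fin n =>
      (a kl.1 * b kl.2 - a kl.2 * b kl.1) ^ 2) ⊔ I ≤ G := by
    refine sup_le (Ideal.span_le.2 ?_) ?_
    · rintro _ ⟨⟨k, l⟩, rfl⟩
      exact homotopy a b I q p k l β hβ h1 h1'
    · intro c hc
      refine ⟨0, fun i hi => Submodule.zero_mem _, fun i hi T => ?_⟩
      simp [Ideal.mul_mem_right _ _ hc]
  obtain ⟨N, hN⟩ := hrad
  have hN := hG hN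
  have key : ∀ M : ℕ, s ^ M ∈ G → (1 : R) ∈ G := by
    intro M
    induction M with
    | zero => intro h; simpa using h
    | succ M ih =>
      rintro ⟨γ, g1, g2⟩
      apply ih
      have hc : ∀ i < q + 1, W a (γ i) + W b (γ (i + 1)) ∈ LI n (I ⊔ Ideal.span {s}) := by
        intro i hi T
        have e1 := g2 i (by omega) T
        have e2 : s ^ (M + 1) * β i T ∈ Ideal.span {s} :=
          Ideal.mem_span_singleton.2 (Dvd.dvd.mul_right (dvd_pow_self s (by omega)) _)
        have := Ideal.sub_mem _ (Ideal.mem_sup_right (S := I) e2)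
          (Ideal.mem_sup_left (T := Ideal.span {s}) e1)
        convert this using 1
        simp
      obtain ⟨ε, e1, e2⟩ := hE γ g1 hc (cyc h2 a b _ q γ hc)
      have hch : ∀ i ≤ q + 1, ∀ T, ∃ y : R,
          γ i T - (W a (ε i) + W b (ε (i + 1))) T - s * y ∈ I := by
        intro i hi T
        obtain ⟨x, hx, z, hz, hxz⟩ := Submodule.mem_sup.1 (e2 i hi T)
        obtain ⟨y, rfl⟩ := Ideal.mem_span_singleton.1 hz
        refine ⟨y, ?_⟩
        have : γ i T - (W a (ε i) + W b (ε (i + 1))) T - s * y = x := by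
          rw [← Pi.sub_apply, ← hxz]; ring
        rwa [this]
      choose! y hy using hch
      let η : ℕ → ((Fin n → Bool) → R) := fun i T => if dg T = p - 1 then y i T else 0
      have hη : ∀ i ≤ q + 1, γ i - (W a (ε i) + W b (ε (i + 1))) - s • η i ∈ LI n I := by
        intro i hi T
        by_cases hT : dg T = p - 1
        · simpa [η, hT] using hy i hi T
        · have z1 := g1 i hi T hT
          have z2 := W_hom a (e1 i (by omega)) T (by omega)
          have z3 := W_hom b (e1 (i + 1) (by omega)) T (by omega)
          simp [η, hT, z1, z2, z3]
      refine ⟨η, fun i hi T hT => by simp [η, hT], fun i hi T => hs _ ?_⟩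
      have f1 := W_LI a (hη i (by omega))
      have f2 := W_LI b (hη (i + 1) (by omega))
      have f3 := Submodule.add_mem _ (g2 i hi) (Submodule.add_mem _ f1 f2)
      have := f3 T
      convert this using 1
      simp only [map_sub, map_add, WW_self h2, map_smul, WW b a]
      simp only [Pi.add_apply, Pi.sub_apply, Pi.smul_apply, smul_eq_mul, Pi.neg_apply, Pi.zero_apply]
      ring
  obtain ⟨γ, g1, g2⟩ := key N hN
  exact ⟨γ, g1, fun i hi => by simpa using g2 i hi⟩

lemma ExI_neg (a b : Fin n → R) (I : Ideal R) (q : ℕ) (p : ℤ) (hp : p < 0) : ExI a b I q p := by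
  intro β hβ _ _
  refine ⟨0, fun i hi => Submodule.zero_mem _, fun i hi => ?_⟩
  rw [hom_neg hp (hβ i hi)]
  simp

/-- the volume element -/
def vol (n : ℕ) (R : Type*) [CommRing R] : (Fin n → Bool) → R :=
  fun T => if T = fun _ => true then 1 else 0

lemma X_vol (i : Fin n) : X i (vol n R) = 0 := by
  ext T
  rw [X_apply]
  split_ifs
  · have : Function.update T i false ≠ fun _ => true := by
      intro h
      have := congrFun h i
      simp at this
    simp [vol, this]
  · rfl

lemma W_vol (a : Fin n → R) : W a (vol n R) = 0 := by
  rw [W_apply]; simp [X_vol]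

lemma vol_hom : vol n R ∈ Hom R n n := by
  intro T hT
  have : T ≠ fun _ => true := by
    rintro rfl
    apply hT
    simp [dg]
  simp [vol, this]

lemma WWYY (a b : Fin n → R) (k l : Fin n) :
    W a (W b (Y k (Y l (vol n R)))) = - ((a k * b l - a l * b k) • vol n R) := by
  have hb : ∀ (b : Fin n → R) k x, W b (Y k x) = b k • x - Y k (W b x) := by
    intro b k x; rw [YW]; simp
  rw [hb, hb]
  simp only [map_sub, map_smul, hb, W_vol, map_zero]
  module

lemma WW_mem (a b : Fin n → R) (η : (Fin n → Bool) → R) (T : Fin n → Bool) :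
    W a (W b η) T ∈ Ideal.span (Set.range fun kl : Fin n × Fin n =>
      a kl.1 * b kl.2 - a kl.2 * b kl.1) := by
  set J := Ideal.span (Set.range fun kl : Fin n × Fin n => a kl.1 * b kl.2 - a kl.2 * b kl.1)
  have hJ : ∀ k l, a k * b l - a l * b k ∈ J := fun k l => Ideal.subset_span ⟨(k, l), rfl⟩
  have hp : ∀ (i j : Fin n), (a i * b j) * X i (X j η) T + (a j * b i) * X j (X i η) T ∈ J := by
    intro i j
    have : (a i * b j) * X i (X j η) T + (a j * b i) * X j (X i η) T
      = (a i * b j - a j * b i) * X i (X j η) T := by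
      rw [XX j i]; simp; ring
    rw [this]
    exact J.mul_mem_right _ (hJ i j)
  rw [WW_expand]
  simp only [Finset.sum_apply, Pi.smul_apply, smul_eq_mul]
  rw [← Finset.sum_product']
  have hsplit : ∑ x ∈ (Finset.univ : Finset (Fin n)) ×ˢ Finset.univ, a x.1 * b x.2 * X x.1 (X x.2 η) T
    = ∑ x ∈ ((Finset.univ : Finset (Fin n)) ×ˢ Finset.univ).filter (fun x => x.1 < x.2),
      (a x.1 * b x.2 * X x.1 (X x.2 η) T + a x.2 * b x.1 * X x.2 (X x.1 η) T) := by
    rw [Finset.sum_add_distrib]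
    rw [← Finset.sum_filter_add_sum_filter_not _ (fun x : Fin n × Fin n => x.1 < x.2)]
    congr 1
    rw [← Finset.sum_filter_add_sum_filter_not _ (fun x : Fin n × Fin n => x.1 = x.2)]
    rw [Finset.sum_eq_zero, zero_add]
    · refine Finset.sum_nbij' Prod.swap Prod.swap ?_ ?_ ?_ ?_ ?_
      · rintro ⟨i, j⟩ h; simp at h ⊢; omega
      · rintro ⟨i, j⟩ h; simp at h ⊢; omega
      · simp
      · simp
      · simp
    · rintro ⟨i, j⟩ h
      have : i = j := by simp at h; exact h.2
      subst this
      simp [XX_self]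
  rw [hsplit]
  exact J.sum_mem fun x _ => hp x.1 x.2

theorem depth (h2 : IsUnit (2 : R)) (a b : Fin n → R) (s : ℕ → R)
    (hreg : ∀ j < n, ∀ x, s j * x ∈ Ideal.span (s '' Set.Iio j) → x ∈ Ideal.span (s '' Set.Iio j))
    (hrad : ∀ j < n, 1 ≤ j → s j ∈ (Ideal.span (Set.range fun kl : Fin n × Fin n =>
      a kl.1 * b kl.2 - a kl.2 * b kl.1) ⊔ Ideal.span {s 0}).radical) (hn : 2 ≤ n)
    (x : R) (hx : s 0 * x ∈ Ideal.span (Set.range fun kl : Fin n × Fin n =>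
      a kl.1 * b kl.2 - a kl.2 * b kl.1)) :
    x ∈ Ideal.span (Set.range fun kl : Fin n × Fin n =>
      a kl.1 * b kl.2 - a kl.2 * b kl.1) := by
  set J := Ideal.span (Set.range fun kl : Fin n × Fin n => a kl.1 * b kl.2 - a kl.2 * b kl.1)
    with hJ
  let I : ℕ → Ideal R := fun j => Ideal.span (s '' Set.Iio j)
  have hI : ∀ j, I (j + 1) = I j ⊔ Ideal.span {s j} := by
    intro j
    have : Set.Iio (j + 1) = Set.Iio j ∪ {j} := by
      ext x; simp [Order.lt_add_one_iff, le_iff_lt_or_eq, or_comm]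
    simp only [I]
    rw [this, Set.image_union, Ideal.span_union, Set.image_singleton]
  have hI1 : ∀ j, Ideal.span {s 0} ≤ I (j + 1) := fun j =>
    Ideal.span_mono (by rintro _ rfl; exact ⟨0, by simp, rfl⟩)
  have hex : ∀ q, q ≤ n - 1 → ExI a b (I (n - 1 - q + 1)) (n - 1 - q) ((n : ℤ) - 2 - (n - 1 - q : ℕ)) := by
    intro q
    induction q with
    | zero => intro _; apply ExI_neg; omega
    | succ q ih =>
      intro hq
      have hE := ih (by omega)
      obtain ⟨j, hj⟩ : ∃ j, j = n - 1 - (q + 1) := ⟨_, rfl⟩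
      rw [show n - 1 - q = j + 1 by omega, hI (j + 1)] at hE
      rw [← hj]
      refine step h2 a b _ (s (j + 1)) (hreg (j + 1) (by omega)) j _ ?_ ?_
      · have h3 : J ⊔ Ideal.span {s 0} ≤ (Ideal.span (Set.range fun kl : Fin n × Fin n =>
            (a kl.1 * b kl.2 - a kl.2 * b kl.1) ^ 2) ⊔ I (j + 1)).radical := by
          refine sup_le (Ideal.span_le.2 ?_) ?_
          · rintro _ ⟨kl, rfl⟩
            exact ⟨2, Ideal.mem_sup_left (Ideal.subset_span ⟨kl, rfl⟩)⟩
          · exact (hI1 j).trans (le_sup_right.trans Ideal.le_radical)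
        have h4 := Ideal.radical_mono h3 (hrad (j + 1) (by omega) (by omega))
        rw [Ideal.radical_idem] at h4
        exact h4
      · convert hE using 1
        push_cast
        omega
  have h0 := hex (n - 1) le_rfl
  simp only [Nat.sub_self, Nat.cast_zero, sub_zero, zero_add] at h0
  have hJ' : ∀ y ∈ J, ∃ η ∈ Hom R n ((n : ℤ) - 2), W a (W b η) = y • vol n R := by
    intro y hy
    refine Submodule.span_induction ?_ ?_ ?_ ?_ hy
    · rintro _ ⟨⟨k, l⟩, rfl⟩
      refine ⟨- Y k (Y l (vol n R)), Submodule.neg_mem _ ?_, ?_⟩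
      · have := Y_hom k (Y_hom l (vol_hom (n := n) (R := R)))
        convert this using 2
        ring
      · simp only [map_neg, WWYY, neg_neg]
    · exact ⟨0, Submodule.zero_mem _, by simp⟩
    · rintro x y _ _ ⟨η, h, h'⟩ ⟨ζ, g, g'⟩
      exact ⟨η + ζ, Submodule.add_mem _ h g, by simp [h', g', add_smul]⟩
    · rintro c x _ ⟨η, h, h'⟩
      exact ⟨c • η, Submodule.smul_mem _ _ h, by simp [h', mul_smul]⟩
  obtain ⟨η, h1, h1'⟩ := hJ' _ hx
  have hs0 : I 1 = Ideal.span {s 0} := by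
    have := hI 0
    simp only [zero_add] at this
    rw [this]
    simp [I]
  obtain ⟨γ, g1, g2⟩ := h0 (fun _ => η) (fun _ _ => h1) (by simp) (by
    rw [h1', hs0]
    intro T
    simp only [Pi.smul_apply, smul_eq_mul, mul_assoc]
    exact Ideal.mem_span_singleton.2 (Dvd.intro _ rfl))
  have g3 := g2 0 le_rfl
  rw [hs0] at g3
  have : ∀ T, ∃ y, (η - (W a (γ 0) + W b (γ 1))) T = s 0 * y := fun T =>
    Ideal.mem_span_singleton.1 (g3 T)
  choose η' hη' using this
  have e : η = W a (γ 0) + W b (γ 1) + s 0 • η' := by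
    ext T
    have := hη' T
    simp only [Pi.add_apply, Pi.sub_apply, Pi.smul_apply, smul_eq_mul] at this ⊢
    linear_combination this
  have e2 : W a (W b η) = s 0 • W a (W b η') := by
    rw [e]
    simp only [map_add, map_smul, WW_self h2, WW b a, map_neg, WW_self h2]
    simp
  rw [h1'] at e2
  have e3 := congrFun e2 (fun _ => true)
  simp only [Pi.smul_apply, smul_eq_mul, vol, if_true, mul_one] at e3
  have e4 : s 0 * (x - W a (W b η') (fun _ => true)) ∈ I 0 := by
    rw [mul_sub, e3, sub_self]; exact Ideal.zero_mem _
  have e5 := hreg 0 (by omega) _ e4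
  have e6 : x - W a (W b η') (fun _ => true) = 0 := by simpa using e5
  rw [sub_eq_zero.1 e6]
  exact WW_mem a b η' _

end Ext
end

section
namespace Ext

lemma wr_iff {R : Type*} [CommRing R] (rs : List R) :
    RingTheory.Sequence.IsWeaklyRegular R rs ↔
    ∀ i (h : i < rs.length), ∀ x, rs[i] * x ∈ Ideal.ofList (rs.take i) →
      x ∈ Ideal.ofList (rs.take i) := by
  rw [RingTheory.Sequence.isWeaklyRegular_iff]
  refine forall_congr' fun i => forall_congr' fun h => ?_
  rw [isSMulRegular_on_quot_iff_lsmul_comap_le]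
  simp only [smul_eq_mul, Ideal.mul_top]
  rfl

lemma mem_span_X {σ : Type*} [DecidableEq σ] (S : Finset σ) (f : MvPowerSeries σ ℂ) :
    f ∈ Ideal.span ((fun i => (MvPowerSeries.X i : MvPowerSeries σ ℂ)) '' (S : Set σ)) ↔
    ∀ d : σ →₀ ℕ, (∀ i ∈ S, d i = 0) → MvPowerSeries.coeff d f = 0 := by
  constructor
  · intro hf
    let I0 : Ideal (MvPowerSeries σ ℂ) :=
      { carrier := {f | ∀ d : σ →₀ ℕ, (∀ i ∈ S, d i = 0) → MvPowerSeries.coeff d f = 0}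
        add_mem' := fun ha hb d hd => by rw [map_add, ha d hd, hb d hd, add_zero]
        zero_mem' := fun d hd => by simp
        smul_mem' := fun c x hx d hd => by
          rw [smul_eq_mul, MvPowerSeries.coeff_mul]
          refine Finset.sum_eq_zero ?_
          rintro ⟨u, v⟩ huv
          have huv := Finset.HasAntidiagonal.mem_antidiagonal.1 huv
          have hv : ∀ i ∈ S, v i = 0 := fun i hi => by
            have := hd i hi
            rw [← huv] at this
            simp at this; exact this.2
          simp [hx v hv] }
    have : Ideal.span ((fun i => (MvPowerSeries.X i : MvPowerSeries σ ℂ)) '' (S : Set σ)) ≤ I0 := by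
      refine Ideal.span_le.2 ?_
      rintro _ ⟨i, hi, rfl⟩ d hd
      exact (MvPowerSeries.X_dvd_iff.1 dvd_rfl) d (hd i hi)
    exact this hf
  · intro h
    induction S using Finset.induction_on generalizing f with
    | empty =>
      have : f = 0 := by ext d; simpa using h d (by simp)
      simp [this]
    | insert i S hi ih =>
      let g : MvPowerSeries σ ℂ := fun d => if d i = 0 then MvPowerSeries.coeff d f else 0
      have hg : ∀ d, MvPowerSeries.coeff d g = if d i = 0 then MvPowerSeries.coeff d f else 0 :=
        fun d => rfl
      have h1 : (MvPowerSeries.X i : MvPowerSeries σ ℂ) ∣ f - g := by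
        rw [MvPowerSeries.X_dvd_iff]
        intro m hm
        rw [map_sub, hg, if_pos hm, sub_self]
      have h2 := ih g (fun d hd => by
        rw [hg]
        split_ifs with hdi
        · apply h
          intro j hj
          rcases Finset.mem_insert.1 hj with rfl | hj
          · exact hdi
          · exact hd j hj
        · rfl)
      have e : f = (f - g) + g := by ring
      rw [e, Finset.coe_insert, Set.image_insert_eq, Ideal.span_insert]
      exact Ideal.add_mem _ (Ideal.mem_sup_left (Ideal.mem_span_singleton.2 h1))
        (Ideal.mem_sup_right h2)


/-- restriction to the first axis -/
def axis (m : ℕ) : MvPowerSeries (Fin (m + 1)) ℂ →+* PowerSeries ℂ :=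
  (PowerSeries.map (MvPowerSeries.constantCoeff)).comp
    (MvPowerSeries.finSuccEquiv ℂ m).toRingEquiv.toRingHom

lemma coeff_axis (m : ℕ) (f : MvPowerSeries (Fin (m + 1)) ℂ) (k : ℕ) :
    PowerSeries.coeff k (axis m f) = MvPowerSeries.coeff (Finsupp.single 0 k) f := by
  have : PowerSeries.coeff k (axis m f) =
      MvPowerSeries.coeff 0 (PowerSeries.coeff k (MvPowerSeries.finSuccEquiv ℂ m f)) := by
    simp [axis]
  rw [this, MvPowerSeries.coeff_coeff_finSuccEquiv]
  congr 1
  congr 1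
  ext i
  refine Fin.cases ?_ (fun j => ?_) i <;> simp [Finsupp.cons]

lemma axis_eq_zero (m : ℕ) (f : MvPowerSeries (Fin (m + 1)) ℂ) :
    axis m f = 0 ↔ f ∈ Ideal.span ((fun i => (MvPowerSeries.X i : MvPowerSeries (Fin (m + 1)) ℂ)) ''
      ((Finset.univ.erase 0 : Finset (Fin (m + 1))) : Set (Fin (m + 1)))) := by
  rw [mem_span_X]
  constructor
  · intro h d hd
    have : d = Finsupp.single 0 (d 0) := by
      ext i
      by_cases hi : i = 0
      · subst hi; simp
      · rw [hd i (by simp [hi]), Finsupp.single_apply, if_neg (Ne.symm hi)]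
    rw [this, ← coeff_axis, h]; simp
  · intro h
    ext k
    rw [coeff_axis, h]
    · simp
    · intro i hi
      have : i ≠ 0 := by simpa using hi
      rw [Finsupp.single_apply, if_neg (Ne.symm this)]

lemma axis_X_zero (m : ℕ) : axis m (MvPowerSeries.X 0) = PowerSeries.X := by
  simp [axis]

lemma axis_X_succ (m : ℕ) (j : Fin m) : axis m (MvPowerSeries.X j.succ) = 0 := by
  simp [axis]

lemma regseq (m : ℕ) (h : MvPowerSeries (Fin (m + 1)) ℂ)
    (h0 : MvPowerSeries.constantCoeff h = 0) (hax : axis m h ≠ 0) :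
    RingTheory.Sequence.IsWeaklyRegular (MvPowerSeries (Fin (m + 1)) ℂ)
      (h :: List.ofFn fun j : Fin m => MvPowerSeries.X j.succ) := by
  have hmax : ∀ f : MvPowerSeries (Fin (m + 1)) ℂ, MvPowerSeries.constantCoeff f = 0 →
      f ∈ IsLocalRing.maximalIdeal (MvPowerSeries (Fin (m + 1)) ℂ) := by
    intro f hf
    rw [IsLocalRing.mem_maximalIdeal, mem_nonunits_iff, MvPowerSeries.isUnit_iff_constantCoeff, hf]
    simp
  have key : RingTheory.Sequence.IsWeaklyRegular (MvPowerSeries (Fin (m + 1)) ℂ)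
      ((List.ofFn fun j : Fin m => (MvPowerSeries.X j.succ : MvPowerSeries (Fin (m + 1)) ℂ)) ++ [h]) := by
    rw [wr_iff]
    have hofl : ∀ i ≤ m, Ideal.ofList (((List.ofFn fun j : Fin m =>
        (MvPowerSeries.X j.succ : MvPowerSeries (Fin (m + 1)) ℂ)) ++ [h]).take i) =
        Ideal.span ((fun i => (MvPowerSeries.X i : MvPowerSeries (Fin (m + 1)) ℂ)) ''
        (((Finset.univ.erase 0).filter (fun j : Fin (m + 1) => (j : ℕ) ≤ i) : Finset (Fin (m + 1))) : Set (Fin (m + 1)))) := by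
      intro i hi
      rw [Ideal.ofList]
      congr 1
      rw [List.take_append_of_le_length (by simpa using hi)]
      ext f
      simp only [Set.mem_ofPred_eq, List.mem_take_iff_getElem, List.getElem_ofFn, List.length_ofFn,
        Set.mem_image, Finset.coe_filter, Finset.mem_erase, Finset.mem_univ, and_true]
      constructor
      · rintro ⟨j, hj, rfl⟩
        exact ⟨Fin.succ ⟨j, by omega⟩, ⟨Fin.succ_ne_zero _, by simp; omega⟩, rfl⟩
      · rintro ⟨j, ⟨hj0, hj⟩, rfl⟩
        obtain ⟨j', rfl⟩ := Fin.exists_succ_eq.2 hj0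
        refine ⟨j', ?_, rfl⟩
        simp at hj
        omega
    intro i hi x hx
    have hi' : i ≤ m := by simp at hi; omega
    rw [hofl i hi'] at hx ⊢
    rcases hi'.lt_or_eq with hlt | rfl
    · rw [mem_span_X] at hx ⊢
      rw [List.getElem_append_left (by simpa using hlt), List.getElem_ofFn] at hx
      intro d hd
      have := hx (Finsupp.single (Fin.succ ⟨i, hlt⟩) 1 + d) (by
        intro j hj
        rw [Finsupp.add_apply, hd j hj, add_zero, Finsupp.single_apply, if_neg]
        rintro rfl
        simp at hj)
      rwa [MvPowerSeries.X, MvPowerSeries.coeff_add_monomial_mul, one_mul] at this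
    · have e : (Finset.univ.erase 0).filter (fun j : Fin (i + 1) => (j : ℕ) ≤ i)
          = Finset.univ.erase 0 := by
        apply Finset.filter_true_of_mem
        intro j _; omega
      rw [e, ← axis_eq_zero] at hx ⊢
      rw [List.getElem_append_right (by simp)] at hx
      simp only [List.length_ofFn, Nat.sub_self, List.getElem_cons_zero, map_mul] at hx
      exact (mul_eq_zero.1 hx).resolve_left hax
  refine IsLocalRing.isWeaklyRegular_of_perm_of_subset_maximalIdeal key ?_ ?_
  · exact List.perm_append_singleton _ _
  · intro r hr
    rw [List.mem_append, List.mem_ofFn, List.mem_singleton] at hr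
    apply hmax
    rcases hr with ⟨j, rfl⟩ | rfl
    · simp
    · exact h0

/-- shear automorphism -/
def shearV (m : ℕ) (c : Fin (m + 1) → ℂ) : Fin (m + 1) → MvPowerSeries (Fin (m + 1)) ℂ :=
  fun i => if i = 0 then MvPowerSeries.X 0 else MvPowerSeries.X i + MvPowerSeries.C (c i) * MvPowerSeries.X 0

lemma shear_hs (m : ℕ) (c : Fin (m + 1) → ℂ) : MvPowerSeries.HasSubst (shearV m c) := by
  apply MvPowerSeries.hasSubst_of_constantCoeff_zero
  intro i
  unfold shearV
  split_ifs <;> simp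

lemma shear_comp (m : ℕ) (c : Fin (m + 1) → ℂ) (f : MvPowerSeries (Fin (m + 1)) ℂ) :
    MvPowerSeries.subst (shearV m c) (MvPowerSeries.subst (shearV m (-c)) f) = f := by
  rw [MvPowerSeries.subst_comp_subst_apply (shear_hs m _) (shear_hs m _)]
  have : (fun s => MvPowerSeries.subst (shearV m c) (shearV m (-c) s)) =
      (MvPowerSeries.X : Fin (m + 1) → MvPowerSeries (Fin (m + 1)) ℂ) := by
    ext1 i
    conv_lhs => rw [shearV]
    split_ifs with h
    · rw [MvPowerSeries.subst_X (shear_hs m c), h]; simp [shearV]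
    · rw [MvPowerSeries.subst_add (shear_hs m c), MvPowerSeries.subst_mul (shear_hs m c),
        MvPowerSeries.subst_X (shear_hs m c), MvPowerSeries.subst_X (shear_hs m c), MvPowerSeries.subst_C]
      simp [shearV, h]
  rw [this, MvPowerSeries.subst_self]; rfl

/-- shear automorphism -/
def shear (m : ℕ) (c : Fin (m + 1) → ℂ) :
    MvPowerSeries (Fin (m + 1)) ℂ ≃ₐ[ℂ] MvPowerSeries (Fin (m + 1)) ℂ :=
  AlgEquiv.ofAlgHom (MvPowerSeries.substAlgHom (shear_hs m c)) (MvPowerSeries.substAlgHom (shear_hs m (-c)))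
    (by ext1 f; simpa [MvPowerSeries.substAlgHom_apply] using shear_comp m c f)
    (by ext1 f; simpa [MvPowerSeries.substAlgHom_apply] using shear_comp m (-c) f)

lemma shear_coe (m : ℕ) (c : Fin (m + 1) → ℂ) (p : MvPolynomial (Fin (m + 1)) ℂ) :
    shear m c (p : MvPowerSeries (Fin (m + 1)) ℂ) = MvPolynomial.aeval (shearV m c) p := by
  exact MvPowerSeries.substAlgHom_coe (shear_hs m c) p

lemma exists_shear (m : ℕ) (h : MvPolynomial (Fin (m + 1)) ℂ) (h0 : h ≠ 0) :
    ∃ c, axis m (shear m c (h : MvPowerSeries (Fin (m + 1)) ℂ)) ≠ 0 := by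
  have : MvPolynomial.X 0 * h ≠ 0 := mul_ne_zero (MvPolynomial.X_ne_zero 0) h0
  obtain ⟨x, hx⟩ : ∃ x, MvPolynomial.eval x (MvPolynomial.X 0 * h) ≠ 0 := by
    by_contra! hcon
    exact this (MvPolynomial.funext fun x => by simpa using hcon x)
  rw [map_mul, MvPolynomial.eval_X] at hx
  have hx0 := left_ne_zero_of_mul hx
  have hxh := right_ne_zero_of_mul hx
  let c : Fin (m + 1) → ℂ := fun i => x i / x 0
  refine ⟨c, fun hax => hxh ?_⟩
  -- the polynomial in one variable
  let v : Fin (m + 1) → ℂ[X] := fun i => Polynomial.C (c i) * Polynomial.X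
  have hc0 : c 0 = 1 := div_self hx0
  have e : axis m (shear m c (h : MvPowerSeries (Fin (m + 1)) ℂ)) =
      ((MvPolynomial.aeval v h : ℂ[X]) : PowerSeries ℂ) := by
    rw [shear_coe]
    have h1 : (axis m).comp (MvPolynomial.aeval (R := ℂ) (shearV m c)).toRingHom =
        (Polynomial.coeToPowerSeries.ringHom).comp (MvPolynomial.aeval (R := ℂ) v).toRingHom := by
      apply MvPolynomial.ringHom_ext
      · intro r
        simp only [RingHom.comp_apply, AlgHom.toRingHom_eq_coe, RingHom.coe_coe, MvPolynomial.algHom_C]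
        simp [axis, MvPowerSeries.algebraMap_apply]
      · intro i
        simp only [RingHom.comp_apply, AlgHom.toRingHom_eq_coe, RingHom.coe_coe, MvPolynomial.aeval_X]
        refine Fin.cases ?_ (fun j => ?_) i
        · simp [shearV, axis_X_zero, v, hc0]
        · simp [shearV, axis_X_zero, axis_X_succ, v, Fin.succ_ne_zero]
          simp [axis]
    exact congrArg (fun φ => φ h) h1
  rw [e] at hax
  have hz : MvPolynomial.aeval v h = 0 := by
    exact_mod_cast hax
  have h2 := congrArg (Polynomial.eval (x 0)) hz
  rw [← Polynomial.coe_evalRingHom, MvPolynomial.aeval_def, MvPolynomial.hom_eval₂] at h2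
  simp only [map_zero] at h2
  rw [← h2, MvPolynomial.eval, MvPolynomial.coe_eval₂Hom]
  congr 1
  · ext r; simp
  · ext i; simp [v, c, hx0]

theorem depth_ps (m : ℕ) (hm : 1 ≤ m) (a b : Fin (m + 1) → MvPowerSeries (Fin (m + 1)) ℂ)
    (h : MvPolynomial (Fin (m + 1)) ℂ) (h0 : h ≠ 0) (hc : MvPolynomial.constantCoeff h = 0)
    (hrad : ∀ i, MvPowerSeries.X i ∈ (Ideal.span (Set.range fun kl : Fin (m + 1) × Fin (m + 1) =>
      a kl.1 * b kl.2 - a kl.2 * b kl.1) ⊔ Ideal.span {(h : MvPowerSeries (Fin (m + 1)) ℂ)}).radical)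
    (x : MvPowerSeries (Fin (m + 1)) ℂ)
    (hx : (h : MvPowerSeries (Fin (m + 1)) ℂ) * x ∈
      Ideal.span (Set.range fun kl : Fin (m + 1) × Fin (m + 1) => a kl.1 * b kl.2 - a kl.2 * b kl.1)) :
    x ∈ Ideal.span (Set.range fun kl : Fin (m + 1) × Fin (m + 1) => a kl.1 * b kl.2 - a kl.2 * b kl.1) := by
  obtain ⟨c, hcax⟩ := exists_shear m h h0
  set J := Ideal.span (Set.range fun kl : Fin (m + 1) × Fin (m + 1) => a kl.1 * b kl.2 - a kl.2 * b kl.1)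
  let σ := shear m c
  let h' := σ (h : MvPowerSeries (Fin (m + 1)) ℂ)
  have hJ' : Ideal.span (Set.range fun kl : Fin (m + 1) × Fin (m + 1) =>
      σ (a kl.1) * σ (b kl.2) - σ (a kl.2) * σ (b kl.1)) = J.map σ := by
    rw [Ideal.map_span, ← Set.range_comp]
    congr 2
    ext1 kl
    simp
  have hcc : ∀ f : MvPowerSeries (Fin (m + 1)) ℂ, MvPowerSeries.constantCoeff f = 0 →
      MvPowerSeries.constantCoeff (σ f) = 0 := by
    intro f hf
    by_contra hne
    have h1 : IsUnit (σ f) := by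
      rw [MvPowerSeries.isUnit_iff_constantCoeff]; exact isUnit_iff_ne_zero.2 hne
    have h2 : IsUnit f := by simpa using h1.map σ.symm
    rw [MvPowerSeries.isUnit_iff_constantCoeff, hf] at h2
    simp at h2
  have hccs : ∀ f : MvPowerSeries (Fin (m + 1)) ℂ, MvPowerSeries.constantCoeff f = 0 →
      MvPowerSeries.constantCoeff (σ.symm f) = 0 := by
    intro f hf
    by_contra hne
    have h1 : IsUnit (σ.symm f) := by
      rw [MvPowerSeries.isUnit_iff_constantCoeff]; exact isUnit_iff_ne_zero.2 hne
    have h2 : IsUnit f := by simpa using h1.map σ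
    rw [MvPowerSeries.isUnit_iff_constantCoeff, hf] at h2
    simp at h2
  have hmspan : ∀ f : MvPowerSeries (Fin (m + 1)) ℂ, MvPowerSeries.constantCoeff f = 0 →
      f ∈ (J ⊔ Ideal.span {(h : MvPowerSeries (Fin (m + 1)) ℂ)}).radical := by
    intro f hf
    have : f ∈ Ideal.span ((fun i => (MvPowerSeries.X i : MvPowerSeries (Fin (m + 1)) ℂ)) ''
        ((Finset.univ : Finset (Fin (m + 1))) : Set (Fin (m + 1)))) := by
      rw [mem_span_X]
      intro d hd
      have : d = 0 := by ext i; simpa using hd i (by simp)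
      rw [this]; simpa using hf
    refine Ideal.span_le.2 ?_ this
    rintro _ ⟨i, _, rfl⟩
    exact hrad i
  have hh0 : MvPowerSeries.constantCoeff (h : MvPowerSeries (Fin (m + 1)) ℂ) = 0 := by
    rw [← MvPowerSeries.coeff_zero_eq_constantCoeff_apply, MvPolynomial.coeff_coe]
    simpa [MvPolynomial.constantCoeff_eq] using hc
  have hreg := regseq m h' (hcc _ hh0) hcax
  rw [wr_iff] at hreg
  let s : ℕ → MvPowerSeries (Fin (m + 1)) ℂ := fun j =>
    if j = 0 then h' else if hj : j < m + 1 then MvPowerSeries.X ⟨j, hj⟩ else 0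
  have hs : ∀ j (hj : j < (h' :: List.ofFn fun j : Fin m =>
      (MvPowerSeries.X j.succ : MvPowerSeries (Fin (m + 1)) ℂ)).length),
      (h' :: List.ofFn fun j : Fin m => (MvPowerSeries.X j.succ : MvPowerSeries (Fin (m + 1)) ℂ))[j] = s j := by
    intro j hj
    cases j with
    | zero => simp [s]
    | succ j =>
      simp at hj
      simp [s, hj]
  have hofl : ∀ j ≤ m, Ideal.ofList ((h' :: List.ofFn fun j : Fin m =>
      (MvPowerSeries.X j.succ : MvPowerSeries (Fin (m + 1)) ℂ)).take j) = Ideal.span (s '' Set.Iio j) := by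
    intro j hj
    rw [Ideal.ofList]
    congr 1
    ext f
    simp only [Set.mem_ofPred_eq, List.mem_take_iff_getElem, Set.mem_image, Set.mem_Iio]
    constructor
    · rintro ⟨i, hi, rfl⟩
      exact ⟨i, by omega, (hs i _).symm⟩
    · rintro ⟨i, hi, rfl⟩
      exact ⟨i, by simp; omega, hs i _⟩
  have main := depth (n := m + 1) (R := MvPowerSeries (Fin (m + 1)) ℂ)
    (by
      rw [MvPowerSeries.isUnit_iff_constantCoeff, map_ofNat]
      exact isUnit_iff_ne_zero.2 two_ne_zero)
    (fun i => σ (a i)) (fun i => σ (b i)) s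
    (by
      intro j hj y hy
      have := hreg j (by simpa using hj) y
      rw [hofl j (by omega), hs j] at this
      exact this hy)
    (by
      intro j hj h1
      have hsj : MvPowerSeries.constantCoeff (s j) = 0 := by
        simp only [s, hj, show j ≠ 0 by omega, if_false, dif_pos]
        simp
      obtain ⟨N, hN⟩ := hmspan _ (hccs _ hsj)
      refine ⟨N, ?_⟩
      rw [hJ']
      have := Ideal.mem_map_of_mem σ hN
      rw [Ideal.map_sup, Ideal.map_span (s := {_}), Set.image_singleton, map_pow, AlgEquiv.apply_symm_apply] at this
      simpa [s] using this)
    (by omega) (σ x)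
    (by
      rw [hJ']
      have := Ideal.mem_map_of_mem σ hx
      rw [map_mul] at this
      simpa [s] using this)
  rw [hJ'] at main
  obtain ⟨y, hy, hxy⟩ := (Ideal.mem_map_iff_of_surjective σ σ.surjective).1 main
  rwa [← σ.injective hxy]

end Ext
end

section
namespace BR
open Ext (mem_span_X depth_ps)

open IsDedekindDomain WithZero

section E1
variable {S : Type*} [CommRing S] [IsDedekindDomain S] [Algebra ℂ S] (v : HeightOneSpectrum S)

lemma poly_fac (q : ℂ[X]) (hq : q ≠ 0) : ∃ (k : ℕ) (r : ℂ[X]), q = X ^ k * r ∧ r.eval 0 ≠ 0 := by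
  obtain ⟨r, h1, h2⟩ := Polynomial.exists_eq_pow_rootMultiplicity_mul_and_not_dvd q hq 0
  refine ⟨_, r, by simpa using h1, ?_⟩
  rw [Polynomial.dvd_iff_isRoot] at h2
  exact h2

lemma v_poly (s : S) (hs : v.intValuation s = exp (-1 : ℤ)) (k : ℕ) (r : ℂ[X]) (hr : r.eval 0 ≠ 0) :
    v.intValuation (aeval s (X ^ k * r)) = exp (-(k:ℤ)) := by
  have hsP : s ∈ v.asIdeal := by
    rw [← HeightOneSpectrum.intValuation_lt_one_iff_mem, hs, ← exp_zero, exp_lt_exp]; norm_num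
  have h1 : v.intValuation (aeval s r) = 1 := by
    rw [HeightOneSpectrum.intValuation_eq_one_iff]
    intro hm
    have : aeval s r - algebraMap ℂ S (r.eval 0) ∈ v.asIdeal := by
      have : X ∣ r - C (r.eval 0) := by
        rw [Polynomial.X_dvd_iff]; simp [Polynomial.coeff_zero_eq_eval_zero]
      obtain ⟨w, hw⟩ := this
      have := congrArg (aeval s) hw
      simp only [map_sub, aeval_C, map_mul, aeval_X] at this
      rw [this]; exact Ideal.mul_mem_right _ _ hsP
    have h3 : algebraMap ℂ S (r.eval 0) ∈ v.asIdeal := by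
      have := Ideal.sub_mem _ hm this
      simpa using this
    exact v.isPrime.ne_top (Ideal.eq_top_of_isUnit_mem _ h3 ((Ne.isUnit hr).map (algebraMap ℂ S)))
  rw [map_mul, map_pow, aeval_X, map_mul, map_pow, h1, hs, mul_one, ← exp_nsmul]
  simp

lemma approx (hres : ∀ y : S, ∃ c : ℂ, y - algebraMap ℂ S c ∈ v.asIdeal) (s : S)
    (hs : v.intValuation s = exp (-1 : ℤ)) (y : S) (N : ℕ) :
    ∃ q : ℂ[X], y - aeval s q ∈ v.asIdeal ^ N := by
  induction N with
  | zero => exact ⟨0, by simp⟩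
  | succ N ih =>
    obtain ⟨q, hq⟩ := ih
    have hsN : s ^ N ∈ v.asIdeal ^ N := by
      rw [← HeightOneSpectrum.intValuation_le_pow_iff_mem, map_pow, hs, ← exp_nsmul]
      simp
    have hsN' : s ^ N ∉ v.asIdeal ^ (N+1) := by
      rw [← HeightOneSpectrum.intValuation_le_pow_iff_mem, map_pow, hs, ← exp_nsmul, exp_le_exp]
      simp
    have := v.isPrime
    obtain ⟨d, e, he, hd⟩ := Ideal.exists_mul_add_mem_pow_succ v.ne_bot _ _ hsN hsN' hq
    obtain ⟨c, hc⟩ := hres d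
    refine ⟨q + C c * X ^ N, ?_⟩
    have : y - aeval s (q + C c * X ^ N) = s ^ N * (d - algebraMap ℂ S c) + e := by
      simp only [map_add, map_mul, map_pow, aeval_X, aeval_C]
      linear_combination -hd
    rw [this]
    exact Ideal.add_mem _ (by rw [pow_succ]; exact Ideal.mul_mem_mul hsN hc) he

lemma v_congr (s : S) (hs : v.intValuation s = exp (-1 : ℤ)) (y : S) (q : ℂ[X]) (N k : ℕ)
    (hq : y - aeval s q ∈ v.asIdeal ^ N) (hk : v.intValuation y = exp (-(k:ℤ))) (hkN : k < N) :
    ∃ r : ℂ[X], q = X ^ k * r ∧ r.eval 0 ≠ 0 := by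
  have h1 : v.intValuation (aeval s q) = exp (-(k:ℤ)) := by
    rw [← HeightOneSpectrum.intValuation_le_pow_iff_mem] at hq
    have h2 : aeval s q = y - (y - aeval s q) := by ring
    rw [h2, Valuation.map_sub_eq_of_lt_left, hk]
    rw [hk]
    refine lt_of_le_of_lt hq ?_
    rw [exp_lt_exp]; omega
  have h0 : q ≠ 0 := by
    rintro rfl
    simp at h1
    exact exp_ne_zero h1.symm
  obtain ⟨l, r, h2, h3⟩ := poly_fac q h0
  rw [h2, v_poly v s hs l r h3, exp_inj] at h1
  have : l = k := by omega
  subst this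
  exact ⟨r, h2, h3⟩

lemma X_dvd_of_mem (s : S) (hs : v.intValuation s = exp (-1 : ℤ)) (q : ℂ[X]) (N : ℕ)
    (hq : aeval s q ∈ v.asIdeal ^ N) : X ^ N ∣ q := by
  by_cases h0 : q = 0
  · simp [h0]
  obtain ⟨l, r, h2, h3⟩ := poly_fac q h0
  rw [← HeightOneSpectrum.intValuation_le_pow_iff_mem, h2, v_poly v s hs l r h3, exp_le_exp] at hq
  rw [h2]
  exact Dvd.dvd.mul_right (pow_dvd_pow _ (by omega)) _

lemma aeval_congr {A : Type*} [CommRing A] [Algebra ℂ A] (I : Ideal A) (ξ η : Fin n → A)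
    (h : ∀ i, ξ i - η i ∈ I) (f : MvPolynomial (Fin n) ℂ) :
    MvPolynomial.aeval ξ f - MvPolynomial.aeval η f ∈ I := by
  rw [← Ideal.Quotient.eq]
  have : (Ideal.Quotient.mkₐ ℂ I).comp (MvPolynomial.aeval ξ) =
      (Ideal.Quotient.mkₐ ℂ I).comp (MvPolynomial.aeval η) := by
    apply MvPolynomial.algHom_ext
    intro i
    simp
    exact Ideal.Quotient.eq.2 (h i)
  exact DFunLike.congr_fun this f

lemma chain (ξ : Fin n → ℂ[X]) (f : MvPolynomial (Fin n) ℂ) :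
    derivative (MvPolynomial.aeval ξ f) =
      ∑ i, MvPolynomial.aeval ξ (MvPolynomial.pderiv i f) * derivative (ξ i) := by
  induction f using MvPolynomial.induction_on with
  | C a => simp [MvPolynomial.algebraMap_eq]
  | add p q hp hq => simp [hp, hq, add_mul, Finset.sum_add_distrib]
  | mul_X p i hp =>
    simp only [map_mul, MvPolynomial.aeval_X, Polynomial.derivative_mul, hp, Derivation.leibniz,
      smul_eq_mul, MvPolynomial.pderiv_X, map_add, add_mul, Finset.sum_add_distrib]
    rw [add_comm]
    congr 1
    · rw [Finset.sum_eq_single i]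
      · simp
      · intro j _ hj; simp [Pi.single_apply, hj, hj.symm]
      · simp
    · rw [Finset.sum_mul]; refine Finset.sum_congr rfl fun j _ => by ring

lemma deriv_fac (a : ℕ) (ha : 1 ≤ a) (r : ℂ[X]) (hr : r.eval 0 ≠ 0) :
    ∃ r' : ℂ[X], derivative (X ^ a * r) = X ^ (a - 1) * r' ∧ r'.eval 0 ≠ 0 := by
  obtain ⟨b, rfl⟩ : ∃ b, a = b + 1 := ⟨a - 1, by omega⟩
  refine ⟨C ((b:ℂ)+1) * r + X * derivative r, ?_, ?_⟩
  · simp [Polynomial.derivative_X_pow]; ring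
  · simp [hr]; exact_mod_cast Nat.succ_ne_zero b

lemma exp_cmp (p q N : ℕ) (U W : ℂ[X]) (hU : U.eval 0 ≠ 0) (hW : W.eval 0 ≠ 0) (hp : p < N)
    (hd : X ^ N ∣ X ^ p * U - X ^ q * W) : q ≤ p := by
  by_contra hlt
  push Not at hlt
  have h1 : X ^ (p + 1) ∣ X ^ p * U := by
    have h2 : (X : ℂ[X]) ^ (p+1) ∣ X ^ q * W := Dvd.dvd.mul_right (pow_dvd_pow _ (by omega)) _
    have h3 := ((pow_dvd_pow (X : ℂ[X]) (show p + 1 ≤ N by omega)).trans hd).add h2 |> fun h => h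
    have := dvd_add ((pow_dvd_pow (X : ℂ[X]) (show p + 1 ≤ N by omega)).trans hd) h2
    simpa using this
  rw [pow_succ] at h1
  have := (mul_dvd_mul_iff_left (pow_ne_zero p X_ne_zero)).1 h1
  rw [Polynomial.X_dvd_iff, Polynomial.coeff_zero_eq_eval_zero] at this
  exact hU this

theorem val_eq (hres : ∀ y : S, ∃ c : ℂ, y - algebraMap ℂ S c ∈ v.asIdeal)
    (ξ : Fin n → S) (f h g g' : MvPolynomial (Fin n) ℂ)
    (hf : MvPolynomial.aeval ξ f ∈ v.asIdeal) (hh : MvPolynomial.aeval ξ h ∈ v.asIdeal)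
    (hf0 : MvPolynomial.aeval ξ f ≠ 0) (hh0 : MvPolynomial.aeval ξ h ≠ 0)
    (hg0 : MvPolynomial.aeval ξ g ≠ 0) (hg'0 : MvPolynomial.aeval ξ g' ≠ 0)
    (hrel : ∀ i, MvPolynomial.aeval ξ
      (MvPolynomial.pderiv i f * g' - MvPolynomial.pderiv i h * g) = 0) :
    v.intValuation (MvPolynomial.aeval ξ (g' * f)) = v.intValuation (MvPolynomial.aeval ξ (g * h)) := by
  obtain ⟨s, hs⟩ := v.intValuation_exists_uniformizer
  have ex : ∀ y : S, y ≠ 0 → ∃ k : ℕ, v.intValuation y = exp (-(k:ℤ)) := fun y hy =>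
    ⟨_, v.intValuation_eq_exp_neg_multiplicity hy⟩
  obtain ⟨a, ha⟩ := ex _ hf0
  obtain ⟨b, hb⟩ := ex _ hh0
  obtain ⟨u, hu⟩ := ex _ hg0
  obtain ⟨u', hu'⟩ := ex _ hg'0
  have ha1 : 1 ≤ a := by
    rw [← HeightOneSpectrum.intValuation_lt_one_iff_mem, ha, ← exp_zero, exp_lt_exp] at hf; omega
  have hb1 : 1 ≤ b := by
    rw [← HeightOneSpectrum.intValuation_lt_one_iff_mem, hb, ← exp_zero, exp_lt_exp] at hh; omega
  obtain ⟨N, hN⟩ : ∃ N, N = a + b + u + u' + 1 := ⟨_, rfl⟩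
  choose η hη using fun i => approx v hres s hs (ξ i) N
  have hcong : ∀ p : MvPolynomial (Fin n) ℂ,
      MvPolynomial.aeval ξ p - aeval s (MvPolynomial.aeval η p) ∈ v.asIdeal ^ N := by
    intro p
    have h1 := aeval_congr (v.asIdeal ^ N) ξ (fun i => aeval s (η i)) hη p
    have h2 : MvPolynomial.aeval (fun i => aeval s (η i)) p = aeval s (MvPolynomial.aeval η p) := by
      have : MvPolynomial.aeval (fun i => aeval s (η i)) = (aeval s : ℂ[X] →ₐ[ℂ] S).comp
          (MvPolynomial.aeval η) := MvPolynomial.algHom_ext (fun i => by simp)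
      rw [this]; rfl
    rwa [h2] at h1
  obtain ⟨F, hF, hF0⟩ := v_congr v s hs _ _ N a (hcong f) ha (by omega)
  obtain ⟨H, hH, hH0⟩ := v_congr v s hs _ _ N b (hcong h) hb (by omega)
  obtain ⟨G, hG, hG0⟩ := v_congr v s hs _ _ N u (hcong g) hu (by omega)
  obtain ⟨G', hG', hG'0⟩ := v_congr v s hs _ _ N u' (hcong g') hu' (by omega)
  have hrel' : ∀ i, X ^ N ∣ MvPolynomial.aeval η
      (MvPolynomial.pderiv i f * g' - MvPolynomial.pderiv i h * g) := by
    intro i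
    apply X_dvd_of_mem v s hs
    have := hcong (MvPolynomial.pderiv i f * g' - MvPolynomial.pderiv i h * g)
    rw [hrel i, zero_sub] at this
    exact (Ideal.neg_mem_iff _).1 this
  have hdvd : X ^ N ∣ derivative (MvPolynomial.aeval η f) * MvPolynomial.aeval η g' -
      derivative (MvPolynomial.aeval η h) * MvPolynomial.aeval η g := by
    rw [chain, chain, Finset.sum_mul, Finset.sum_mul, ← Finset.sum_sub_distrib]
    refine Finset.dvd_sum fun i _ => ?_
    have := (hrel' i).mul_right (derivative (η i))
    convert this using 1
    simp only [map_sub, map_mul]; ring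
  obtain ⟨F', e1, hF'0⟩ := deriv_fac a ha1 F hF0
  obtain ⟨H', e2, hH'0⟩ := deriv_fac b hb1 H hH0
  rw [hF, hH, hG, hG', e1, e2] at hdvd
  have hd1 : X ^ N ∣ X ^ (a - 1 + u') * (F' * G') - X ^ (b - 1 + u) * (H' * G) := by
    convert hdvd using 1; ring
  have hd2 : X ^ N ∣ X ^ (b - 1 + u) * (H' * G) - X ^ (a - 1 + u') * (F' * G') := by
    rw [dvd_sub_comm]; exact hd1
  have i1 := exp_cmp _ _ N _ _ (by simp [hF'0, hG'0]) (by simp [hH'0, hG0]) (by omega) hd1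
  have i2 := exp_cmp _ _ N _ _ (by simp [hH'0, hG0]) (by simp [hF'0, hG'0]) (by omega) hd2
  rw [map_mul, map_mul, map_mul, map_mul, ha, hb, hu, hu', ← exp_add, ← exp_add, exp_inj]
  omega

end E1
end BR
end

section
namespace BR
open Ext (mem_span_X depth_ps)

open IsDedekindDomain WithZero

lemma ps_fac (c : PowerSeries ℂ) (hc : c ≠ 0) : ∃ (k : ℕ) (u : PowerSeries ℂ), IsUnit u ∧ c = PowerSeries.X ^ k * u := by
  refine ⟨c.order.toNat, PowerSeries.divXPowOrder c, ?_, ?_⟩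
  · rw [PowerSeries.isUnit_iff_constantCoeff, isUnit_iff_ne_zero]
    exact fun h => hc (PowerSeries.constantCoeff_divXPowOrder_eq_zero_iff.1 h)
  · exact (PowerSeries.X_pow_order_mul_divXPowOrder).symm

lemma res_field {S : Type*} [CommRing S] [Algebra (PowerSeries ℂ) S] [Algebra ℂ S]
    [IsScalarTower ℂ (PowerSeries ℂ) S] [Algebra.IsIntegral (PowerSeries ℂ) S] (P : Ideal S) [P.IsPrime]
    (ht : algebraMap (PowerSeries ℂ) S PowerSeries.X ∈ P) (y : S) :
    ∃ c : ℂ, y - algebraMap ℂ S c ∈ P := by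
  obtain ⟨q, hq, hq0⟩ := Algebra.IsIntegral.isIntegral (R := PowerSeries ℂ) y
  let q0 : ℂ[X] := q.map (PowerSeries.constantCoeff)
  have hmon : q0.Monic := hq.map _
  have key : (Ideal.Quotient.mk P).comp (algebraMap (PowerSeries ℂ) S) =
      ((Ideal.Quotient.mk P).comp (algebraMap ℂ S)).comp (PowerSeries.constantCoeff) := by
    ext c
    have : c - PowerSeries.C (PowerSeries.constantCoeff c) ∈ Ideal.span {(PowerSeries.X : PowerSeries ℂ)} := by
      rw [Ideal.mem_span_singleton, PowerSeries.X_dvd_iff]; simp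
    obtain ⟨d, hd⟩ := Ideal.mem_span_singleton.1 this
    simp only [RingHom.comp_apply]
    rw [Ideal.Quotient.eq, IsScalarTower.algebraMap_apply ℂ (PowerSeries ℂ) S, ← map_sub]
    have e : algebraMap ℂ (PowerSeries ℂ) (PowerSeries.constantCoeff c) =
      PowerSeries.C (PowerSeries.constantCoeff c) := rfl
    rw [e, hd, map_mul]
    exact Ideal.mul_mem_right _ _ ht
  have h1 : eval₂ ((Ideal.Quotient.mk P).comp (algebraMap ℂ S)) (Ideal.Quotient.mk P y) q0 = 0 := by
    rw [Polynomial.eval₂_map, ← key, ← Polynomial.hom_eval₂, hq0, map_zero]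
  have hs : q0 = (q0.roots.map fun a => X - C a).prod := by
    have := (IsAlgClosed.splits q0).eq_prod_roots
    rw [hmon.leadingCoeff] at this
    simpa using this
  rw [hs, ← Polynomial.coe_eval₂RingHom, map_multiset_prod, Multiset.prod_eq_zero_iff,
    Multiset.map_map, Multiset.mem_map] at h1
  obtain ⟨a, _, ha⟩ := h1
  refine ⟨a, ?_⟩
  rw [← Ideal.Quotient.eq, ← sub_eq_zero]
  simpa using ha

theorem integral_rel {A : Type*} [CommRing A] [IsDomain A] [Algebra (PowerSeries ℂ) A] [Algebra ℂ A]
    [IsScalarTower ℂ (PowerSeries ℂ) A] [Module.Finite (PowerSeries ℂ) A]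
    (hinj : Function.Injective (algebraMap (PowerSeries ℂ) A))
    (ξ : Fin n → A) (f h g g' : MvPolynomial (Fin n) ℂ)
    (hth : algebraMap (PowerSeries ℂ) A PowerSeries.X = MvPolynomial.aeval ξ h)
    (htf : ∃ k, MvPolynomial.aeval ξ f ^ k ∈ Ideal.span {MvPolynomial.aeval ξ h})
    (hf0 : MvPolynomial.aeval ξ f ≠ 0) (hh0 : MvPolynomial.aeval ξ h ≠ 0)
    (hg0 : MvPolynomial.aeval ξ g ≠ 0) (hg'0 : MvPolynomial.aeval ξ g' ≠ 0)
    (hrel : ∀ i, MvPolynomial.aeval ξ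
      (MvPolynomial.pderiv i f * g' - MvPolynomial.pderiv i h * g) = 0) :
    (∃ q : A[X], q.Monic ∧ (q.scaleRoots (MvPolynomial.aeval ξ (g' * f))).eval
      (MvPolynomial.aeval ξ (g * h)) = 0) ∧
    (∃ q : A[X], q.Monic ∧ (q.scaleRoots (MvPolynomial.aeval ξ (g * h))).eval
      (MvPolynomial.aeval ξ (g' * f)) = 0) := by
  let L := FractionRing A
  let K := FractionRing (PowerSeries ℂ)
  have : FaithfulSMul (PowerSeries ℂ) A := (faithfulSMul_iff_algebraMap_injective _ _).2 hinj
  let _ : Algebra K L := FractionRing.liftAlgebra _ _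
  have : IsScalarTower (PowerSeries ℂ) K L := inferInstance
  have : FiniteDimensional K L := .of_isLocalization (PowerSeries ℂ) A (nonZeroDivisors (PowerSeries ℂ))
  have : CharZero K := charZero_of_injective_algebraMap (R := ℂ) ((algebraMap ℂ K).injective)
  have : Algebra.IsSeparable K L := inferInstance
  let S := integralClosure (PowerSeries ℂ) L
  have : IsDedekindDomain S := integralClosure.isDedekindDomain (PowerSeries ℂ) K L
  have : IsFractionRing S L := integralClosure.isFractionRing_of_finite_extension K L
  have hintA : ∀ a : A, IsIntegral (PowerSeries ℂ) (algebraMap A L a) := fun a =>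
    (Algebra.IsIntegral.isIntegral (R := PowerSeries ℂ) a).algebraMap
  let ξ' : Fin n → S := fun i => ⟨algebraMap A L (ξ i), hintA _⟩
  have : IsScalarTower ℂ (PowerSeries ℂ) L := inferInstance
  have hev : ∀ p : MvPolynomial (Fin n) ℂ, ((MvPolynomial.aeval ξ' p : S) : L) =
      algebraMap A L (MvPolynomial.aeval ξ p) := by
    intro p
    induction p using MvPolynomial.induction_on with
    | C a =>
      rw [MvPolynomial.aeval_C, MvPolynomial.aeval_C, IsScalarTower.algebraMap_apply ℂ (PowerSeries ℂ) S,
        ← IsScalarTower.algebraMap_apply ℂ A L, IsScalarTower.algebraMap_apply ℂ (PowerSeries ℂ) L]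
      rfl
    | add p q hp hq => simp [hp, hq]
    | mul_X p i hp => simp [hp, ξ']
  have hALinj : Function.Injective (algebraMap A L) := IsFractionRing.injective A L
  have hne : ∀ p : MvPolynomial (Fin n) ℂ, MvPolynomial.aeval ξ p ≠ 0 → MvPolynomial.aeval ξ' p ≠ 0 := by
    intro p hp h0
    apply hp
    apply hALinj
    rw [← hev, h0]; simp
  have hval : ∀ v : HeightOneSpectrum S, v.intValuation (MvPolynomial.aeval ξ' (g' * f)) =
      v.intValuation (MvPolynomial.aeval ξ' (g * h)) := by
    intro v
    have hvp := v.isPrime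
    have ht : algebraMap (PowerSeries ℂ) S PowerSeries.X ∈ v.asIdeal := by
      have h1 := Ideal.IsIntegral.comap_ne_bot (R := PowerSeries ℂ) v.ne_bot
      obtain ⟨c, hc, hc0⟩ := Submodule.exists_mem_ne_zero_of_ne_bot h1
      obtain ⟨k, u, hu, rfl⟩ := ps_fac c hc0
      have h2 : (PowerSeries.X : PowerSeries ℂ) ^ k ∈ Ideal.comap (algebraMap (PowerSeries ℂ) S) v.asIdeal :=
        (Ideal.mul_unit_mem_iff_mem _ hu).1 hc
      exact hvp.mem_of_pow_mem k (by rw [← map_pow]; exact h2)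
    have hhP : MvPolynomial.aeval ξ' h ∈ v.asIdeal := by
      convert ht
      apply Subtype.ext
      rw [hev, ← hth]
      exact (IsScalarTower.algebraMap_apply (PowerSeries ℂ) A L _).symm
    have hfP : MvPolynomial.aeval ξ' f ∈ v.asIdeal := by
      obtain ⟨k, hk⟩ := htf
      obtain ⟨a, ha⟩ := Ideal.mem_span_singleton.1 hk
      apply hvp.mem_of_pow_mem k
      have : MvPolynomial.aeval ξ' f ^ k = MvPolynomial.aeval ξ' h * ⟨algebraMap A L a, hintA a⟩ := by
        apply Subtype.ext
        push_cast
        rw [hev, hev, ← map_pow, ha, map_mul]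
      rw [this]
      exact Ideal.mul_mem_right _ _ hhP
    refine val_eq v (res_field v.asIdeal ht) ξ' f h g g' hfP hhP (hne _ hf0) (hne _ hh0) (hne _ hg0)
      (hne _ hg'0) ?_
    intro i
    apply Subtype.ext
    rw [hev, hrel i]; simp
  have main : ∀ p q : MvPolynomial (Fin n) ℂ, MvPolynomial.aeval ξ p ≠ 0 → 
      (∀ v : HeightOneSpectrum S, v.intValuation (MvPolynomial.aeval ξ' q) =
      v.intValuation (MvPolynomial.aeval ξ' p)) →
      (∃ w : A[X], w.Monic ∧ (w.scaleRoots (MvPolynomial.aeval ξ p)).eval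
      (MvPolynomial.aeval ξ q) = 0) := by
    intro p q hp hv
    have h1 : algebraMap A L (MvPolynomial.aeval ξ q) / algebraMap A L (MvPolynomial.aeval ξ p)
        ∈ (algebraMap S L).range := by
      apply HeightOneSpectrum.mem_integers_of_valuation_le_one
      intro v
      rw [← hev, ← hev, map_div₀]
      have e1 : ∀ s : S, (s : L) = algebraMap S L s := fun _ => rfl
      rw [e1, e1, HeightOneSpectrum.valuation_of_algebraMap, HeightOneSpectrum.valuation_of_algebraMap,
        hv v, div_self]
      exact v.intValuation_ne_zero _ (hne _ hp)
    obtain ⟨y, hy⟩ := h1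
    obtain ⟨w, hw, hw0⟩ := y.2
    refine ⟨w.map (algebraMap (PowerSeries ℂ) A), hw.map _, ?_⟩
    apply hALinj
    rw [map_zero]
    have := Polynomial.scaleRoots_aeval_eq_zero_of_aeval_div_eq_zero (K := L) hALinj
      (p := w.map (algebraMap (PowerSeries ℂ) A)) (r := MvPolynomial.aeval ξ q) (s := MvPolynomial.aeval ξ p)
      (by
        rw [← hy, Polynomial.aeval_map_algebraMap]
        exact hw0) (mem_nonZeroDivisors_of_ne_zero hp)
    rwa [Polynomial.aeval_algebraMap_apply_eq_algebraMap_eval] at this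
  exact ⟨main _ _ (by rw [map_mul]; exact mul_ne_zero hg'0 hf0) (fun v => (hval v).symm),
    main _ _ (by rw [map_mul]; exact mul_ne_zero hg0 hh0) hval⟩

end BR
end

section
namespace BR
open Ext (mem_span_X depth_ps)

/-- power series all of whose coefficients of degree `< K` vanish -/
def OK (n K : ℕ) : Ideal (MvPowerSeries (Fin n) ℂ) where
  carrier := {f | ∀ d : Fin n →₀ ℕ, d.degree < K → MvPowerSeries.coeff d f = 0}
  add_mem' := fun ha hb d hd => by rw [map_add, ha d hd, hb d hd, add_zero]
  zero_mem' := fun d hd => by simp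
  smul_mem' := fun c f hf d hd => by
    rw [smul_eq_mul, MvPowerSeries.coeff_mul]
    refine Finset.sum_eq_zero fun p hp => ?_
    rw [Finset.HasAntidiagonal.mem_antidiagonal] at hp
    have : p.2.degree < K := by
      rw [← hp, map_add] at hd; omega
    rw [hf _ this, mul_zero]

lemma mem_OK {K : ℕ} {f : MvPowerSeries (Fin n) ℂ} :
    f ∈ OK n K ↔ ∀ d : Fin n →₀ ℕ, d.degree < K → MvPowerSeries.coeff d f = 0 := Iff.rfl

lemma mul_OK {K L : ℕ} {f g : MvPowerSeries (Fin n) ℂ} (hf : f ∈ OK n K) (hg : g ∈ OK n L) :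
    f * g ∈ OK n (K + L) := by
  intro d hd
  rw [MvPowerSeries.coeff_mul]
  refine Finset.sum_eq_zero fun p hp => ?_
  rw [Finset.HasAntidiagonal.mem_antidiagonal] at hp
  rw [← hp, map_add] at hd
  by_cases h : p.1.degree < K
  · rw [hf _ h, zero_mul]
  · rw [hg p.2 (by omega), mul_zero]

/-- the maximal ideal of the power series ring -/
def mR (n : ℕ) : Ideal (MvPowerSeries (Fin n) ℂ) :=
  Ideal.span (Set.range fun i => MvPowerSeries.X i)

lemma X_mem_OK (i : Fin n) : (MvPowerSeries.X i : MvPowerSeries (Fin n) ℂ) ∈ OK n 1 := by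
  intro d hd
  have : d = 0 := by
    rw [← Finsupp.degree_eq_zero_iff]; omega
  subst this
  simp

lemma mR_pow_le (K : ℕ) : mR n ^ K ≤ OK n K := by
  induction K with
  | zero => intro f _ d hd; omega
  | succ K ih =>
    rw [pow_succ, Ideal.mul_le]
    intro r hr s hs
    refine mul_OK (ih hr) ?_
    have : mR n ≤ OK n 1 := by
      rw [mR, Ideal.span_le]
      rintro _ ⟨i, rfl⟩
      exact X_mem_OK i
    exact this hs

lemma coeff_mul_X_congr (i : Fin n) (a b : MvPowerSeries (Fin n) ℂ) (d : Fin n →₀ ℕ)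
    (h : ∀ e : Fin n →₀ ℕ, e.degree + 1 = d.degree → MvPowerSeries.coeff e a = MvPowerSeries.coeff e b) :
    MvPowerSeries.coeff d (a * MvPowerSeries.X i) = MvPowerSeries.coeff d (b * MvPowerSeries.X i) := by
  rw [MvPowerSeries.coeff_mul, MvPowerSeries.coeff_mul]
  refine Finset.sum_congr rfl fun p hp => ?_
  rw [Finset.HasAntidiagonal.mem_antidiagonal] at hp
  by_cases hp2 : p.2 = Finsupp.single i 1
  · rw [h]
    rw [← hp, map_add, hp2]; simp
  · classical
    rw [MvPowerSeries.coeff_X, if_neg hp2, mul_zero, mul_zero]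

lemma OK_le (K : ℕ) : OK n K ≤ mR n ^ K := by
  induction K with
  | zero => simp
  | succ K ih =>
    intro f hf
    have h1 : f ∈ mR n := by
      have := (mem_span_X (Finset.univ : Finset (Fin n)) f).2 (fun d hd => hf d (by
        have : d = 0 := by ext i; exact hd i (Finset.mem_univ i)
        rw [this]; simp))
      simpa [mR, Set.image_univ] using this
    obtain ⟨c, hc⟩ := (Ideal.mem_span_range_iff_exists_fun).1 h1
    have key : f = ∑ i, (c i - (MvPowerSeries.truncTotal K (c i) : MvPowerSeries (Fin n) ℂ)) * MvPowerSeries.X i := by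
      have h0 : ∑ i, (MvPowerSeries.truncTotal K (c i) : MvPowerSeries (Fin n) ℂ) * MvPowerSeries.X i = 0 := by
        ext d
        rw [map_sum, map_zero]
        by_cases hd : d.degree < K + 1
        · rw [← hf d hd, ← hc, map_sum]
          refine Finset.sum_congr rfl fun i _ => coeff_mul_X_congr i _ _ d fun e he => ?_
          rw [MvPolynomial.coeff_coe, MvPowerSeries.coeff_truncTotal _ (by omega)]
        · refine Finset.sum_eq_zero fun i _ => ?_
          rw [coeff_mul_X_congr i _ 0 d fun e he => ?_]
          · simp
          · rw [MvPolynomial.coeff_coe, MvPowerSeries.coeff_truncTotal_eq_zero _ (by omega), map_zero]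
      simp only [sub_mul, Finset.sum_sub_distrib, h0, hc, sub_zero]
    rw [key, pow_succ]
    refine Ideal.sum_mem _ fun i _ => Ideal.mul_mem_mul (ih ?_) (Ideal.subset_span ⟨i, rfl⟩)
    intro d hd
    rw [map_sub, MvPolynomial.coeff_coe, MvPowerSeries.coeff_truncTotal _ hd, sub_self]

lemma mR_pow (K : ℕ) : mR n ^ K = OK n K := le_antisymm (mR_pow_le K) (OK_le K)

lemma sub_trunc_mem (K : ℕ) (x : MvPowerSeries (Fin n) ℂ) :
    x - (MvPowerSeries.truncTotal K x : MvPowerSeries (Fin n) ℂ) ∈ mR n ^ K := by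
  rw [mR_pow]
  intro d hd
  rw [map_sub, MvPolynomial.coeff_coe, MvPowerSeries.coeff_truncTotal _ hd, sub_self]

lemma coe_mem_mR_pow (K : ℕ) (p : MvPolynomial (Fin n) ℂ) :
    (p : MvPowerSeries (Fin n) ℂ) ∈ mR n ^ K ↔ p ∈ MvPolynomial.idealOfVars (Fin n) ℂ ^ K := by
  rw [mR_pow, MvPolynomial.mem_pow_idealOfVars_iff']
  rfl

lemma mR_eq : mR n = IsLocalRing.maximalIdeal (MvPowerSeries (Fin n) ℂ) := by
  ext f
  rw [IsLocalRing.mem_maximalIdeal, mem_nonunits_iff, MvPowerSeries.isUnit_iff_constantCoeff,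
    isUnit_iff_ne_zero, not_not, ← pow_one (mR n), mR_pow]
  constructor
  · intro h; exact h 0 (by simp)
  · intro h d hd
    have : d = 0 := by
      rw [← Finsupp.degree_eq_zero_iff]; omega
    subst this
    exact h

lemma exists_pow_le {I : Ideal (MvPowerSeries (Fin n) ℂ)} (h : ∀ i, MvPowerSeries.X i ∈ I.radical) :
    ∃ K, mR n ^ K ≤ I := by
  have : mR n ≤ I.radical := by
    rw [mR, Ideal.span_le]
    rintro _ ⟨i, rfl⟩
    exact h i
  exact Ideal.exists_pow_le_of_le_radical_of_fg this
    (by have := MvPowerSeries.isNoetherianRing (σ := Fin n) ℂ; exact IsNoetherian.noetherian _)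

end BR
end

section
namespace BR
open Ext (mem_span_X depth_ps)

abbrev RR (n : ℕ) := MvPowerSeries (Fin n) ℂ

lemma mem_of_forall_pow (p : Ideal (RR n)) (h x : RR n) (hp : p ≠ ⊤)
    (hc : MvPowerSeries.constantCoeff h = 0) (hx : ∀ k, x ∈ p ⊔ Ideal.span {h ^ k}) : x ∈ p := by
  have := MvPowerSeries.isNoetherianRing (σ := Fin n) ℂ
  have h1 := Ideal.iInf_pow_smul_eq_bot_of_isLocalRing (M := RR n ⧸ p) (Ideal.span {h}) (by
    rw [Ne, Ideal.span_singleton_eq_top, MvPowerSeries.isUnit_iff_constantCoeff, hc]; simp)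
  rw [← Ideal.Quotient.eq_zero_iff_mem, ← Submodule.mem_bot (R := RR n), ← h1, Submodule.mem_iInf]
  intro k
  obtain ⟨a, ha, b, hb, rfl⟩ := Submodule.mem_sup.1 (hx k)
  obtain ⟨c, rfl⟩ := Ideal.mem_span_singleton.1 hb
  rw [map_add, Ideal.Quotient.eq_zero_iff_mem.2 ha, zero_add, Ideal.span_singleton_pow]
  have : Ideal.Quotient.mk p (h ^ k * c) = h ^ k • Ideal.Quotient.mk p c := rfl
  rw [this]
  exact Submodule.smul_mem_smul (Ideal.mem_span_singleton_self _) trivial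

lemma finite_gen (p : Ideal (RR n)) (h : RR n) (hp : p ≠ ⊤)
    (hc : MvPowerSeries.constantCoeff h = 0) (K : ℕ) (hK : mR n ^ K ≤ p ⊔ Ideal.span {h}) (x : RR n) :
    ∃ C : (Fin n →₀ ℕ) → PowerSeries ℂ,
      x - ∑ d ∈ (Finsupp.finite_of_degree_le (σ := Fin n) K).toFinset,
        PowerSeries.substAlgHom (PowerSeries.HasSubst.of_constantCoeff_zero hc) (C d) *
          (MvPolynomial.monomial d 1 : MvPolynomial (Fin n) ℂ) ∈ p := by
  set φ := PowerSeries.substAlgHom (R := ℂ) (PowerSeries.HasSubst.of_constantCoeff_zero hc) with hφ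
  set T := (Finsupp.finite_of_degree_le (σ := Fin n) K).toFinset with hT
  let tr : RR n → RR n := fun x => ∑ d ∈ T, φ (PowerSeries.C (MvPolynomial.coeff d (MvPowerSeries.truncTotal K x))) *
          (MvPolynomial.monomial d 1 : MvPolynomial (Fin n) ℂ)
  have htr : ∀ x, tr x = (MvPowerSeries.truncTotal K x : MvPolynomial (Fin n) ℂ) := by
    intro x
    have e1 : MvPowerSeries.truncTotal K x = ∑ d ∈ T, MvPolynomial.C (MvPolynomial.coeff d (MvPowerSeries.truncTotal K x)) *
       (MvPolynomial.monomial d 1 : MvPolynomial (Fin n) ℂ) := by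
      conv_lhs => rw [MvPolynomial.as_sum (MvPowerSeries.truncTotal K x)]
      simp only [MvPolynomial.C_mul_monomial, mul_one]
      refine Finset.sum_subset ?_ ?_
      · intro d hd
        rw [hT, Set.Finite.mem_toFinset]
        by_contra hlt
        rw [MvPolynomial.mem_support_iff] at hd
        apply hd
        refine MvPowerSeries.coeff_truncTotal_eq_zero _ ?_
        have : ¬ (Finsupp.degree d ≤ K) := hlt
        omega
      · intro d _ hd
        rw [MvPolynomial.notMem_support_iff.1 hd]; simp
    conv_rhs => rw [e1]
    have e2 := map_sum (MvPolynomial.coeToMvPowerSeries.ringHom (R := ℂ) (σ := Fin n)) (fun d => MvPolynomial.C (MvPolynomial.coeff d (MvPowerSeries.truncTotal K x)) *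
       (MvPolynomial.monomial d 1 : MvPolynomial (Fin n) ℂ)) T
    simp only [MvPolynomial.coeToMvPowerSeries.ringHom_apply] at e2
    rw [e2]
    refine Finset.sum_congr rfl fun d _ => ?_
    rw [MvPolynomial.coe_mul, MvPolynomial.coe_C]
    congr 1
    have : (PowerSeries.C (MvPolynomial.coeff d (MvPowerSeries.truncTotal K x))) =
      algebraMap ℂ (PowerSeries ℂ) (MvPolynomial.coeff d (MvPowerSeries.truncTotal K x)) := rfl
    rw [this, AlgHom.commutes]; rfl
  have hstep : ∀ x : RR n, ∃ y, x - tr x - h * y ∈ p := by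
    intro x
    have := hK (sub_trunc_mem K x)
    rw [← htr] at this
    obtain ⟨a, ha, b, hb, hab⟩ := Submodule.mem_sup.1 this
    obtain ⟨c, rfl⟩ := Ideal.mem_span_singleton.1 hb
    refine ⟨c, ?_⟩
    rw [← hab]; simpa using ha
  choose nx hnx using hstep
  let xs : ℕ → RR n := fun k => nx^[k] x
  let cs : ℕ → (Fin n →₀ ℕ) → PowerSeries ℂ := fun j d =>
    PowerSeries.mk fun k => MvPolynomial.coeff d (MvPowerSeries.truncTotal K (xs (j + k)))
  have hcs : ∀ j d, cs j d = PowerSeries.X * cs (j + 1) d +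
      PowerSeries.C (MvPolynomial.coeff d (MvPowerSeries.truncTotal K (xs j))) := by
    intro j d
    conv_lhs => rw [PowerSeries.eq_X_mul_shift_add_const (cs j d)]
    congr 2
    · ext k
      simp only [cs, PowerSeries.coeff_mk]
      rw [show j + (k + 1) = j + 1 + k by ring]
  let E : ℕ → RR n := fun j => xs j - ∑ d ∈ T, φ (cs j d) * (MvPolynomial.monomial d 1 : MvPolynomial (Fin n) ℂ)
  have hE : ∀ j, E j - h * E (j + 1) ∈ p := by
    intro j
    have hX : φ PowerSeries.X = h := PowerSeries.substAlgHom_X _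
    have e : E j - h * E (j + 1) = xs j - tr (xs j) - h * nx (xs j) := by
      have h1 : ∑ d ∈ T, φ (cs j d) * (MvPolynomial.monomial d 1 : MvPolynomial (Fin n) ℂ) =
          h * (∑ d ∈ T, φ (cs (j+1) d) * (MvPolynomial.monomial d 1 : MvPolynomial (Fin n) ℂ)) + tr (xs j) := by
        rw [Finset.mul_sum, ← Finset.sum_add_distrib]
        refine Finset.sum_congr rfl fun d _ => ?_
        rw [hcs j d, map_add, map_mul, hX]; ring
      have h2 : xs (j + 1) = nx (xs j) := Function.iterate_succ_apply' nx j x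
      simp only [E]
      rw [h1, h2]; ring
    rw [e]; exact hnx _
  refine ⟨cs 0, ?_⟩
  refine mem_of_forall_pow p h _ hp hc fun k => ?_
  have : ∀ k, E 0 - h ^ k * E k ∈ p := by
    intro k
    induction k with
    | zero => simp
    | succ k ih =>
      have := Ideal.add_mem _ ih (Ideal.mul_mem_left _ (h ^ k) (hE k))
      convert this using 1; ring
  have h3 : E 0 = (E 0 - h ^ k * E k) + h ^ k * E k := by ring
  change E 0 ∈ _
  rw [h3]
  exact Submodule.add_mem_sup (this k) (Ideal.mul_mem_right _ _ (Ideal.mem_span_singleton_self _))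

lemma lift_monic (p : Ideal (RR n)) [p.IsPrime] (q : (RR n ⧸ p)[X]) (hq : q.Monic) (α β : RR n)
    (h : (q.scaleRoots (Ideal.Quotient.mk p α)).eval (Ideal.Quotient.mk p β) = 0) :
    ∃ w : (RR n)[X], w.Monic ∧ (w.scaleRoots α).eval β ∈ p := by
  have hl : q ∈ Polynomial.lifts (Ideal.Quotient.mk p) := by
    rw [Polynomial.mem_lifts]
    exact Polynomial.map_surjective _ Ideal.Quotient.mk_surjective q
  obtain ⟨w, hw, _, hm⟩ := Polynomial.lifts_and_natDegree_eq_and_monic hl hq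
  refine ⟨w, hm, ?_⟩
  rw [← Ideal.Quotient.eq_zero_iff_mem, ← Polynomial.eval₂_at_apply, ← Polynomial.eval_map,
    Polynomial.map_scaleRoots _ _ _ (by rw [hm.leadingCoeff]; simp), hw, h]

theorem rel_mod_prime (p : Ideal (RR n)) [hp : p.IsPrime] (f h g g' : MvPolynomial (Fin n) ℂ)
    (hhc : MvPolynomial.constantCoeff h = 0) (hfc : MvPolynomial.constantCoeff f = 0)
    (K : ℕ) (hK : mR n ^ K ≤ p ⊔ Ideal.span {(h : RR n)})
    (hf : (f : RR n) ∉ p) (hh : (h : RR n) ∉ p) (hg : (g : RR n) ∉ p) (hg' : (g' : RR n) ∉ p)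
    (hrel : ∀ i, ((MvPolynomial.pderiv i f * g' - MvPolynomial.pderiv i h * g :
      MvPolynomial (Fin n) ℂ) : RR n) ∈ p) :
    (∃ w : (RR n)[X], w.Monic ∧ (w.scaleRoots ((g' * f : MvPolynomial (Fin n) ℂ) : RR n)).eval
      ((g * h : MvPolynomial (Fin n) ℂ) : RR n) ∈ p) ∧
    (∃ w : (RR n)[X], w.Monic ∧ (w.scaleRoots ((g * h : MvPolynomial (Fin n) ℂ) : RR n)).eval
      ((g' * f : MvPolynomial (Fin n) ℂ) : RR n) ∈ p) ∧
    (∀ q : Ideal (RR n), q.IsPrime → p < q → (h : RR n) ∈ q) := by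
  have hc : MvPowerSeries.constantCoeff (h : RR n) = 0 := by
    rw [← MvPowerSeries.coeff_zero_eq_constantCoeff_apply, MvPolynomial.coeff_coe]; exact hhc
  let φ := PowerSeries.substAlgHom (R := ℂ) (PowerSeries.HasSubst.of_constantCoeff_zero hc)
  let A := RR n ⧸ p
  let _ : Algebra (PowerSeries ℂ) A := ((Ideal.Quotient.mk p).comp φ.toRingHom).toAlgebra
  have halg : ∀ c : PowerSeries ℂ, algebraMap (PowerSeries ℂ) A c = Ideal.Quotient.mk p (φ c) := fun c => rfl
  have : IsScalarTower ℂ (PowerSeries ℂ) A := by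
    refine IsScalarTower.of_algebraMap_eq fun c => ?_
    rw [halg, AlgHom.commutes]; rfl
  have : Module.Finite (PowerSeries ℂ) A := by
    classical
    refine ⟨⟨((Finsupp.finite_of_degree_le (σ := Fin n) K).toFinset).image fun d =>
      Ideal.Quotient.mk p ((MvPolynomial.monomial d 1 : MvPolynomial (Fin n) ℂ) : RR n), ?_⟩⟩
    rw [eq_top_iff]
    rintro y -
    obtain ⟨x, rfl⟩ := Ideal.Quotient.mk_surjective y
    obtain ⟨C, hC⟩ := finite_gen p h hp.ne_top hc K hK x
    rw [← Ideal.Quotient.eq] at hC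
    rw [hC, map_sum]
    refine Submodule.sum_mem _ fun d hd => ?_
    rw [map_mul]
    have : Ideal.Quotient.mk p (φ (C d)) * Ideal.Quotient.mk p
      ((MvPolynomial.monomial d 1 : MvPolynomial (Fin n) ℂ) : RR n) = C d • Ideal.Quotient.mk p
      ((MvPolynomial.monomial d 1 : MvPolynomial (Fin n) ℂ) : RR n) := by
      rw [Algebra.smul_def, halg]
    rw [this]
    refine Submodule.smul_mem _ _ (Submodule.subset_span ?_)
    simp only [Finset.coe_image]
    exact ⟨d, hd, rfl⟩
  have hφX : φ PowerSeries.X = h := PowerSeries.substAlgHom_X _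
  have hinj : Function.Injective (algebraMap (PowerSeries ℂ) A) := by
    rw [injective_iff_map_eq_zero]
    intro c hc0
    by_contra hne
    obtain ⟨k, u, hu, rfl⟩ := ps_fac c hne
    rw [halg, map_mul, map_pow, hφX, Ideal.Quotient.eq_zero_iff_mem,
      Ideal.mul_unit_mem_iff_mem _ (hu.map φ)] at hc0
    exact hh (hp.mem_of_pow_mem k hc0)
  let ξ : Fin n → A := fun i => Ideal.Quotient.mk p (MvPowerSeries.X i)
  have hev : ∀ q : MvPolynomial (Fin n) ℂ, MvPolynomial.aeval ξ q = Ideal.Quotient.mk p (q : RR n) := by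
    intro q
    induction q using MvPolynomial.induction_on with
    | C a => rw [MvPolynomial.aeval_C, MvPolynomial.coe_C]; rfl
    | add p q hp hq => simp [hp, hq]
    | mul_X p i hp => simp [hp, ξ]
  have hfm : (f : RR n) ^ K ∈ mR n ^ K := by
    refine Ideal.pow_mem_pow ?_ K
    rw [mR_eq, IsLocalRing.mem_maximalIdeal, mem_nonunits_iff, MvPowerSeries.isUnit_iff_constantCoeff,
      isUnit_iff_ne_zero, not_not, ← MvPowerSeries.coeff_zero_eq_constantCoeff_apply, MvPolynomial.coeff_coe]
    exact hfc
  have := integral_rel hinj ξ f h g g' (by rw [halg, hφX, hev])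
    ⟨K, by
      obtain ⟨a, ha, b, hb, hab⟩ := Submodule.mem_sup.1 (hK hfm)
      obtain ⟨c, rfl⟩ := Ideal.mem_span_singleton.1 hb
      rw [hev, hev, ← map_pow, ← hab, map_add, Ideal.Quotient.eq_zero_iff_mem.2 ha, zero_add, map_mul]
      exact Ideal.mul_mem_right _ _ (Ideal.mem_span_singleton_self _)⟩
    (by rw [hev, Ne, Ideal.Quotient.eq_zero_iff_mem]; exact hf)
    (by rw [hev, Ne, Ideal.Quotient.eq_zero_iff_mem]; exact hh)
    (by rw [hev, Ne, Ideal.Quotient.eq_zero_iff_mem]; exact hg)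
    (by rw [hev, Ne, Ideal.Quotient.eq_zero_iff_mem]; exact hg')
    (fun i => by rw [hev, Ideal.Quotient.eq_zero_iff_mem]; exact hrel i)
  simp only [hev] at this
  obtain ⟨⟨q, h1, h2⟩, q', h3, h4⟩ := this
  refine ⟨lift_monic p q h1 _ _ h2, lift_monic p q' h3 _ _ h4, ?_⟩
  intro Q hQ hlt
  have hQ' : (Q.map (Ideal.Quotient.mk p)).IsPrime :=
    Ideal.map_isPrime_of_surjective Ideal.Quotient.mk_surjective (by rw [Ideal.mk_ker]; exact hlt.le)
  have hne : Q.map (Ideal.Quotient.mk p) ≠ ⊥ := by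
    intro h0
    rw [Ideal.map_eq_bot_iff_le_ker, Ideal.mk_ker] at h0
    exact absurd h0 (not_le_of_gt hlt)
  have h5 := Ideal.IsIntegral.comap_ne_bot (R := PowerSeries ℂ) (A := A) hne
  obtain ⟨c, hc1, hc0⟩ := Submodule.exists_mem_ne_zero_of_ne_bot h5
  obtain ⟨k, u, hu, rfl⟩ := ps_fac c hc0
  have h6 : (PowerSeries.X : PowerSeries ℂ) ^ k ∈ Ideal.comap (algebraMap (PowerSeries ℂ) A) (Q.map (Ideal.Quotient.mk p)) :=
        (Ideal.mul_unit_mem_iff_mem _ hu).1 hc1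
  rw [Ideal.mem_comap, map_pow] at h6
  have h7 := hQ'.mem_of_pow_mem k h6
  rw [halg, hφX] at h7
  have h8 := Ideal.comap_map_of_surjective' (Ideal.Quotient.mk p) Ideal.Quotient.mk_surjective Q
  have h9 : (h : RR n) ∈ Ideal.comap (Ideal.Quotient.mk p) (Q.map (Ideal.Quotient.mk p)) := h7
  rw [h8, Ideal.mk_ker, sup_eq_left.2 hlt.le] at h9
  exact h9

end BR
end

section
namespace BR
lemma enat_add {a b : ℕ∞} (h : a ≠ ⊤) (h2 : b ≠ ⊤) : a + b ≠ ⊤ := by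
  lift a to ℕ using h
  lift b to ℕ using h2
  exact_mod_cast ENat.natCast_ne_top (a + b)
lemma enat_cancel {a b c : ℕ∞} (h : a ≠ ⊤) (h2 : a + b = a + c) : b = c :=
  (WithTop.add_left_inj h).1 h2
section gen
variable {A : Type*} [CommRing A] [Algebra ℂ A]
variable {M M' : Type*} [AddCommGroup M] [Module A M] [Module ℂ M] [IsScalarTower ℂ A M]
  [AddCommGroup M'] [Module A M'] [Module ℂ M'] [IsScalarTower ℂ A M']

def len (N : Submodule A M) : ℕ∞ := Module.length ℂ (M ⧸ N)

lemma len_star (φ : M →ₗ[A] M') (N' : Submodule A M') :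
    len N' = len (N'.comap φ) + len (N' ⊔ LinearMap.range φ) := by
  unfold len
  refine Module.length_eq_add_of_exact
    (((N'.comap φ).mapQ N' φ le_rfl).restrictScalars ℂ)
    ((Submodule.factor (le_sup_left : N' ≤ N' ⊔ LinearMap.range φ)).restrictScalars ℂ) ?_ ?_ ?_
  · intro x y hxy
    obtain ⟨x, rfl⟩ := Submodule.Quotient.mk_surjective _ x
    obtain ⟨y, rfl⟩ := Submodule.Quotient.mk_surjective _ y
    have h2 : (Submodule.Quotient.mk (φ x) : M' ⧸ N') = Submodule.Quotient.mk (φ y) := hxy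
    rw [Submodule.Quotient.eq] at h2 ⊢
    simpa using h2
  · exact Submodule.factor_surjective le_sup_left
  · intro y
    obtain ⟨y, rfl⟩ := Submodule.Quotient.mk_surjective _ y
    constructor
    · intro h
      have h2 : (Submodule.Quotient.mk y : M' ⧸ (N' ⊔ LinearMap.range φ)) = 0 := h
      rw [Submodule.Quotient.mk_eq_zero] at h2
      obtain ⟨a, ha, b, ⟨c, rfl⟩, rfl⟩ := Submodule.mem_sup.1 h2
      refine ⟨Submodule.Quotient.mk c, ?_⟩
      change (Submodule.Quotient.mk (φ c) : M' ⧸ N') = _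
      rw [Submodule.Quotient.eq]
      simpa using ha
    · rintro ⟨x, hx⟩
      obtain ⟨x, rfl⟩ := Submodule.Quotient.mk_surjective _ x
      rw [← hx]
      change (Submodule.Quotient.mk (φ x) : M' ⧸ (N' ⊔ LinearMap.range φ)) = 0
      rw [Submodule.Quotient.mk_eq_zero]
      exact Submodule.mem_sup_right ⟨x, rfl⟩

lemma len_top : len (⊤ : Submodule A M) = 0 := by
  unfold len
  have : Subsingleton (M ⧸ (⊤ : Submodule A M)) := Submodule.Quotient.subsingleton_iff.2 rfl
  exact Module.length_eq_zero

lemma len_comap (φ : M →ₗ[A] M') (hφ : Function.Surjective φ) (N' : Submodule A M') :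
    len (N'.comap φ) = len N' := by
  rw [len_star φ N', LinearMap.range_eq_top.2 hφ, sup_top_eq, len_top, add_zero]

lemma len_mono {N N' : Submodule A M} (h : N ≤ N') : len N' ≤ len N := by
  unfold len
  exact Module.length_le_of_surjective ((Submodule.factor h).restrictScalars ℂ)
    (Submodule.factor_surjective h)

lemma len_ne_top {N : Submodule A M} (h : FiniteDimensional ℂ (M ⧸ N)) : len N ≠ ⊤ :=
  Module.length_ne_top

lemma fin_of_len {N : Submodule A M} (h : len N ≠ ⊤) : FiniteDimensional ℂ (M ⧸ N) := by
  unfold len at h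
  rw [Module.length_ne_top_iff, isFiniteLength_iff_isNoetherian_isArtinian] at h
  have := h.1
  infer_instance

lemma len_eq {N : Submodule A M} (h : len N ≠ ⊤) : (Module.finrank ℂ (M ⧸ N) : ℕ∞) = len N := by
  have := fin_of_len h
  unfold len
  rw [Module.length_eq_finrank]

lemma len_prod (Q : Submodule A (A × A)) :
    len Q = len (Q.comap (LinearMap.inl A A A)) + len (Q.map (LinearMap.snd A A A)) := by
  rw [len_star (LinearMap.inl A A A) Q, ← len_comap (LinearMap.snd A A A) Prod.snd_surjective
    (Q.map (LinearMap.snd A A A)), Submodule.comap_map_eq, LinearMap.ker_snd]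

lemma len_prod' (Q : Submodule A (A × A)) :
    len Q = len (Q.comap (LinearMap.inr A A A)) + len (Q.map (LinearMap.fst A A A)) := by
  rw [len_star (LinearMap.inr A A A) Q, ← len_comap (LinearMap.fst A A A) Prod.fst_surjective
    (Q.map (LinearMap.fst A A A)), Submodule.comap_map_eq, LinearMap.ker_fst]

/-- S1 -/
lemma len_mul (J I : Ideal A) (α : A) (hα : ∀ x, α * x ∈ J → x ∈ J) :
    len (Ideal.span {α} * I ⊔ J) = len (I ⊔ J) + len (Ideal.span {α} ⊔ J) := by
  rw [len_star (LinearMap.mulLeft A α) (Ideal.span {α} * I ⊔ J)]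
  congr 2
  · ext x
    rw [Submodule.mem_comap, LinearMap.mulLeft_apply]
    constructor
    · intro h
      obtain ⟨a, ha, b, hb, hab⟩ := Submodule.mem_sup.1 h
      obtain ⟨i, hi, rfl⟩ := Ideal.mem_span_singleton_mul.1 ha
      have : α * (x - i) ∈ J := by
        have : α * (x - i) = b := by rw [mul_sub, ← hab]; ring
        rwa [this]
      exact Submodule.mem_sup.2 ⟨i, hi, _, hα _ this, by ring⟩
    · intro h
      obtain ⟨a, ha, b, hb, rfl⟩ := Submodule.mem_sup.1 h
      rw [mul_add]
      exact Submodule.add_mem_sup (Ideal.mul_mem_mul (Ideal.mem_span_singleton_self _) ha)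
        (Ideal.mul_mem_left _ _ hb)
  · apply le_antisymm
    · refine sup_le (sup_le (Ideal.mul_le_left.trans le_sup_left) le_sup_right) ?_
      rintro _ ⟨x, rfl⟩
      exact Submodule.mem_sup_left (Ideal.mul_mem_right _ _ (Ideal.mem_span_singleton_self _))
    · refine sup_le ?_ (le_sup_right.trans le_sup_left)
      rw [Ideal.span_singleton_le_iff_mem]
      exact Submodule.mem_sup_right ⟨1, by simp⟩

lemma len_mul_elt (J : Ideal A) (α β : A) (hα : ∀ x, α * x ∈ J → x ∈ J) :
    len (Ideal.span {α * β} ⊔ J) = len (Ideal.span {β} ⊔ J) + len (Ideal.span {α} ⊔ J) := by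
  rw [← len_mul J _ α hα, Ideal.span_singleton_mul_span_singleton]

lemma len_pow_ne_top (J : Ideal A) (α : A) (hα : ∀ x, α * x ∈ J → x ∈ J)
    (hf : len (Ideal.span {α} ⊔ J) ≠ ⊤) (k : ℕ) : len (Ideal.span {α ^ k} ⊔ J) ≠ ⊤ := by
  induction k with
  | zero =>
    have : (Ideal.span {α ^ 0} ⊔ J) = ⊤ := by simp
    rw [this, len_top]; simp
  | succ k ih =>
    rw [pow_succ', len_mul_elt J α _ hα]
    exact enat_add ih hf

lemma pow_sup_le (J : Ideal A) (α β : A) (w : A[X]) (hw : w.Monic)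
    (h : (w.scaleRoots α).eval β ∈ J) (k : ℕ) (hk : w.natDegree ≤ k) :
    Ideal.span {α, β} ^ (k + 1) ⊔ J = Ideal.span {α} * Ideal.span {α, β} ^ k ⊔ J := by
  have hαβ : Ideal.span {α} ≤ Ideal.span {α, β} := Ideal.span_mono (by simp)
  have hα : α ∈ Ideal.span {α, β} := Ideal.subset_span (by simp)
  have hβ : β ∈ Ideal.span {α, β} := Ideal.subset_span (by simp)
  have key : β ^ (k + 1) ∈ Ideal.span {α} * Ideal.span {α, β} ^ k ⊔ J := by
    have e : β ^ (k + 1) = β ^ (k + 1 - w.natDegree) * β ^ w.natDegree := by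
      rw [← pow_add]; congr 1; omega
    have e2 : (w.scaleRoots α).eval β = β ^ w.natDegree +
        ∑ i ∈ Finset.range w.natDegree, w.coeff i * α ^ (w.natDegree - i) * β ^ i := by
      rw [Polynomial.eval_eq_sum_range, natDegree_scaleRoots, Finset.sum_range_succ]
      simp only [coeff_scaleRoots, hw.coeff_natDegree]
      simp; ring
    have e3 : β ^ w.natDegree = (w.scaleRoots α).eval β -
        ∑ i ∈ Finset.range w.natDegree, w.coeff i * α ^ (w.natDegree - i) * β ^ i := by
      rw [e2]; ring
    rw [e, e3, mul_sub]
    refine Ideal.sub_mem _ (Submodule.mem_sup_right (Ideal.mul_mem_left _ _ h))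
      (Submodule.mem_sup_left ?_)
    rw [Finset.mul_sum]
    refine Ideal.sum_mem _ fun i hi => ?_
    rw [Finset.mem_range] at hi
    have e4 : β ^ (k + 1 - w.natDegree) * (w.coeff i * α ^ (w.natDegree - i) * β ^ i) =
      w.coeff i * (α * (α ^ (w.natDegree - i - 1) * β ^ (k + 1 - w.natDegree + i))) := by
      obtain ⟨j, hj⟩ : ∃ j, w.natDegree - i = j + 1 := ⟨w.natDegree - i - 1, by omega⟩
      rw [hj, pow_add β, pow_succ]; simp; ring
    rw [e4]
    refine Ideal.mul_mem_left _ _ (Ideal.mul_mem_mul (Ideal.mem_span_singleton_self _) ?_)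
    have : k = (w.natDegree - i - 1) + (k + 1 - w.natDegree + i) := by omega
    have h5 : Ideal.span {α, β} ^ (w.natDegree - i - 1) * Ideal.span {α, β} ^ (k + 1 - w.natDegree + i) ≤ Ideal.span {α, β} ^ k := by
      rw [← pow_add, ← this]
    exact h5 <| Ideal.mul_mem_mul (Ideal.pow_mem_pow hα _) (Ideal.pow_mem_pow hβ _)
  apply le_antisymm
  · refine sup_le ?_ le_sup_right
    have hle : ∀ j, Ideal.span {α, β} ^ (j + 1) ≤
        Ideal.span {α} * Ideal.span {α, β} ^ j ⊔ Ideal.span {β ^ (j + 1)} := by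
      intro j
      induction j with
      | zero => simp [Ideal.span_insert]
      | succ j ih =>
        rw [pow_succ', Ideal.span_insert α, Ideal.sup_mul, ← Ideal.span_insert]
        refine sup_le le_sup_left ?_
        refine (Ideal.mul_mono_right ih).trans ?_
        rw [Ideal.mul_sup]
        refine sup_le_sup ?_ ?_
        · rw [mul_left_comm]
          refine Ideal.mul_mono_right ?_
          rw [pow_succ']
          exact Ideal.mul_mono_left (Ideal.span_mono (by simp))
        · rw [Ideal.span_singleton_mul_span_singleton, ← pow_succ']
    exact (hle k).trans (sup_le le_sup_left (by rwa [Ideal.span_singleton_le_iff_mem]))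
  · refine sup_le_sup_right ?_ _
    rw [pow_succ']
    exact Ideal.mul_mono_left hαβ

/-- S2 -/
lemma len_eq_of_rel (J : Ideal A) (α β : A) (hα : ∀ x, α * x ∈ J → x ∈ J)
    (hβ : ∀ x, β * x ∈ J → x ∈ J) (hf : len (Ideal.span {α} ⊔ J) ≠ ⊤)
    (h1 : ∃ w : A[X], w.Monic ∧ (w.scaleRoots α).eval β ∈ J)
    (h2 : ∃ w : A[X], w.Monic ∧ (w.scaleRoots β).eval α ∈ J) :
    len (Ideal.span {α} ⊔ J) = len (Ideal.span {β} ⊔ J) := by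
  obtain ⟨w, hw, hwJ⟩ := h1
  obtain ⟨v, hv, hvJ⟩ := h2
  set k := max w.natDegree v.natDegree
  have e1 := pow_sup_le J α β w hw hwJ k (le_max_left _ _)
  have e2 := pow_sup_le J β α v hv hvJ k (le_max_right _ _)
  rw [Set.pair_comm β α] at e2
  rw [e1] at e2
  have e3 := congrArg len e2
  rw [len_mul _ _ _ hα, len_mul _ _ _ hβ] at e3
  refine enat_cancel ?_ e3
  refine ne_top_of_le_ne_top (len_pow_ne_top J α hα hf k) (len_mono ?_)
  refine sup_le_sup_right ?_ _
  rw [Ideal.span_singleton_le_iff_mem]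
  exact Ideal.pow_mem_pow (Ideal.subset_span (by simp)) _

/-- S3 -/
lemma combine [IsNoetherianRing A] (J : Ideal A) (α β : A)
    (h : ∀ p ∈ J.minimalPrimes, ∃ w : A[X], w.Monic ∧ (w.scaleRoots α).eval β ∈ p) :
    ∃ w : A[X], w.Monic ∧ (w.scaleRoots α).eval β ∈ J := by
  classical
  cases subsingleton_or_nontrivial A with
  | inl hs => exact ⟨1, Polynomial.monic_one, by rw [Subsingleton.elim (eval _ _) 0]; exact J.zero_mem⟩
  | inr hn =>
  have hfin := Ideal.finite_minimalPrimes_of_isNoetherianRing A J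
  have mulm : ∀ w v : A[X], w.Monic → v.Monic →
      ((w * v).scaleRoots α).eval β = (w.scaleRoots α).eval β * (v.scaleRoots α).eval β := by
    intro w v hw hv
    rw [Polynomial.mul_scaleRoots', Polynomial.eval_mul]
    rw [hw.leadingCoeff, hv.leadingCoeff]; simp
  have key : ∀ S : Finset (Ideal A), (S : Set (Ideal A)) ⊆ J.minimalPrimes →
      ∃ w : A[X], w.Monic ∧ ∀ p ∈ S, (w.scaleRoots α).eval β ∈ p := by
    intro S
    induction S using Finset.induction_on with
    | empty => exact fun _ => ⟨1, Polynomial.monic_one, by simp⟩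
    | insert p S hp ih =>
      intro hS
      obtain ⟨w, hw, hw'⟩ := ih (fun x hx => hS (by simp at hx ⊢; exact Or.inr hx))
      obtain ⟨v, hv, hv'⟩ := h p (hS (by simp))
      refine ⟨w * v, hw.mul hv, fun q hq => ?_⟩
      rw [mulm w v hw hv]
      rcases Finset.mem_insert.1 hq with rfl | hq
      · exact Ideal.mul_mem_left _ _ hv'
      · exact Ideal.mul_mem_right _ _ (hw' q hq)
  obtain ⟨w, hw, hw'⟩ := key hfin.toFinset (by simp)
  have hr : (w.scaleRoots α).eval β ∈ J.radical := by
    rw [← Ideal.sInf_minimalPrimes, Submodule.mem_sInf]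
    intro p hp
    exact hw' p (by simpa using hp)
  obtain ⟨N, hN⟩ := hr
  refine ⟨w ^ N, hw.pow N, ?_⟩
  have : ∀ N, ((w ^ N).scaleRoots α).eval β = ((w.scaleRoots α).eval β) ^ N := by
    intro N
    induction N with
    | zero => simp
    | succ N ih => rw [pow_succ, mulm _ _ (hw.pow N) hw, ih, pow_succ]
  rw [this]; exact hN

/-- the two-row map -/
def rowMap {n : ℕ} (a b : Fin n → A) : (Fin n → A) →ₗ[A] A × A :=
  LinearMap.prod (Fintype.linearCombination A a) (Fintype.linearCombination A b)

lemma rowMap_apply {n : ℕ} (a b δ : Fin n → A) :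
    rowMap a b δ = (∑ i, δ i * a i, ∑ i, δ i * b i) := by
  simp [rowMap, Fintype.linearCombination_apply]

/-- minors -/
def minors {n : ℕ} (a b : Fin n → A) : Ideal A :=
  Ideal.span (Set.range fun kl : Fin n × Fin n => a kl.1 * b kl.2 - a kl.2 * b kl.1)

lemma minors_comm {n : ℕ} (a b : Fin n → A) : minors a b = minors b a := by
  have : ∀ a b : Fin n → A, minors a b ≤ minors b a := by
    intro a b
    refine Ideal.span_le.2 ?_
    rintro _ ⟨⟨k, l⟩, rfl⟩
    have := Ideal.subset_span (α := A) (Set.mem_range_self (f := fun kl : Fin n × Fin n => b kl.1 * a kl.2 - b kl.2 * a kl.1) (l, k))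
    simp only at this ⊢
    rw [SetLike.mem_coe, minors]
    have e : a k * b l - a l * b k = b l * a k - b k * a l := by ring
    rw [e]; exact this
  exact le_antisymm (this a b) (this b a)

lemma minor_mem {n : ℕ} (a b : Fin n → A) (k l : Fin n) : a k * b l - a l * b k ∈ minors a b :=
  Ideal.subset_span ⟨(k, l), rfl⟩

lemma minors_le_inl {n : ℕ} (a b : Fin n → A) :
    minors a b ≤ (LinearMap.range (rowMap a b)).comap (LinearMap.inl A A A) := by
  classical
  refine Ideal.span_le.2 ?_
  rintro _ ⟨⟨k, l⟩, rfl⟩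
  refine ⟨b l • Pi.single k 1 - b k • Pi.single l 1, ?_⟩
  rw [map_sub, map_smul, map_smul, rowMap_apply, rowMap_apply]
  simp [Pi.single_apply]
  constructor <;> ring

lemma minors_le_inr {n : ℕ} (a b : Fin n → A) :
    minors a b ≤ (LinearMap.range (rowMap a b)).comap (LinearMap.inr A A A) := by
  rw [minors_comm]
  intro x hx
  obtain ⟨δ, hδ⟩ := minors_le_inl b a hx
  refine ⟨δ, ?_⟩
  rw [rowMap_apply] at hδ ⊢
  simp at hδ ⊢
  exact ⟨hδ.2, hδ.1⟩

lemma range_span {n : ℕ} (b : Fin n → A) :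
    LinearMap.range (Fintype.linearCombination A b) = Ideal.span (Set.range b) := by
  rw [Fintype.range_linearCombination]

/-- S4 -/
lemma len_rows {n : ℕ} (a b : Fin n → A)
    (h1 : ∀ δ : Fin n → A, ∑ i, δ i * b i = 0 → ∑ i, δ i * a i ∈ minors a b)
    (h2 : ∀ δ : Fin n → A, ∑ i, δ i * a i = 0 → ∑ i, δ i * b i ∈ minors a b)
    (c : Fin n → A) (g g' : A) (hg : g = ∑ i, c i * a i) (hg' : g' = ∑ i, c i * b i) :
    len (Ideal.span {g} ⊔ minors a b) + len (Ideal.span (Set.range b)) =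
    len (Ideal.span {g'} ⊔ minors a b) + len (Ideal.span (Set.range a)) := by
  set N := LinearMap.range (rowMap a b)
  have hgg : (g, g') ∈ N := ⟨c, by rw [rowMap_apply, hg, hg']⟩
  have hQ : N ⊔ Submodule.span A {((g, 0) : A × A)} = N ⊔ Submodule.span A {((0, g') : A × A)} := by
    apply le_antisymm
    · refine sup_le le_sup_left ?_
      rw [Submodule.span_singleton_le_iff_mem]
      have : ((g, 0) : A × A) = (g, g') - (0, g') := by simp
      rw [this]
      exact Submodule.sub_mem _ (Submodule.mem_sup_left hgg)
        (Submodule.mem_sup_right (Submodule.mem_span_singleton_self _))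
    · refine sup_le le_sup_left ?_
      rw [Submodule.span_singleton_le_iff_mem]
      have : ((0, g') : A × A) = (g, g') - (g, 0) := by simp
      rw [this]
      exact Submodule.sub_mem _ (Submodule.mem_sup_left hgg)
        (Submodule.mem_sup_right (Submodule.mem_span_singleton_self _))
  have e1 := len_prod (N ⊔ Submodule.span A {((g, 0) : A × A)})
  have e2 := len_prod' (N ⊔ Submodule.span A {((0, g') : A × A)})
  have f1 : (N ⊔ Submodule.span A {((g, 0) : A × A)}).comap (LinearMap.inl A A A) =
      Ideal.span {g} ⊔ minors a b := by
    apply le_antisymm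
    · intro x hx
      obtain ⟨y, ⟨δ, rfl⟩, z, hz, hyz⟩ := Submodule.mem_sup.1 hx
      obtain ⟨r, rfl⟩ := Submodule.mem_span_singleton.1 hz
      rw [rowMap_apply] at hyz
      simp at hyz
      rw [← hyz.1, add_comm]
      exact Submodule.add_mem_sup (Ideal.mul_mem_left _ _ (Ideal.mem_span_singleton_self _))
        (h1 δ hyz.2)
    · refine sup_le ?_ ((minors_le_inl a b).trans (Submodule.comap_mono le_sup_left))
      rw [Ideal.span_singleton_le_iff_mem]
      exact Submodule.mem_sup_right (Submodule.mem_span_singleton_self _)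
  have f2 : (N ⊔ Submodule.span A {((0, g') : A × A)}).comap (LinearMap.inr A A A) =
      Ideal.span {g'} ⊔ minors a b := by
    apply le_antisymm
    · intro x hx
      obtain ⟨y, ⟨δ, rfl⟩, z, hz, hyz⟩ := Submodule.mem_sup.1 hx
      obtain ⟨r, rfl⟩ := Submodule.mem_span_singleton.1 hz
      rw [rowMap_apply] at hyz
      simp at hyz
      rw [← hyz.2, add_comm]
      exact Submodule.add_mem_sup (Ideal.mul_mem_left _ _ (Ideal.mem_span_singleton_self _))
        (h2 δ hyz.1)
    · refine sup_le ?_ ((minors_le_inr a b).trans (Submodule.comap_mono le_sup_left))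
      rw [Ideal.span_singleton_le_iff_mem]
      exact Submodule.mem_sup_right (Submodule.mem_span_singleton_self _)
  have f3 : (N ⊔ Submodule.span A {((g, 0) : A × A)}).map (LinearMap.snd A A A) =
      Ideal.span (Set.range b) := by
    rw [Submodule.map_sup, ← LinearMap.range_comp, Submodule.map_span, ← range_span]
    simp [rowMap, LinearMap.snd_prod]
  have f4 : (N ⊔ Submodule.span A {((0, g') : A × A)}).map (LinearMap.fst A A A) =
      Ideal.span (Set.range a) := by
    rw [Submodule.map_sup, ← LinearMap.range_comp, Submodule.map_span, ← range_span]
    simp [rowMap, LinearMap.fst_prod]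
  rw [f1, f3] at e1
  rw [f2, f4, ← hQ] at e2
  rw [← e1, ← e2]
end gen
end BR
end

section
namespace BR
abbrev PP (n : ℕ) := MvPolynomial (Fin n) ℂ
/-- the maximal ideal of polynomials -/
abbrev m0 (n : ℕ) : Ideal (PP n) := MvPolynomial.idealOfVars (Fin n) ℂ

lemma fin_m0 (K : ℕ) : FiniteDimensional ℂ (PP n ⧸ m0 n ^ K) := by
  classical
  have hfin : Finite {d : Fin n →₀ ℕ // d.degree < K} :=
    Set.Finite.to_subtype ((Finsupp.finite_of_degree_le (σ := Fin n) K).subset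
      (fun d (hd : d.degree < K) => hd.le))
  have hF : Fintype {d : Fin n →₀ ℕ // d.degree < K} := Fintype.ofFinite _
  let T : PP n →ₗ[ℂ] ({d : Fin n →₀ ℕ // d.degree < K} → ℂ) :=
    LinearMap.pi fun d => MvPolynomial.lcoeff ℂ d.1
  have hk : ∀ p, T p = 0 ↔ p ∈ m0 n ^ K := by
    intro p
    rw [MvPolynomial.mem_pow_idealOfVars_iff']
    constructor
    · intro h d hd
      exact congrFun h ⟨d, hd⟩
    · intro h
      funext d
      exact h d.1 d.2
  let T' : (PP n ⧸ (m0 n ^ K).restrictScalars ℂ) →ₗ[ℂ] ({d : Fin n →₀ ℕ // d.degree < K} → ℂ) :=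
    Submodule.liftQ ((m0 n ^ K).restrictScalars ℂ) T (fun p hp => (hk p).2 hp)
  have hinj : Function.Injective T' := by
    rw [← LinearMap.ker_eq_bot]
    refine Submodule.ker_liftQ_eq_bot _ _ _ ?_
    intro p hp
    exact (hk p).1 hp
  have h1 : FiniteDimensional ℂ (PP n ⧸ (m0 n ^ K).restrictScalars ℂ) :=
    FiniteDimensional.of_injective T' hinj
  exact h1

section tr
variable {A : Type*} [CommRing A] [Algebra ℂ A] (ι : PP n →ₐ[ℂ] A) (m : Ideal A)

/-- A is a good local algebra -/
structure Good : Prop where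
  approx : ∀ (K : ℕ) (x : A), ∃ p : PP n, x - ι p ∈ m ^ K
  mem : ∀ (K : ℕ) (p : PP n), ι p ∈ m ^ K ↔ p ∈ m0 n ^ K

variable {ι m}
lemma Good.map_approx (hG : Good ι m) (I : Ideal (PP n)) (K : ℕ) (x : A) (hx : x ∈ I.map ι) :
    ∃ s ∈ I, x - ι s ∈ m ^ K := by
  induction hx using Submodule.span_induction with
  | mem x h =>
    obtain ⟨s, hs, rfl⟩ := h
    exact ⟨s, hs, by simp⟩
  | zero => exact ⟨0, I.zero_mem, by simp⟩
  | add x y _ _ hx hy =>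
    obtain ⟨s, hs, h1⟩ := hx
    obtain ⟨t, ht, h2⟩ := hy
    refine ⟨s + t, I.add_mem hs ht, ?_⟩
    have : x + y - ι (s + t) = (x - ι s) + (y - ι t) := by rw [map_add]; ring
    rw [this]; exact Ideal.add_mem _ h1 h2
  | smul a x _ hx =>
    obtain ⟨s, hs, h1⟩ := hx
    obtain ⟨p, hp⟩ := hG.approx K a
    refine ⟨p * s, I.mul_mem_left _ hs, ?_⟩
    have : a • x - ι (p * s) = a * (x - ι s) + (a - ι p) * ι s := by
      rw [map_mul, smul_eq_mul]; ring
    rw [this]; exact Ideal.add_mem _ (Ideal.mul_mem_left _ _ h1) (Ideal.mul_mem_right _ _ hp)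

lemma Good.map_mem_iff (hG : Good ι m) (I : Ideal (PP n)) (K : ℕ) (hK : m ^ K ≤ I.map ι)
    (p : PP n) : ι p ∈ I.map ι ↔ p ∈ I ⊔ m0 n ^ K := by
  constructor
  · intro h
    obtain ⟨s, hs, h1⟩ := hG.map_approx I K _ h
    rw [← map_sub, hG.mem] at h1
    exact Submodule.mem_sup.2 ⟨s, hs, _, h1, by ring⟩
  · intro h
    obtain ⟨s, hs, t, ht, rfl⟩ := Submodule.mem_sup.1 h
    rw [map_add]
    exact Ideal.add_mem _ (Ideal.mem_map_of_mem _ hs) (hK ((hG.mem _ _).2 ht))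

lemma Good.len_map (hG : Good ι m) (I : Ideal (PP n)) (K : ℕ) (hK : m ^ K ≤ I.map ι) :
    len (I.map ι) = len (I ⊔ m0 n ^ K) := by
  unfold len
  have hle : I ⊔ m0 n ^ K ≤ (I.map ι).comap ι := fun p hp => (hG.map_mem_iff I K hK p).2 hp
  refine (LinearEquiv.length_eq (LinearEquiv.ofBijective
    (Ideal.quotientMapₐ (I.map ι) ι hle).toLinearMap ⟨?_, ?_⟩)).symm
  · rw [← LinearMap.ker_eq_bot, LinearMap.ker_eq_bot']
    intro x hx
    obtain ⟨x, rfl⟩ := Ideal.Quotient.mk_surjective x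
    have h2 : (Ideal.Quotient.mk (I.map ι)) (ι x) = 0 := hx
    rw [Ideal.Quotient.eq_zero_iff_mem] at h2 ⊢
    exact (hG.map_mem_iff I K hK x).1 h2
  · intro y
    obtain ⟨y, rfl⟩ := Ideal.Quotient.mk_surjective y
    obtain ⟨p, hp⟩ := hG.approx K y
    refine ⟨Ideal.Quotient.mk _ p, ?_⟩
    change (Ideal.Quotient.mk (I.map ι)) (ι p) = _
    rw [eq_comm, Ideal.Quotient.eq]
    exact hK hp

lemma len_m0 (I : Ideal (PP n)) (K : ℕ) : len (I ⊔ m0 n ^ K) ≠ ⊤ :=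
  ne_top_of_le_ne_top (len_ne_top (fin_m0 K)) (len_mono le_sup_right)

lemma Good.pow_eq (hG : Good ι m) (hm : m = (m0 n).map ι) (K : ℕ) : m ^ K = (m0 n ^ K).map ι := by
  rw [hm, Ideal.map_pow]

lemma Good.len_ne_top (hG : Good ι m) (hm : m = (m0 n).map ι) (I : Ideal A) (K : ℕ) (hK : m ^ K ≤ I) :
    len I ≠ ⊤ := by
  refine ne_top_of_le_ne_top ?_ (len_mono hK)
  rw [hG.pow_eq hm K, hG.len_map _ K (hG.pow_eq hm K).le]
  exact len_m0 _ _
end tr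

lemma m0_eq : m0 n = Ideal.span (Set.range MvPolynomial.X) := rfl

/-- the inclusion of polynomials in power series -/
def ιR (n : ℕ) : PP n →ₐ[ℂ] RR n := MvPolynomial.coeToMvPowerSeries.algHom ℂ

lemma ιR_apply (p : PP n) : ιR n p = (p : RR n) := by
  simp [ιR, MvPolynomial.coeToMvPowerSeries.algHom_apply]

lemma goodR : Good (ιR n) (mR n) where
  approx K x := ⟨_, by rw [ιR_apply]; exact sub_trunc_mem K x⟩
  mem K p := by rw [ιR_apply]; exact coe_mem_mR_pow K p

lemma mR_map : mR n = (m0 n).map (ιR n) := by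
  rw [m0_eq, Ideal.map_span, mR, ← Set.range_comp]
  congr 2
  funext i
  simp [ιR_apply]

lemma lenR_ne_top (I : Ideal (RR n)) (K : ℕ) (hK : mR n ^ K ≤ I) : len I ≠ ⊤ :=
  goodR.len_ne_top mR_map I K hK
end BR
end

section
namespace BR
open Ext (depth_ps)

/-- partials of a polynomial as power series -/
def dR (f : PP n) (i : Fin n) : RR n := ((MvPolynomial.pderiv i f : PP n) : RR n)

/-- standing hypotheses -/
structure HypR (f h : PP n) (K : ℕ) : Prop where
  fc : MvPolynomial.constantCoeff f = 0
  hc : MvPolynomial.constantCoeff h = 0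
  jf : mR n ^ K ≤ Ideal.span (Set.range (dR f))
  jh : mR n ^ K ≤ Ideal.span (Set.range (dR h))
  kf : mR n ^ K ≤ Ideal.span {(f : RR n)} ⊔ minors (dR f) (dR h)
  kh : mR n ^ K ≤ Ideal.span {(h : RR n)} ⊔ minors (dR f) (dR h)

lemma HypR.symm {f h : PP n} {K : ℕ} (H : HypR f h K) : HypR h f K where
  fc := H.hc
  hc := H.fc
  jf := H.jh
  jh := H.jf
  kf := by rw [minors_comm]; exact H.kh
  kh := by rw [minors_comm]; exact H.kf

lemma mem_mR_of_const (f : PP n) (hf : MvPolynomial.constantCoeff f = 0) : (f : RR n) ∈ mR n := by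
  rw [mR_eq, IsLocalRing.mem_maximalIdeal, mem_nonunits_iff, MvPowerSeries.isUnit_iff_constantCoeff,
    ← MvPowerSeries.coeff_zero_eq_constantCoeff_apply, MvPolynomial.coeff_coe]
  change ¬ IsUnit (MvPolynomial.constantCoeff f)
  rw [hf]; simp

lemma X_mem_mR (i : Fin n) : (MvPowerSeries.X i : RR n) ∈ mR n := Ideal.subset_span ⟨i, rfl⟩

section
variable {m : ℕ} {f h : PP (m + 1)} {K : ℕ}

lemma HypR.h_ne (H : HypR f h K) : h ≠ 0 := by
  rintro rfl
  have h1 := H.jh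
  have h2 : Ideal.span (Set.range (dR (0 : PP (m + 1)))) = ⊥ := by
    rw [Ideal.span_eq_bot]
    rintro _ ⟨i, rfl⟩
    simp [dR]
  rw [h2] at h1
  have h3 : (MvPowerSeries.X 0 : RR (m + 1)) ^ K ∈ mR (m + 1) ^ K :=
    Ideal.pow_mem_pow (X_mem_mR 0) _
  have h4 := h1 h3
  rw [Ideal.mem_bot] at h4
  have h5 : (MvPowerSeries.X 0 : RR (m + 1)) = 0 := eq_zero_of_pow_eq_zero h4
  have h6 := congrArg (MvPowerSeries.coeff (Finsupp.single 0 1)) h5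
  rw [MvPowerSeries.coeff_X] at h6
  simp at h6

lemma HypR.nzd_h (hm : 1 ≤ m) (H : HypR f h K) (x : RR (m + 1))
    (hx : (h : RR (m + 1)) * x ∈ minors (dR f) (dR h)) : x ∈ minors (dR f) (dR h) := by
  refine depth_ps m hm (dR f) (dR h) h H.h_ne H.hc ?_ x hx
  intro i
  refine ⟨K, ?_⟩
  have := H.kh (Ideal.pow_mem_pow (X_mem_mR i) K : (MvPowerSeries.X i : RR (m + 1)) ^ K ∈ mR (m + 1) ^ K)
  rw [sup_comm] at this
  exact this

lemma HypR.nzd_f (hm : 1 ≤ m) (H : HypR f h K) (x : RR (m + 1))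
    (hx : (f : RR (m + 1)) * x ∈ minors (dR f) (dR h)) : x ∈ minors (dR f) (dR h) := by
  have := H.symm.nzd_h hm x
  rw [minors_comm] at this
  exact this hx

lemma pow_nzd {A : Type*} [CommRing A] {J : Ideal A} {a : A} (ha : ∀ x, a * x ∈ J → x ∈ J) (k : ℕ) :
    ∀ x, a ^ k * x ∈ J → x ∈ J := by
  induction k with
  | zero => intro x hx; simpa using hx
  | succ k ih => intro x hx; exact ih _ (ha _ (by rwa [← mul_assoc, ← pow_succ']))

lemma HypR.sat (hm : 1 ≤ m) (H : HypR f h K) (x : RR (m + 1)) (L : ℕ)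
    (hx : ∀ y ∈ mR (m + 1) ^ L, y * x ∈ minors (dR f) (dR h)) : x ∈ minors (dR f) (dR h) :=
  pow_nzd (H.nzd_h hm) L x (hx _ (Ideal.pow_mem_pow (mem_mR_of_const h H.hc) _))

/-- T3 -/
lemma HypR.ham (hm : 1 ≤ m) (H : HypR f h K) (δ : Fin (m + 1) → RR (m + 1))
    (hδ : ∑ i, δ i * dR h i = 0) : ∑ i, δ i * dR f i ∈ minors (dR f) (dR h) := by
  refine H.sat hm _ K fun y hy => ?_
  have hy' := H.jh hy
  refine Submodule.span_induction (p := fun y _ => y * ∑ i, δ i * dR f i ∈ minors (dR f) (dR h))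
    ?_ ?_ ?_ ?_ hy'
  · rintro _ ⟨k, rfl⟩
    have : dR h k * ∑ i, δ i * dR f i =
        ∑ i, δ i * (dR f i * dR h k - dR f k * dR h i) + dR f k * ∑ i, δ i * dR h i := by
      rw [Finset.mul_sum, Finset.mul_sum, ← Finset.sum_add_distrib]
      exact Finset.sum_congr rfl fun i _ => by ring
    rw [this, hδ, mul_zero, add_zero]
    exact Ideal.sum_mem _ fun i _ => Ideal.mul_mem_left _ _ (minor_mem _ _ _ _)
  · simp
  · intro x y _ _ hx hy
    rw [add_mul]; exact Ideal.add_mem _ hx hy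
  · intro a x _ hx
    rw [smul_eq_mul, mul_assoc]; exact Ideal.mul_mem_left _ _ hx

lemma HypR.ham' (hm : 1 ≤ m) (H : HypR f h K) (δ : Fin (m + 1) → RR (m + 1))
    (hδ : ∑ i, δ i * dR f i = 0) : ∑ i, δ i * dR h i ∈ minors (dR f) (dR h) := by
  rw [minors_comm]
  exact H.symm.ham hm δ hδ

lemma ass_iff {A : Type*} [CommRing A] [IsNoetherianRing A] (J : Ideal A) (a : A) :
    (∀ x, a * x ∈ J → x ∈ J) ↔ ∀ p ∈ associatedPrimes A (A ⧸ J), a ∉ p := by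
  have h := biUnion_associatedPrimes_eq_zero_divisors A (A ⧸ J)
  have h2 : (a ∈ ⋃ p ∈ associatedPrimes A (A ⧸ J), (p : Set A)) ↔ ∃ x : A ⧸ J, x ≠ 0 ∧ a • x = 0 := by
    rw [h]; rfl
  constructor
  · intro h3 p hp hap
    obtain ⟨x, hx, hx2⟩ := h2.1 (Set.mem_biUnion hp hap)
    obtain ⟨x, rfl⟩ := Ideal.Quotient.mk_surjective x
    apply hx
    rw [Ideal.Quotient.eq_zero_iff_mem]
    apply h3
    rw [← Ideal.Quotient.eq_zero_iff_mem, ← hx2]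
    rfl
  · intro h3 x hx
    by_contra hxJ
    have := h2.2 ⟨Ideal.Quotient.mk J x, by rwa [Ne, Ideal.Quotient.eq_zero_iff_mem], by
      have : a • Ideal.Quotient.mk J x = Ideal.Quotient.mk J (a * x) := rfl
      rw [this, Ideal.Quotient.eq_zero_iff_mem]; exact hx⟩
    simp only [Set.mem_iUnion] at this
    obtain ⟨p, hp, hap⟩ := this
    exact h3 p hp hap

lemma minimal_ass {A : Type*} [CommRing A] [IsNoetherianRing A] (J : Ideal A) (p : Ideal A)
    (hp : p ∈ J.minimalPrimes) : p ∈ associatedPrimes A (A ⧸ J) := by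
  have := Module.associatedPrimes.minimalPrimes_annihilator_subset_associatedPrimes A (A ⧸ J)
  rw [Ideal.annihilator_quotient] at this
  exact this hp

lemma HypR.not_le (hm : 1 ≤ m) (H : HypR f h K) (p : Ideal (RR (m + 1)))
    (hp : p ∈ associatedPrimes (RR (m + 1)) (RR (m + 1) ⧸ minors (dR f) (dR h))) (L : ℕ) :
    ¬ mR (m + 1) ^ L ≤ p := by
  intro hle
  have hpr : p.IsPrime := hp.1
  refine (ass_iff _ _).1 (H.nzd_h hm) p hp (hpr.mem_of_pow_mem L (hle ?_))
  exact Ideal.pow_mem_pow (mem_mR_of_const h H.hc) _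

/-- T4 -/
lemma exists_generic (S : Set (Ideal (RR n))) (hS : S.Finite) (a b : Fin n → RR n)
    (ha : ∀ p ∈ S, ¬ Ideal.span (Set.range a) ≤ p) (hb : ∀ p ∈ S, ¬ Ideal.span (Set.range b) ≤ p) :
    ∃ c : Fin n → ℂ, ∀ p ∈ S, ∑ i, c i • a i ∉ p ∧ ∑ i, c i • b i ∉ p := by
  classical
  let V : (Fin n → RR n) → Ideal (RR n) → Subspace ℂ (Fin n → ℂ) := fun a p =>
    (p.restrictScalars ℂ).comap (Fintype.linearCombination ℂ a)
  have hV : ∀ a : Fin n → RR n, ∀ p, ¬ Ideal.span (Set.range a) ≤ p → V a p ≠ ⊤ := by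
    intro a p h1 h2
    apply h1
    rw [Ideal.span_le]
    rintro _ ⟨i, rfl⟩
    have : Pi.single i 1 ∈ V a p := by rw [h2]; trivial
    simpa [V, Fintype.linearCombination_apply, Pi.single_apply] using this
  let T : Finset (Subspace ℂ (Fin n → ℂ)) := hS.toFinset.image (V a) ∪ hS.toFinset.image (V b)
  have hT : (⊤ : Subspace ℂ (Fin n → ℂ)) ∉ T := by
    simp only [T, Finset.mem_union, Finset.mem_image, Set.Finite.mem_toFinset, not_or]
    constructor
    · rintro ⟨p, hp, h⟩; exact hV a p (ha p hp) h
    · rintro ⟨p, hp, h⟩; exact hV b p (hb p hp) h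
  have := Subspace.biUnion_ne_univ_of_top_notMem hT
  rw [Ne, Set.eq_univ_iff_forall] at this
  push Not at this
  obtain ⟨c, hc⟩ := this
  refine ⟨c, fun p hp => ?_⟩
  simp only [Set.mem_iUnion, not_exists] at hc
  constructor
  · intro h
    exact hc (V a p) (by simp [T]; exact Or.inl ⟨p, hp, rfl⟩)
      (by simpa [V, Fintype.linearCombination_apply] using h)
  · intro h
    exact hc (V b p) (by simp [T]; exact Or.inr ⟨p, hp, rfl⟩)
      (by simpa [V, Fintype.linearCombination_apply] using h)
end
end BR
end

section
namespace BR
section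
variable {m : ℕ} {f h : PP (m + 1)} {K : ℕ}

lemma exists_pow_le_of_primes (I : Ideal (RR n)) (hI : ∀ q : Ideal (RR n), q.IsPrime → I ≤ q → ∃ L, mR n ^ L ≤ q) :
    ∃ L, mR n ^ L ≤ I := by
  apply exists_pow_le
  intro i
  rw [Ideal.radical_eq_sInf, Submodule.mem_sInf]
  rintro q ⟨hq, hqp⟩
  obtain ⟨L, hL⟩ := hI q hqp hq
  exact hqp.mem_of_pow_mem L (hL (Ideal.pow_mem_pow (X_mem_mR i) L))

theorem B4R (hm : 1 ≤ m) (H : HypR f h K) :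
    len (Ideal.span (Set.range (dR h))) + len (Ideal.span {(f : RR (m + 1))} ⊔ minors (dR f) (dR h)) =
    len (Ideal.span (Set.range (dR f))) + len (Ideal.span {(h : RR (m + 1))} ⊔ minors (dR f) (dR h)) := by
  set J := minors (dR f) (dR h) with hJ
  obtain ⟨c, hc⟩ := exists_generic (associatedPrimes (RR (m + 1)) (RR (m + 1) ⧸ J))
    (associatedPrimes.finite _ _) (dR f) (dR h)
    (fun p hp hle => H.not_le hm p hp K (H.jf.trans hle))
    (fun p hp hle => H.not_le hm p hp K (H.jh.trans hle))
  let gP : PP (m + 1) → PP (m + 1) := fun f => ∑ i, MvPolynomial.C (c i) * MvPolynomial.pderiv i f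
  have hgP : ∀ f, ((gP f : PP (m + 1)) : RR (m + 1)) = ∑ i, c i • dR f i := by
    intro f
    simp only [gP]
    rw [← MvPolynomial.coeToMvPowerSeries.ringHom_apply, map_sum]
    refine Finset.sum_congr rfl fun i _ => ?_
    rw [← MvPolynomial.smul_eq_C_mul]
    simp [dR, MvPolynomial.coeToMvPowerSeries.ringHom_apply]
  set g := gP f with hg
  set g' := gP h with hg'
  have hgn : ∀ p ∈ associatedPrimes (RR (m + 1)) (RR (m + 1) ⧸ J), (g : RR (m + 1)) ∉ p := by
    intro p hp; rw [hg, hgP]; exact (hc p hp).1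
  have hgn' : ∀ p ∈ associatedPrimes (RR (m + 1)) (RR (m + 1) ⧸ J), (g' : RR (m + 1)) ∉ p := by
    intro p hp; rw [hg', hgP]; exact (hc p hp).2
  have ng := (ass_iff J _).2 hgn
  have ng' := (ass_iff J _).2 hgn'
  have nf := H.nzd_f hm
  have nh := H.nzd_h hm
  -- relations
  have hrel : ∀ i, ((MvPolynomial.pderiv i f * g' - MvPolynomial.pderiv i h * g :
      PP (m + 1)) : RR (m + 1)) ∈ J := by
    intro i
    have e : ((MvPolynomial.pderiv i f * g' - MvPolynomial.pderiv i h * g :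
      PP (m + 1)) : RR (m + 1)) = ∑ j, c j • (dR f i * dR h j - dR f j * dR h i) := by
      rw [← MvPolynomial.coeToMvPowerSeries.ringHom_apply, map_sub, map_mul, map_mul,
        MvPolynomial.coeToMvPowerSeries.ringHom_apply, MvPolynomial.coeToMvPowerSeries.ringHom_apply,
        MvPolynomial.coeToMvPowerSeries.ringHom_apply, MvPolynomial.coeToMvPowerSeries.ringHom_apply, hg, hg', hgP, hgP,
        Finset.mul_sum, Finset.mul_sum, ← Finset.sum_sub_distrib]
      refine Finset.sum_congr rfl fun j _ => ?_
      rw [smul_sub, mul_smul_comm, mul_smul_comm, mul_comm (dR f j)]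
      rfl
    rw [e]
    refine Ideal.sum_mem _ fun j _ => ?_
    rw [← algebraMap_smul (RR (m + 1)) (c j), smul_eq_mul]
    exact Ideal.mul_mem_left _ _ (minor_mem _ _ _ _)
  have hR : ∀ p ∈ J.minimalPrimes, _ := fun p hp =>
    let hA := minimal_ass J p hp
    have hpp : p.IsPrime := hp.1.1
    rel_mod_prime p f h g g' H.hc H.fc K
      (H.kh.trans (by rw [sup_comm]; exact sup_le_sup_right hp.1.2 _))
      ((ass_iff J _).1 nf p hA) ((ass_iff J _).1 nh p hA) (hgn p hA) (hgn' p hA)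
      (fun i => hp.1.2 (hrel i))
  -- finiteness
  have hfin : ∀ x : RR (m + 1), (∀ p ∈ associatedPrimes (RR (m + 1)) (RR (m + 1) ⧸ J), x ∉ p) →
      len (Ideal.span {x} ⊔ J) ≠ ⊤ := by
    intro x hx
    obtain ⟨L, hL⟩ := exists_pow_le_of_primes (Ideal.span {x} ⊔ J) (by
      intro q hq hle
      obtain ⟨p, hp, hpq⟩ := Ideal.exists_minimalPrimes_le (le_sup_right.trans hle : J ≤ q)
      refine ⟨K, H.kh.trans (sup_le ?_ (le_sup_right.trans hle))⟩
      rw [Ideal.span_singleton_le_iff_mem]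
      refine (hR p hp).2.2 q hq (lt_of_le_of_ne hpq ?_)
      rintro rfl
      exact hx p (minimal_ass J p hp) (hle (Submodule.mem_sup_left (Ideal.mem_span_singleton_self x))))
    exact lenR_ne_top _ L hL
  have fg := hfin _ hgn
  have fg' := hfin _ hgn'
  have ff := lenR_ne_top _ K H.kf
  have fh := lenR_ne_top _ K H.kh
  have e1 := len_mul_elt J (g' : RR (m + 1)) (f : RR (m + 1)) ng'
  have e2 := len_mul_elt J (g : RR (m + 1)) (h : RR (m + 1)) ng
  have e3 := len_eq_of_rel J ((g' * f : PP (m + 1)) : RR (m + 1)) ((g * h : PP (m + 1)) : RR (m + 1))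
    (by intro x hx; rw [MvPolynomial.coe_mul, mul_assoc] at hx; exact nf _ (ng' _ hx))
    (by intro x hx; rw [MvPolynomial.coe_mul, mul_assoc] at hx; exact nh _ (ng _ hx))
    (by rw [MvPolynomial.coe_mul, e1]; exact enat_add ff fg')
    (combine J _ _ fun p hp => (hR p hp).1) (combine J _ _ fun p hp => (hR p hp).2.1)
  rw [MvPolynomial.coe_mul, MvPolynomial.coe_mul, e1, e2] at e3
  have e4 := len_rows (dR f) (dR h) (H.ham hm) (H.ham' hm) (fun i => MvPowerSeries.C (c i))
    (g : RR (m + 1)) (g' : RR (m + 1))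
    (by rw [hg, hgP]; exact Finset.sum_congr rfl fun i _ => MvPowerSeries.smul_eq_C_mul _ _)
    (by rw [hg', hgP]; exact Finset.sum_congr rfl fun i _ => MvPowerSeries.smul_eq_C_mul _ _)
  have fjf := lenR_ne_top _ K H.jf
  have fjh := lenR_ne_top _ K H.jh
  rw [← hJ] at e4
  rw [← hJ] at ff fh
  generalize len (Ideal.span {(f : RR (m + 1))} ⊔ J) = xf at *
  generalize len (Ideal.span {(h : RR (m + 1))} ⊔ J) = xh at *
  generalize len (Ideal.span {(g : RR (m + 1))} ⊔ J) = xg at *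
  generalize len (Ideal.span {(g' : RR (m + 1))} ⊔ J) = xg' at *
  generalize len (Ideal.span (Set.range (dR f))) = jf at *
  generalize len (Ideal.span (Set.range (dR h))) = jh at *
  lift xf to ℕ using ff
  lift xh to ℕ using fh
  lift xg to ℕ using fg
  lift xg' to ℕ using fg'
  lift jf to ℕ using fjf
  lift jh to ℕ using fjh
  norm_cast at *
  omega
end
end BR
end

section
namespace BR
variable {f g : (Fin n → ℂ) → ℂ}

lemma mkOn_rep (g : On n) : mkOn (On.rep g) (On.rep_analyticAt g) = g :=
  Subtype.ext (On.rep_spec g)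

lemma mkOn_eq_iff (hf : AnalyticAt ℂ f 0) (hg : AnalyticAt ℂ g 0) :
    mkOn f hf = mkOn g hg ↔ f =ᶠ[𝓝 0] g := by
  exact Subtype.ext_iff.trans Filter.Germ.coe_eq

lemma rep_mkOn (hf : AnalyticAt ℂ f 0) : On.rep (mkOn f hf) =ᶠ[𝓝 0] f := by
  rw [← mkOn_eq_iff (On.rep_analyticAt _) hf, mkOn_rep]

lemma exists_mkOn (x : On n) : ∃ (f : (Fin n → ℂ) → ℂ) (hf : AnalyticAt ℂ f 0), x = mkOn f hf :=
  ⟨_, _, (mkOn_rep x).symm⟩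

lemma mkOn_add (hf : AnalyticAt ℂ f 0) (hg : AnalyticAt ℂ g 0) :
    mkOn f hf + mkOn g hg = mkOn (fun x => f x + g x) (hf.add hg) := rfl
lemma mkOn_mul (hf : AnalyticAt ℂ f 0) (hg : AnalyticAt ℂ g 0) :
    mkOn f hf * mkOn g hg = mkOn (fun x => f x * g x) (hf.mul hg) := rfl
lemma mkOn_const (c : ℂ) : algebraMap ℂ (On n) c = mkOn (fun _ => c) analyticAt_const := rfl
lemma mkOn_zero : (0 : On n) = mkOn (fun _ => 0) analyticAt_const := rfl
lemma mkOn_one : (1 : On n) = mkOn (fun _ => 1) analyticAt_const := rfl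

/-- directional derivative is analytic -/
lemma an_fd (hf : AnalyticAt ℂ f 0) (v : Fin n → ℂ) : AnalyticAt ℂ (fun x => fderiv ℂ f x v) 0 :=
  ((ContinuousLinearMap.apply ℂ ℂ v).analyticAt (fderiv ℂ f 0)).comp hf.fderiv

lemma pd_def (i : Fin n) (g : On n) : pd i g =
    mkOn (fun x => fderiv ℂ (On.rep g) x (Pi.single i 1)) (an_fd (On.rep_analyticAt g) _) := rfl

lemma an_coord (i : Fin n) : AnalyticAt ℂ (fun x : Fin n → ℂ => x i) 0 :=
  (ContinuousLinearMap.proj (R := ℂ) (φ := fun _ : Fin n => ℂ) i).analyticAt _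

lemma coordG_def (i : Fin n) : coordG i = mkOn (fun x => x i) (an_coord i) := rfl

lemma pd_mkOn (hf : AnalyticAt ℂ f 0) (i : Fin n) :
    pd i (mkOn f hf) = mkOn (fun x => fderiv ℂ f x (Pi.single i 1)) (an_fd hf _) := by
  rw [pd_def, mkOn_eq_iff]
  filter_upwards [(rep_mkOn hf).fderiv (𝕜 := ℂ)] with x hx
  rw [hx]

lemma pd_add (i : Fin n) (x y : On n) : pd i (x + y) = pd i x + pd i y := by
  obtain ⟨f, hf, rfl⟩ := exists_mkOn x
  obtain ⟨g, hg, rfl⟩ := exists_mkOn y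
  rw [mkOn_add, pd_mkOn, pd_mkOn, pd_mkOn, mkOn_add, mkOn_eq_iff]
  filter_upwards [hf.eventually_analyticAt, hg.eventually_analyticAt] with x h1 h2
  rw [fderiv_fun_add h1.differentiableAt h2.differentiableAt]; rfl

lemma pd_mul (i : Fin n) (x y : On n) : pd i (x * y) = x * pd i y + y * pd i x := by
  obtain ⟨f, hf, rfl⟩ := exists_mkOn x
  obtain ⟨g, hg, rfl⟩ := exists_mkOn y
  rw [mkOn_mul, pd_mkOn, pd_mkOn, pd_mkOn, mkOn_mul, mkOn_mul, mkOn_add, mkOn_eq_iff]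
  filter_upwards [hf.eventually_analyticAt, hg.eventually_analyticAt] with x h1 h2
  rw [fderiv_fun_mul h1.differentiableAt h2.differentiableAt]; rfl

lemma pd_const (i : Fin n) (c : ℂ) : pd i (algebraMap ℂ (On n) c) = 0 := by
  rw [mkOn_const, pd_mkOn, mkOn_zero, mkOn_eq_iff]
  filter_upwards with x
  simp

lemma pd_coord (i j : Fin n) : pd i (coordG j) = if i = j then 1 else 0 := by
  rw [coordG_def, pd_mkOn]
  have : (fun x : Fin n → ℂ => (fderiv ℂ (fun x : Fin n → ℂ => x j) x) (Pi.single i 1)) =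
      fun _ => if i = j then 1 else 0 := by
    funext x
    have := (ContinuousLinearMap.proj (R := ℂ) (φ := fun _ : Fin n => ℂ) j).fderiv (x := x)
    have e : fderiv ℂ (fun x : Fin n → ℂ => x j) x = ContinuousLinearMap.proj (R := ℂ) (φ := fun _ : Fin n => ℂ) j := this
    rw [e]
    simp [Pi.single_apply, eq_comm]
  split_ifs with h
  · rw [mkOn_one, mkOn_eq_iff, this]; simp [h]
  · rw [mkOn_zero, mkOn_eq_iff, this]; simp [h]

/-- polynomials as germs -/
def ιO (n : ℕ) : PP n →ₐ[ℂ] On n := MvPolynomial.aeval coordG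

lemma ιO_X (i : Fin n) : ιO n (MvPolynomial.X i) = coordG i := by simp [ιO]

lemma ιO_C (c : ℂ) : ιO n (MvPolynomial.C c) = algebraMap ℂ (On n) c := by
  simp [ιO]

lemma pd_ιO (i : Fin n) (p : PP n) : pd i (ιO n p) = ιO n (MvPolynomial.pderiv i p) := by
  induction p using MvPolynomial.induction_on with
  | C a => rw [ιO_C, pd_const]; simp
  | add p q hp hq => rw [map_add, pd_add, hp, hq, map_add, map_add]
  | mul_X p j hp =>
    rw [map_mul, pd_mul, hp, ιO_X, pd_coord, Derivation.leibniz, map_add, smul_eq_mul, smul_eq_mul,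
      map_mul, map_mul, ιO_X, MvPolynomial.pderiv_X]
    congr 2
    by_cases h : i = j
    · subst h; simp
    · rw [if_neg h, Pi.single_eq_of_ne (fun h' => h h'.symm)]; simp

lemma mem_mId (hf : AnalyticAt ℂ f 0) : mkOn f hf ∈ mId n ↔ f 0 = 0 := by
  rw [mId, RingHom.mem_ker]
  change ((f : Filter.Germ (pure (0 : Fin n → ℂ)) ℂ) = ((fun _ => 0 : (Fin n → ℂ) → ℂ) : Filter.Germ (pure (0 : Fin n → ℂ)) ℂ)) ↔ _
  rw [Filter.Germ.coe_eq]
  exact Filter.eventually_pure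

lemma mem_IX {X : Set (Fin n → ℂ)} (hf : AnalyticAt ℂ f 0) :
    mkOn f hf ∈ IX n X ↔ ∀ᶠ x in 𝓝 0, x ∈ X → f x = 0 := by
  rw [IX, RingHom.mem_ker]
  change ((f : Filter.Germ (𝓝[X] (0 : Fin n → ℂ)) ℂ) = ((fun _ => 0 : (Fin n → ℂ) → ℂ) : Filter.Germ (𝓝[X] (0 : Fin n → ℂ)) ℂ)) ↔ _
  rw [Filter.Germ.coe_eq]
  exact eventually_nhdsWithin_iff

lemma coord_mem (i : Fin n) : coordG i ∈ mId n := by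
  rw [coordG_def, mem_mId]; rfl

lemma exists_const_sub_mem (x : On n) : ∃ c : ℂ, x - algebraMap ℂ (On n) c ∈ mId n := by
  obtain ⟨f, hf, rfl⟩ := exists_mkOn x
  refine ⟨f 0, ?_⟩
  rw [mkOn_const]
  have : mkOn f hf - mkOn (fun _ => f 0) analyticAt_const =
    mkOn (fun x => f x - f 0) (hf.sub analyticAt_const) := rfl
  rw [this, mem_mId]; simp

lemma mId_ne_top : mId n ≠ ⊤ := by
  intro h
  have : (1 : On n) ∈ mId n := by rw [h]; trivial
  rw [mkOn_one, mem_mId] at this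
  simp at this

/-- Hadamard -/
lemma mId_eq : mId n = Ideal.span (Set.range coordG) := by
  apply le_antisymm
  · intro x hx
    obtain ⟨f, hf, rfl⟩ := exists_mkOn x
    rw [mem_mId] at hx
    obtain ⟨p, r, hp⟩ := id hf
    have hpr : 0 < p.shift.radius := by
      rw [FormalMultilinearSeries.radius_shift]; exact hp.r_pos.trans_le hp.r_le
    have hL := p.shift.hasFPowerSeriesOnBall hpr
    set L := p.shift.sum
    have hLa : AnalyticAt ℂ L 0 := hL.analyticAt
    have hLi : ∀ i : Fin n, AnalyticAt ℂ (fun x => L x (Pi.single i 1)) 0 := fun i =>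
      ((ContinuousLinearMap.apply ℂ ℂ (Pi.single i (1:ℂ) : Fin n → ℂ)).analyticAt (L 0)).comp hLa
    have key : mkOn f hf = ∑ i, mkOn _ (hLi i) * coordG i := by
      have hs : ∀ s : Finset (Fin n), ∑ i ∈ s, mkOn _ (hLi i) * coordG i =
          mkOn (fun x => ∑ i ∈ s, L x (Pi.single i 1) * x i) (by
            refine Finset.analyticAt_fun_sum _ fun i _ => (hLi i).mul ?_
            exact an_coord i) := by
        intro s
        classical
        induction s using Finset.induction_on with
        | empty => simp; rfl
        | insert a s ha ih =>
          simp only [Finset.sum_insert ha]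
          rw [ih]; rfl
      rw [hs, mkOn_eq_iff]
      have hr : Metric.eball (0 : Fin n → ℂ) r ∈ 𝓝 0 := Metric.eball_mem_nhds _ hp.r_pos
      filter_upwards [hr] with x hx'
      have h1 := hp.hasSum hx'
      have h2 := hL.hasSum (y := x) (by
        rw [FormalMultilinearSeries.radius_shift]
        exact Metric.eball_subset_eball hp.r_le hx')
      rw [zero_add] at h1 h2
      have h3 := (ContinuousLinearMap.apply ℂ ℂ x).hasSum h2
      have h4 : HasSum (fun k => p (k + 1) fun _ => x) (L x x) := by
        have e : (fun k => p (k + 1) fun _ => x) =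
            fun b => ((ContinuousLinearMap.apply ℂ ℂ) x) ((p.shift b) fun _ => x) := by
          funext k
          change _ = (p (k + 1)).curryRight (fun _ => x) x
          rw [ContinuousMultilinearMap.curryRight_apply]
          congr 1
          funext j
          refine Fin.lastCases ?_ (fun j => ?_) j <;> simp
        rw [e]; exact h3
      have h5 := (hasSum_nat_add_iff' 1).2 h1
      have h6 := h5.unique h4
      rw [Finset.sum_range_one, hp.coeff_zero, hx, sub_zero] at h6
      rw [h6]
      have h7 := congrArg (L x) (pi_eq_sum_univ' x)
      rw [map_sum] at h7
      refine h7.trans (Finset.sum_congr rfl fun i _ => ?_)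
      rw [map_smul, smul_eq_mul, mul_comm]
    rw [key]
    exact Ideal.sum_mem _ fun i _ => Ideal.mul_mem_left _ _ (Ideal.subset_span ⟨i, rfl⟩)
  · rw [Ideal.span_le]
    rintro _ ⟨i, rfl⟩
    exact coord_mem i
end BR
end

section
namespace BR

lemma mId_map : mId n = (m0 n).map (ιO n) := by
  rw [m0_eq, Ideal.map_span, mId_eq, ← Set.range_comp]
  congr 2
  funext i
  simp [ιO_X]

lemma mId_approx_step (K : ℕ) (y : On n) (hy : y ∈ mId n ^ K) : ∃ q : PP n, y - ιO n q ∈ mId n ^ (K + 1) := by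
  rw [mId_map, ← Ideal.map_pow] at hy
  refine (?_ : y ∈ mId n ^ K ∧ _).2
  induction hy using Submodule.span_induction with
  | mem x h =>
    obtain ⟨s, hs, rfl⟩ := h
    refine ⟨?_, s, by simp⟩
    rw [mId_map, ← Ideal.map_pow]
    exact Ideal.mem_map_of_mem _ hs
  | zero => exact ⟨Ideal.zero_mem _, 0, by simp⟩
  | add x y _ _ hx hy =>
    obtain ⟨hx1, s, h1⟩ := hx
    obtain ⟨hy1, t, h2⟩ := hy
    refine ⟨Ideal.add_mem _ hx1 hy1, s + t, ?_⟩
    have : x + y - ιO n (s + t) = (x - ιO n s) + (y - ιO n t) := by rw [map_add]; ring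
    rw [this]; exact Ideal.add_mem _ h1 h2
  | smul a x _ hx =>
    obtain ⟨hx1, s, h1⟩ := hx
    obtain ⟨c, hc⟩ := exists_const_sub_mem a
    refine ⟨Ideal.mul_mem_left _ _ hx1, MvPolynomial.C c * s, ?_⟩
    have : a • x - ιO n (MvPolynomial.C c * s) =
        (a - algebraMap ℂ (On n) c) * x + algebraMap ℂ (On n) c * (x - ιO n s) := by
      rw [map_mul, smul_eq_mul, ιO_C]; ring
    rw [this]
    refine Ideal.add_mem _ ?_ (Ideal.mul_mem_left _ _ h1)
    rw [pow_succ']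
    exact Ideal.mul_mem_mul hc hx1

lemma mId_approx (K : ℕ) (x : On n) : ∃ p : PP n, x - ιO n p ∈ mId n ^ K := by
  induction K with
  | zero => exact ⟨0, by simp⟩
  | succ K ih =>
    obtain ⟨p, hp⟩ := ih
    obtain ⟨q, hq⟩ := mId_approx_step K _ hp
    exact ⟨p + q, by rw [map_add, ← sub_sub]; exact hq⟩

lemma pd_zero (i : Fin n) : pd i (0 : On n) = 0 := by
  have := pd_const i (0 : ℂ)
  rwa [map_zero] at this

lemma pd_pow_mem (i : Fin n) (K : ℕ) (x : On n) (hx : x ∈ mId n ^ (K + 1)) : pd i x ∈ mId n ^ K := by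
  induction K generalizing x with
  | zero => simp
  | succ K ih =>
    rw [pow_succ'] at hx
    refine Submodule.mul_induction_on hx ?_ ?_
    · intro a ha b hb
      rw [pd_mul]
      refine Ideal.add_mem _ ?_ (Ideal.mul_mem_right _ _ hb)
      rw [pow_succ']
      exact Ideal.mul_mem_mul ha (ih b hb)
    · intro a b ha hb
      rw [pd_add]; exact Ideal.add_mem _ ha hb

lemma ιO_mem_mId (p : PP n) : ιO n p ∈ mId n ↔ MvPolynomial.constantCoeff p = 0 := by
  have h1 : ιO n p - algebraMap ℂ _ (MvPolynomial.constantCoeff p) ∈ mId n := by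
    induction p using MvPolynomial.induction_on with
    | C a => simp [ιO_C]
    | add p q hp hq =>
      have : ιO n (p + q) - algebraMap ℂ _ (MvPolynomial.constantCoeff (p + q)) =
        (ιO n p - algebraMap ℂ _ (MvPolynomial.constantCoeff p)) +
        (ιO n q - algebraMap ℂ _ (MvPolynomial.constantCoeff q)) := by simp only [map_add]; ring
      rw [this]; exact Ideal.add_mem _ hp hq
    | mul_X p j hp =>
      rw [map_mul, map_mul, MvPolynomial.constantCoeff_X, mul_zero, map_zero, sub_zero, ιO_X]
      exact Ideal.mul_mem_left _ _ (coord_mem j)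
  constructor
  · intro h
    have h2 := Ideal.sub_mem _ h h1
    rw [sub_sub_cancel, mkOn_const, mem_mId] at h2
    exact h2
  · intro h
    rw [h, map_zero, sub_zero] at h1; exact h1

lemma ιO_mem (K : ℕ) (p : PP n) : ιO n p ∈ mId n ^ K ↔ p ∈ m0 n ^ K := by
  constructor
  · intro h
    induction K generalizing p with
    | zero => simp
    | succ K ih =>
      have h0 : MvPolynomial.constantCoeff p = 0 :=
        (ιO_mem_mId p).1 (Ideal.pow_le_self (Nat.succ_ne_zero K) h)
      have h1 : ∀ i, MvPolynomial.pderiv i p ∈ m0 n ^ K := fun i => ih _ (by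
        rw [← pd_ιO]; exact pd_pow_mem i K _ h)
      rw [MvPolynomial.mem_pow_idealOfVars_iff']
      intro d hd
      by_cases hd0 : d = 0
      · subst hd0; exact h0
      · obtain ⟨i, hi⟩ : ∃ i, d i ≠ 0 := by
          by_contra hh; push Not at hh; exact hd0 (Finsupp.ext hh)
        obtain ⟨e, rfl⟩ : ∃ e, d = e + Finsupp.single i 1 :=
          ⟨d - Finsupp.single i 1, by
            rw [tsub_add_cancel_of_le]; rw [Finsupp.single_le_iff]; omega⟩
        have h2 := (MvPolynomial.mem_pow_idealOfVars_iff' _ _).1 (h1 i) e (by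
          rw [map_add, Finsupp.degree_single] at hd; omega)
        rw [MvPolynomial.coeff_pderiv] at h2
        rcases mul_eq_zero.1 h2 with h3 | h3
        · exact h3
        · exfalso; exact Nat.cast_add_one_ne_zero (R := ℂ) (e i) h3
  · intro h
    rw [mId_map, ← Ideal.map_pow]
    exact Ideal.mem_map_of_mem _ h

lemma goodO : Good (ιO n) (mId n) where
  approx := mId_approx
  mem := ιO_mem

lemma lenO_ne_top (I : Ideal (On n)) (K : ℕ) (hK : mId n ^ K ≤ I) : len I ≠ ⊤ :=
  goodO.len_ne_top mId_map I K hK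

lemma isUnit_of_not_mem (x : On n) (hx : x ∉ mId n) : IsUnit x := by
  obtain ⟨f, hf, rfl⟩ := exists_mkOn x
  rw [mem_mId] at hx
  refine IsUnit.of_mul_eq_one (mkOn (fun x => (f x)⁻¹) (hf.inv hx)) ?_
  rw [mkOn_mul, mkOn_one, mkOn_eq_iff]
  filter_upwards [hf.continuousAt.eventually_ne hx] with x hx
  exact mul_inv_cancel₀ hx

lemma local_aux (I : Ideal (On n)) (hI : I ≠ ⊤) : I ≤ mId n := by
  intro x hx
  by_contra h
  exact hI (Ideal.eq_top_of_isUnit_mem _ hx (isUnit_of_not_mem x h))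

lemma art_aux {A B : Type*} [CommRing A] [CommRing B] (π : A →+* B) (hπ : Function.Surjective π)
    [IsArtinianRing B] (m : Ideal A) (hu : ∀ x ∈ m, ∀ y, IsUnit (x * y + 1)) :
    ∃ K, m ^ K ≤ RingHom.ker π := by
  obtain ⟨K, hK⟩ := IsArtinianRing.isNilpotent_jacobson_bot (R := B)
  refine ⟨K, ?_⟩
  have h1 : m.map π ≤ Ideal.jacobson ⊥ := by
    rw [Ideal.map_le_iff_le_comap]
    intro x hx
    rw [Ideal.mem_comap, Ideal.mem_jacobson_bot]
    intro y
    obtain ⟨y, rfl⟩ := hπ y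
    rw [← map_mul, ← map_one π, ← map_add]
    exact (hu x hx y).map _
  have h2 := Ideal.pow_right_mono h1 K
  rw [hK, ← Ideal.map_pow] at h2
  intro x hx
  rw [RingHom.mem_ker]
  exact (Ideal.mem_bot).1 (h2 (Ideal.mem_map_of_mem _ hx))

lemma pow_le_gen {A : Type*} [CommRing A] [Algebra ℂ A] (m I : Ideal A)
    (hu : ∀ x ∈ m, ∀ y, IsUnit (x * y + 1)) (hI : len I ≠ ⊤) : ∃ K, m ^ K ≤ I := by
  have hfd : FiniteDimensional ℂ (A ⧸ I) := fin_of_len hI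
  have hart : IsArtinianRing (A ⧸ I) := IsArtinianRing.of_finite ℂ _
  obtain ⟨K, hK⟩ := art_aux (Ideal.Quotient.mk I) Ideal.Quotient.mk_surjective m hu
  exact ⟨K, hK.trans (Ideal.mk_ker (I := I)).le⟩

lemma isUnit_mul_add_one (x : On n) (hx : x ∈ mId n) (y : On n) : IsUnit (x * y + 1) := by
  refine isUnit_of_not_mem _ ?_
  intro h
  have := Ideal.sub_mem _ h (Ideal.mul_mem_right y _ hx)
  rw [add_sub_cancel_left] at this
  exact mId_ne_top ((Ideal.eq_top_iff_one _).2 this)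

lemma exists_pow_le_of_len (I : Ideal (On n)) (hI : len I ≠ ⊤) : ∃ K, mId n ^ K ≤ I :=
  pow_le_gen (mId n) I isUnit_mul_add_one hI
end BR
end

section
namespace BR
section sup
variable {E : Type*} [NormedAddCommGroup E] [NormedSpace ℂ E]
  {S : Type*} [TopologicalSpace S] [CompactSpace S]

/-- The `k`-th term of the superposition operator. -/
def supTerm {k : ℕ} (p : ContinuousMultilinearMap ℂ (fun _ : Fin k => E) ℂ) :
    ContinuousMultilinearMap ℂ (fun _ : Fin k => C(S, E)) C(S, ℂ) :=
  MultilinearMap.mkContinuous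
    { toFun := fun y => ⟨fun ζ => p fun i => y i ζ, by fun_prop⟩
      map_update_add' := by
        intro _ y i a b
        ext ζ
        have e : ∀ c : C(S, E), (fun j => (Function.update y i c) j ζ)
            = Function.update (fun j => y j ζ) i (c ζ) := by
          intro c; funext j
          by_cases hj : j = i
          · subst hj; simp
          · simp [hj]
        simp [e]
      map_update_smul' := by
        intro _ y i a b
        ext ζ
        have e : ∀ c : C(S, E), (fun j => (Function.update y i c) j ζ)
            = Function.update (fun j => y j ζ) i (c ζ) := by
          intro c; funext j
          by_cases hj : j = i
          · subst hj; simp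
          · simp [hj]
        simp [e] } ‖p‖ (by
    intro y
    rw [ContinuousMap.norm_le _ (by positivity)]
    intro ζ
    refine (p.le_opNorm _).trans ?_
    gcongr with i
    exact (y i).norm_coe_le_norm ζ)

lemma supTerm_apply {k : ℕ} (p : ContinuousMultilinearMap ℂ (fun _ : Fin k => E) ℂ)
    (y : Fin k → C(S, E)) (ζ : S) : supTerm p y ζ = p fun i => y i ζ := rfl

lemma supTerm_norm {k : ℕ} (p : ContinuousMultilinearMap ℂ (fun _ : Fin k => E) ℂ) :
    ‖supTerm (S := S) p‖ ≤ ‖p‖ := MultilinearMap.mkContinuous_norm_le _ (norm_nonneg _) _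

/-- superposition series -/
def supSer (p : FormalMultilinearSeries ℂ E ℂ) : FormalMultilinearSeries ℂ C(S, E) C(S, ℂ) :=
  fun k => supTerm (p k)

lemma supSer_radius (p : FormalMultilinearSeries ℂ E ℂ) :
    p.radius ≤ (supSer (S := S) p).radius :=
  FormalMultilinearSeries.radius_le_of_le fun {k} => supTerm_norm (p k)

lemma sup_analytic {g : E → ℂ} {p : FormalMultilinearSeries ℂ E ℂ} {y : E} {R : ENNReal}
    (hg : HasFPowerSeriesOnBall g p y R) : ∃ G : C(S, E) → C(S, ℂ),
      ∀ w : C(S, E), (‖w‖ₑ < R) → AnalyticAt ℂ G w ∧ ∀ ζ, G w ζ = g (y + w ζ) := by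
  have hr : R ≤ (supSer (S := S) p).radius := hg.r_le.trans (supSer_radius p)
  have hP := (supSer (S := S) p).hasFPowerSeriesOnBall (hg.r_pos.trans_le hr)
  refine ⟨(supSer (S := S) p).sum, fun w hw => ⟨?_, fun ζ => ?_⟩⟩
  · refine hP.analyticAt_of_mem ?_
    rw [Metric.mem_eball, edist_zero_right]
    exact hw.trans_le hr
  · have h1 := hP.hasSum (y := w) (by
      rw [Metric.mem_eball, edist_zero_right]; exact hw.trans_le hr)
    rw [zero_add] at h1
    have h2 := h1.mapL (ContinuousMap.evalCLM ℂ ζ)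
    have h3 := hg.hasSum (y := w ζ) (by
      rw [Metric.mem_eball, edist_zero_right]
      refine lt_of_le_of_lt ?_ hw
      rw [enorm_le_iff_norm_le]
      exact w.norm_coe_le_norm ζ)
    exact h2.unique h3
end sup
end BR
end

section
namespace BR
section L
open Metric
variable {E : Type*} [NormedAddCommGroup E] [NormedSpace ℂ E]

/-- circle mean as a functional on continuous functions on the circle -/
def cmean (r : ℝ) (hr : 0 ≤ r) : C(sphere (0 : ℂ) r, ℂ) →L[ℂ] ℂ :=
  LinearMap.mkContinuous
    { toFun := fun u => (2 * Real.pi : ℂ)⁻¹ *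
        ∫ θ in (0:ℝ)..2 * Real.pi, u ⟨circleMap 0 r θ, circleMap_mem_sphere 0 hr θ⟩
      map_add' := by
        intro u v
        rw [← mul_add, ← intervalIntegral.integral_add]
        · rfl
        · apply Continuous.intervalIntegrable; fun_prop
        · apply Continuous.intervalIntegrable; fun_prop
      map_smul' := by
        intro c u
        simp only [ContinuousMap.smul_apply, smul_eq_mul, RingHom.id_apply,
          intervalIntegral.integral_const_mul]
        ring } 1 (by
    intro u
    have h := intervalIntegral.norm_integral_le_of_norm_le_const
      (a := 0) (b := 2 * Real.pi) (C := ‖u‖)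
      (f := fun θ => u ⟨circleMap 0 r θ, circleMap_mem_sphere 0 hr θ⟩)
      (fun θ _ => u.norm_coe_le_norm _)
    have hp := Real.two_pi_pos
    rw [sub_zero, abs_of_pos hp] at h
    have e : ‖(2 * Real.pi : ℂ)⁻¹‖ = (2 * Real.pi)⁻¹ := by
      rw [norm_inv]
      congr 1
      rw [show (2 * Real.pi : ℂ) = ((2 * Real.pi : ℝ) : ℂ) by push_cast; rfl,
        Complex.norm_real, Real.norm_of_nonneg hp.le]
    show ‖(2 * Real.pi : ℂ)⁻¹ * _‖ ≤ _
    rw [norm_mul, e, inv_mul_le_iff₀ hp]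
    linarith)

lemma cmean_eq (r : ℝ) (hr : 0 ≤ r) (u : C(sphere (0 : ℂ) r, ℂ)) (φ : ℂ → ℂ)
    (hφ : ∀ ζ, u ζ = φ ζ) : cmean r hr u = Real.circleAverage φ 0 r := by
  rw [Real.circleAverage_def]
  show (2 * Real.pi : ℂ)⁻¹ * _ = _
  have e : (fun θ => u ⟨circleMap 0 r θ, circleMap_mem_sphere 0 hr θ⟩)
      = fun θ => φ (circleMap 0 r θ) := funext fun θ => hφ _
  rw [e, Complex.real_smul]
  push_cast
  rfl

/-- the analytic family of circles -/
def circ (r : ℝ) (y v x : E) : C(sphere (0 : ℂ) r, E) :=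
  ⟨fun ζ => (x - y) + (ζ : ℂ) • v, by fun_prop⟩

lemma circ_analytic (r : ℝ) (y v x : E) : AnalyticAt ℂ (circ r y v) x := by
  have e : circ r y v = fun x => (ContinuousLinearMap.const ℂ (sphere (0 : ℂ) r) : E →L[ℂ] _) x
      + circ r y v 0 := by
    funext x
    ext ζ
    simp [circ]
    abel
  rw [e]
  exact (ContinuousLinearMap.analyticAt _ _).add analyticAt_const

theorem lemmaL {g h : E → ℂ} {pg ph : FormalMultilinearSeries ℂ E ℂ} {y v : E} {R : ENNReal}
    (hg : HasFPowerSeriesOnBall g pg y R) (hh : HasFPowerSeriesOnBall h ph y R)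
    {r : ℝ} (hr : 0 < r) (hrv : ENNReal.ofReal (r * ‖v‖) < R)
    (hne : ∀ ζ : ℂ, ‖ζ‖ = r → h (y + ζ • v) ≠ 0)
    (D : Set E) (hD : Dense D)
    (hφ : ∀ᶠ x in 𝓝 y, x ∈ D → ∃ φ : ℂ → ℂ, DiffContOnCl ℂ φ (ball 0 r) ∧
      ∀ ζ ∈ closedBall (0:ℂ) r, φ ζ * h (x + ζ • v) = g (x + ζ • v)) :
    ∃ q : E → ℂ, AnalyticAt ℂ q y ∧ ∀ᶠ x in 𝓝 y, q x * h x = g x := by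
  obtain ⟨G, hG⟩ := sup_analytic (S := sphere (0 : ℂ) r) hg
  obtain ⟨H, hH⟩ := sup_analytic (S := sphere (0 : ℂ) r) hh
  have hc0 : ‖circ r y v y‖ₑ < R := by
    refine lt_of_le_of_lt ?_ hrv
    rw [← ofReal_norm]
    refine ENNReal.ofReal_le_ofReal ?_
    rw [ContinuousMap.norm_le _ (by positivity)]
    intro ζ
    have h1 : ‖(ζ : ℂ)‖ = r := by simpa using ζ.2
    simp [circ, norm_smul, h1]
  have hcont := (circ_analytic r y v y).continuousAt
  have hc : ∀ᶠ x in 𝓝 y, ‖circ r y v x‖ₑ < R :=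
    (hcont.enorm).eventually_lt_const hc0
  have ev : ∀ x : E, ∀ ζ : sphere (0 : ℂ) r, y + circ r y v x ζ = x + (ζ : ℂ) • v := by
    intro x ζ; simp only [circ, ContinuousMap.coe_mk]; abel
  have hun : IsUnit (H (circ r y v y)) := by
    rw [ContinuousMap.isUnit_iff_forall_ne_zero]
    intro ζ
    rw [(hH _ hc0).2, ev]
    exact hne _ (by simpa using ζ.2)
  have hHa : AnalyticAt ℂ (fun x => H (circ r y v x)) y :=
    (hH _ hc0).1.comp (circ_analytic r y v y)
  have hGa : AnalyticAt ℂ (fun x => G (circ r y v x)) y :=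
    (hG _ hc0).1.comp (circ_analytic r y v y)
  have hI : AnalyticAt ℂ (fun x => Ring.inverse (H (circ r y v x))) y := by
    obtain ⟨u, hu⟩ := hun
    have := analyticAt_inverse (𝕜 := ℂ) u
    rw [hu] at this
    exact AnalyticAt.comp (f := fun x => H (circ r y v x)) (g := Ring.inverse) this hHa
  have hunn : ∀ᶠ x in 𝓝 y, IsUnit (H (circ r y v x)) :=
    hHa.continuousAt.eventually (Units.isOpen.mem_nhds hun)
  let q : E → ℂ := fun x => cmean r hr.le (G (circ r y v x) * Ring.inverse (H (circ r y v x)))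
  have hq : AnalyticAt ℂ q y :=
    ((cmean r hr.le).analyticAt _).comp (hGa.mul hI)
  refine ⟨q, hq, ?_⟩
  have hqD : ∀ᶠ x in 𝓝 y, x ∈ D → q x * h x = g x := by
    filter_upwards [hφ, hc, hunn] with x hx hcx hux hxD
    obtain ⟨φ, hφd, hφe⟩ := hx hxD
    have e : ∀ ζ : sphere (0 : ℂ) r,
        (G (circ r y v x) * Ring.inverse (H (circ r y v x))) ζ = φ ζ := by
      intro ζ
      have h1 : H (circ r y v x) * Ring.inverse (H (circ r y v x)) = 1 :=
        Ring.mul_inverse_cancel _ hux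
      have h2 : G (circ r y v x) ζ = φ ζ * H (circ r y v x) ζ := by
        rw [(hG _ hcx).2, (hH _ hcx).2, ev]
        exact (hφe ζ (sphere_subset_closedBall ζ.2)).symm
      have h3 := congrArg (fun u : C(sphere (0 : ℂ) r, ℂ) => u ζ) h1
      simp only [ContinuousMap.mul_apply, ContinuousMap.one_apply] at h3
      rw [ContinuousMap.mul_apply, h2, mul_assoc, h3, mul_one]
    have h4 : q x = φ 0 := by
      show cmean r hr.le _ = _
      rw [cmean_eq r hr.le _ φ e]
      exact DiffContOnCl.circleAverage (by rwa [abs_of_pos hr])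
    have := hφe 0 (by simp [hr.le])
    rw [zero_smul, add_zero] at this
    rw [h4, this]
  -- density
  have hga := hg.analyticAt.eventually_analyticAt
  have hha := hh.analyticAt.eventually_analyticAt
  have hqa := hq.eventually_analyticAt
  obtain ⟨U, hU, hUo, hyU⟩ := _root_.eventually_nhds_iff.1 (hqD.and (hga.and (hha.and hqa)))
  filter_upwards [hUo.mem_nhds hyU] with x hx
  have hcl : x ∈ closure (U ∩ D) := by
    exact hD.open_subset_closure_inter hUo hx
  have hF : ContinuousAt (fun x => q x * h x - g x) x := by
    obtain ⟨_, a, b, c⟩ := hU x hx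
    exact (c.continuousAt.mul b.continuousAt).sub a.continuousAt
  have : (fun x => q x * h x - g x) x ∈ closure ({0} : Set ℂ) := by
    refine hF.continuousWithinAt.mem_closure hcl ?_
    intro z hz
    simp [(hU z hz.1).1 hz.2]
  rw [closure_singleton, Set.mem_singleton_iff, sub_eq_zero] at this
  exact this
end L
end BR
end

section
namespace BR
section glue
open Metric
variable {E : Type*} [NormedAddCommGroup E] [NormedSpace ℂ E]

lemma eq_of_freq {h q q' : E → ℂ} {z : E} (hq : ContinuousAt q z) (hq' : ContinuousAt q' z)
    (hz : ∃ᶠ x in 𝓝 z, h x ≠ 0) (he : ∀ᶠ x in 𝓝 z, q x * h x = q' x * h x) : q z = q' z := by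
  by_contra hne
  have h1 : ∀ᶠ x in 𝓝 z, q x - q' x ≠ 0 :=
    (hq.sub hq').eventually_ne (sub_ne_zero.2 hne)
  obtain ⟨x, hx, h2, h3⟩ := (hz.and_eventually (h1.and he)).exists
  exact h2 (sub_eq_zero.2 (mul_right_cancel₀ hx h3))

theorem glue {g h : E → ℂ} (U : Set E) (hU : IsOpen U)
    (hz : ∀ y ∈ U, ∃ᶠ x in 𝓝 y, h x ≠ 0)
    (hl : ∀ y ∈ U, ∃ q : E → ℂ, AnalyticAt ℂ q y ∧ ∀ᶠ x in 𝓝 y, q x * h x = g x) :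
    ∃ Q : E → ℂ, ∀ y ∈ U, AnalyticAt ℂ Q y ∧ Q y * h y = g y := by
  classical
  choose! q hqa hqe using hl
  refine ⟨fun y => q y y, fun y hy => ⟨?_, (hqe y hy).self_of_nhds⟩⟩
  refine (hqa y hy).congr ?_
  filter_upwards [hU.mem_nhds hy, (hqa y hy).eventually_analyticAt, (hqe y hy).eventually_nhds]
    with z hzU ha he
  refine eq_of_freq ha.continuousAt (hqa z hzU).continuousAt (hz z hzU) ?_
  filter_upwards [he, hqe z hzU] with x h1 h2
  rw [h1, h2]

lemma freq_ne_of_deriv {a : ℂ → ℂ} {z : ℂ} (ha : AnalyticAt ℂ a z) (h : a z ≠ 0 ∨ deriv a z ≠ 0) :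
    ∃ᶠ x in 𝓝 z, a x ≠ 0 := by
  rw [Filter.Frequently]
  intro hn
  have hn : a =ᶠ[𝓝 z] fun _ => 0 := by
    filter_upwards [hn] with x hx
    simpa using hx
  rcases h with h | h
  · exact h hn.self_of_nhds
  · apply h; rw [hn.deriv_eq]; simp

lemma dslope_an {a : ℂ → ℂ} {z : ℂ} (ha : AnalyticAt ℂ a z) : AnalyticAt ℂ (dslope a z) z := by
  obtain ⟨p, hp⟩ := ha
  exact hp.has_fpower_series_dslope_fslope.analyticAt

theorem oneVar {a b : ℂ → ℂ} (U : Set ℂ) (hU : IsOpen U) (ha : ∀ z ∈ U, AnalyticAt ℂ a z)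
    (hb : ∀ z ∈ U, AnalyticAt ℂ b z) (hs : ∀ z ∈ U, a z = 0 → deriv a z ≠ 0)
    (hab : ∀ z ∈ U, a z = 0 → b z = 0) :
    ∃ φ : ℂ → ℂ, ∀ z ∈ U, AnalyticAt ℂ φ z ∧ φ z * a z = b z := by
  refine glue U hU (fun z hz => freq_ne_of_deriv (ha z hz) ?_) ?_
  · by_cases h : a z = 0
    · exact Or.inr (hs z hz h)
    · exact Or.inl h
  · intro z hz
    by_cases h : a z = 0
    · have hd : dslope a z z ≠ 0 := by rw [dslope_same]; exact hs z hz h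
      have hda := dslope_an (ha z hz)
      refine ⟨fun x => dslope b z x / dslope a z x, (dslope_an (hb z hz)).div hda hd, ?_⟩
      filter_upwards [hda.continuousAt.eventually_ne hd] with x hx
      have e1 := sub_smul_dslope a z x
      have e2 := sub_smul_dslope b z x
      rw [h, sub_zero, smul_eq_mul] at e1
      rw [hab z hz h, sub_zero, smul_eq_mul] at e2
      rw [← e1, ← e2]
      field_simp
    · refine ⟨fun x => b x / a x, (hb z hz).div (ha z hz) h, ?_⟩
      filter_upwards [(ha z hz).continuousAt.eventually_ne h] with x hx
      field_simp

lemma line_an {g : E → ℂ} {x v : E} {ζ : ℂ} (hg : AnalyticAt ℂ g (x + ζ • v)) :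
    AnalyticAt ℂ (fun ζ : ℂ => g (x + ζ • v)) ζ := by
  have h : AnalyticAt ℂ (fun ζ : ℂ => x + ζ • v) ζ :=
    analyticAt_const.add (((ContinuousLinearMap.id ℂ ℂ).smulRight v).analyticAt ζ)
  exact AnalyticAt.comp (f := fun ζ : ℂ => x + ζ • v) (g := g) hg h

lemma line_deriv {g : E → ℂ} {x v : E} {ζ : ℂ} (hg : AnalyticAt ℂ g (x + ζ • v)) :
    deriv (fun ζ : ℂ => g (x + ζ • v)) ζ = fderiv ℂ g (x + ζ • v) v := by
  have h : HasDerivAt (fun ζ : ℂ => x + ζ • v) v ζ := by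
    have := ((hasDerivAt_id ζ).smul_const v).const_add x
    simpa using this
  exact (hg.differentiableAt.hasFDerivAt.comp_hasDerivAt ζ h).deriv

lemma common_ball {g h : E → ℂ} {y : E} (hg : AnalyticAt ℂ g y) (hh : AnalyticAt ℂ h y) :
    ∃ R : ENNReal, 0 < R ∧ ∃ pg ph : FormalMultilinearSeries ℂ E ℂ, HasFPowerSeriesOnBall g pg y R ∧
      HasFPowerSeriesOnBall h ph y R := by
  obtain ⟨pg, r1, h1⟩ := hg
  obtain ⟨ph, r2, h2⟩ := hh
  have h0 : 0 < min r1 r2 := lt_min h1.r_pos h2.r_pos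
  exact ⟨min r1 r2, h0, pg, ph, h1.mono h0 (min_le_left _ _), h2.mono h0 (min_le_right _ _)⟩

lemma ev_small (v : E) {R : ENNReal} (hR : 0 < R) {ρ : ℝ} (hρ : 0 < ρ) :
    ∀ᶠ r in 𝓝[>] (0 : ℝ), ENNReal.ofReal (r * ‖v‖) < R ∧ r * ‖v‖ < ρ := by
  have hc : Tendsto (fun r : ℝ => r * ‖v‖) (𝓝[>] 0) (𝓝 0) := by
    have : ContinuousAt (fun r : ℝ => r * ‖v‖) 0 := by fun_prop
    have := this.tendsto
    rw [zero_mul] at this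
    exact this.mono_left nhdsWithin_le_nhds
  have h2 : Tendsto (fun r : ℝ => ENNReal.ofReal (r * ‖v‖)) (𝓝[>] 0) (𝓝 0) := by
    have := ENNReal.tendsto_ofReal hc
    simpa using this
  exact (h2.eventually_lt_const hR).and (hc.eventually_lt_const hρ)

lemma ev_ne {a : ℂ → ℂ} (ha : ∀ᶠ z in 𝓝[≠] (0:ℂ), a z ≠ 0) :
    ∀ᶠ r in 𝓝[>] (0 : ℝ), ∀ ζ : ℂ, ‖ζ‖ = r → a ζ ≠ 0 := by
  rw [eventually_nhdsWithin_iff, Metric.eventually_nhds_iff] at ha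
  obtain ⟨ε, hε, h⟩ := ha
  filter_upwards [Ioo_mem_nhdsGT hε] with r hr ζ hζ
  refine h ?_ ?_
  · rw [dist_zero_right, hζ]; exact hr.2
  · intro h0
    rw [Set.mem_singleton_iff] at h0
    rw [h0, norm_zero] at hζ
    exact hr.1.ne hζ

/-- local division at a smooth point -/
theorem divSmooth {g h : E → ℂ} {y : E} (hg : AnalyticAt ℂ g y) (hh : AnalyticAt ℂ h y)
    (hy : h y = 0) (hd : fderiv ℂ h y ≠ 0) (hv : ∀ᶠ x in 𝓝 y, h x = 0 → g x = 0) :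
    ∃ q : E → ℂ, AnalyticAt ℂ q y ∧ ∀ᶠ x in 𝓝 y, q x * h x = g x := by
  obtain ⟨v, hdv⟩ : ∃ v, fderiv ℂ h y v ≠ 0 := by
    by_contra hn
    push Not at hn
    exact hd (ContinuousLinearMap.ext hn)
  have hdc : ∀ᶠ x in 𝓝 y, fderiv ℂ h x v ≠ 0 := by
    have : ContinuousAt (fun x => fderiv ℂ h x v) y :=
      hh.fderiv.continuousAt.clm_apply continuousAt_const
    exact this.eventually_ne hdv
  obtain ⟨ρ, hρ, hW⟩ := Metric.eventually_nhds_iff.1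
    (hv.and (hdc.and (hg.eventually_analyticAt.and hh.eventually_analyticAt)))
  obtain ⟨R, hR, pg, ph, hpg, hph⟩ := common_ball hg hh
  have hh0 : AnalyticAt ℂ h (y + (0:ℂ) • v) := by simpa using hh
  have hane : ∀ᶠ z in 𝓝[≠] (0:ℂ), h (y + z • v) ≠ 0 := by
    rcases (line_an hh0).eventually_eq_zero_or_eventually_ne_zero with h1 | h1
    · exfalso
      have h1 : (fun ζ : ℂ => h (y + ζ • v)) =ᶠ[𝓝 0] fun _ => 0 := h1
      have h2 := line_deriv hh0
      rw [h1.deriv_eq] at h2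
      simp at h2
      exact hdv h2.symm
    · exact h1
  obtain ⟨r, ⟨⟨hr1, hr2⟩, hr3⟩, hr0⟩ := ((((ev_small v hR (half_pos hρ)).and
    (ev_ne hane)).and self_mem_nhdsWithin)).exists
  refine lemmaL hpg hph (v := v) hr0 hr1 hr3 Set.univ dense_univ ?_
  filter_upwards [Metric.ball_mem_nhds y (half_pos hρ)] with x hx _
  have hcontl : Continuous fun ζ : ℂ => x + ζ • v := by fun_prop
  have hball : ∀ ζ ∈ closedBall (0:ℂ) r, x + ζ • v ∈ ball y ρ := by
    intro ζ hζ
    rw [mem_ball_iff_norm] at hx ⊢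
    rw [mem_closedBall_zero_iff] at hζ
    have h1 : ‖ζ • v‖ ≤ r * ‖v‖ := by rw [norm_smul]; gcongr
    have h2 : x + ζ • v - y = (x - y) + ζ • v := by abel
    rw [h2]
    linarith [norm_add_le (x - y) (ζ • v)]
  obtain ⟨φ, hφ⟩ := oneVar (a := fun ζ : ℂ => h (x + ζ • v)) (b := fun ζ : ℂ => g (x + ζ • v))
    ((fun ζ : ℂ => x + ζ • v) ⁻¹' ball y ρ) (isOpen_ball.preimage hcontl)
    (fun z hz => line_an (hW hz).2.2.2) (fun z hz => line_an (hW hz).2.2.1)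
    (fun z hz _ => by rw [line_deriv (hW hz).2.2.2]; exact (hW hz).2.1)
    (fun z hz h0 => (hW hz).1 h0)
  refine ⟨φ, ?_, fun ζ hζ => (hφ ζ (hball ζ hζ)).2⟩
  refine DifferentiableOn.diffContOnCl_ball (c := 0) (U := closedBall 0 r) ?_ subset_rfl
  intro ζ hζ
  exact (hφ ζ (hball ζ hζ)).1.differentiableAt.differentiableWithinAt

lemma freq_ne_of_fderiv {h : E → ℂ} {z : E} (hd : h z ≠ 0 ∨ fderiv ℂ h z ≠ 0) :
    ∃ᶠ x in 𝓝 z, h x ≠ 0 := by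
  rw [Filter.Frequently]
  intro hn
  have hn : h =ᶠ[𝓝 z] fun _ => 0 := by
    filter_upwards [hn] with x hx
    simpa using hx
  rcases hd with h | h
  · exact h hn.self_of_nhds
  · apply h; rw [hn.fderiv_eq]; simp

theorem divIso {g h : E → ℂ} (hg : AnalyticAt ℂ g 0) (hh : AnalyticAt ℂ h 0) (h0 : h 0 = 0)
    (hD : ∀ v : E, Dense ((Submodule.span ℂ {v} : Submodule ℂ E) : Set E)ᶜ)
    (hf : ∃ᶠ x in 𝓝 0, h x ≠ 0)
    (hd : ∀ᶠ x in 𝓝 (0:E), x ≠ 0 → fderiv ℂ h x ≠ 0)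
    (hv : ∀ᶠ x in 𝓝 (0:E), h x = 0 → g x = 0) :
    ∃ q : E → ℂ, AnalyticAt ℂ q 0 ∧ ∀ᶠ x in 𝓝 0, q x * h x = g x := by
  obtain ⟨ρ, hρ, hW⟩ := Metric.eventually_nhds_iff_ball.1
    (hd.and (hv.and (hg.eventually_analyticAt.and hh.eventually_analyticAt)))
  obtain ⟨Q, hQ⟩ := glue (g := g) (h := h) (ball 0 ρ \ {0}) (isOpen_ball.sdiff isClosed_singleton)
    (fun y hy => freq_ne_of_fderiv (Or.inr ((hW y hy.1).1 hy.2)))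
    (fun y hy => by
      obtain ⟨h1, h2, h3, h4⟩ := hW y hy.1
      by_cases hz : h y = 0
      · refine divSmooth h3 h4 hz (h1 hy.2) ?_
        filter_upwards [isOpen_ball.mem_nhds hy.1] with x hx
        exact (hW x hx).2.1
      · refine ⟨fun x => g x / h x, h3.div h4 hz, ?_⟩
        filter_upwards [h4.continuousAt.eventually_ne hz] with x hx
        field_simp)
  obtain ⟨v, hvn, hvρ⟩ := (hf.and_eventually (ball_mem_nhds (0:E) hρ)).exists
  have hlv : ∀ ζ ∈ closedBall (0:ℂ) 1, (0:E) + ζ • v ∈ ball (0:E) ρ := by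
    intro ζ hζ
    rw [mem_closedBall_zero_iff] at hζ
    rw [dist_zero_right] at hvρ
    rw [mem_ball_zero_iff]
    rw [zero_add, norm_smul]
    nlinarith [norm_nonneg v, norm_nonneg ζ]
  have hane : ∀ᶠ z in 𝓝[≠] (0:ℂ), h (0 + z • v) ≠ 0 := by
    have hl0 := line_an (hW _ (hlv 0 (by simp))).2.2.2
    rcases hl0.eventually_eq_zero_or_eventually_ne_zero with h1 | h1
    · exfalso
      have ha : AnalyticOnNhd ℂ (fun ζ : ℂ => h (0 + ζ • v)) (closedBall 0 1) :=
        fun ζ hζ => line_an (hW _ (hlv ζ hζ)).2.2.2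
      have := ha.eqOn_zero_of_preconnected_of_eventuallyEq_zero
        (convex_closedBall _ _).isPreconnected (by simp : (0:ℂ) ∈ closedBall 0 1) h1
        (by simp : (1:ℂ) ∈ closedBall 0 1)
      simp at this
      exact hvn this
    · exact h1
  obtain ⟨R, hR, pg, ph, hpg, hph⟩ := common_ball hg hh
  obtain ⟨r, ⟨⟨hr1, hr2⟩, hr3⟩, hr0⟩ := ((((ev_small v hR (half_pos hρ)).and
    (ev_ne hane)).and self_mem_nhdsWithin)).exists
  refine lemmaL hpg hph (v := v) hr0 hr1 hr3 _ (hD v) ?_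
  filter_upwards [Metric.ball_mem_nhds (0:E) (half_pos hρ)] with x hx hxD
  have hball : ∀ ζ ∈ closedBall (0:ℂ) r, x + ζ • v ∈ ball (0:E) ρ \ {0} := by
    intro ζ hζ
    constructor
    · rw [mem_ball_zero_iff] at hx ⊢
      rw [mem_closedBall_zero_iff] at hζ
      have h1 : ‖ζ • v‖ ≤ r * ‖v‖ := by rw [norm_smul]; gcongr
      linarith [norm_add_le x (ζ • v)]
    · intro h1
      apply hxD
      rw [Set.mem_singleton_iff] at h1
      rw [eq_neg_of_add_eq_zero_left h1]
      exact Submodule.neg_mem _ (Submodule.smul_mem _ _ (Submodule.mem_span_singleton_self v))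
  refine ⟨fun ζ => Q (x + ζ • v), ?_, fun ζ hζ => (hQ _ (hball ζ hζ)).2⟩
  refine DifferentiableOn.diffContOnCl_ball (c := 0) (U := closedBall 0 r) ?_ subset_rfl
  intro ζ hζ
  exact (line_an (hQ _ (hball ζ hζ)).1).differentiableAt.differentiableWithinAt
end glue
end BR
end

section
namespace BR
variable {H : (Fin n → ℂ) → ℂ}

lemma dense_line (hn : 2 ≤ n) (v : Fin n → ℂ) :
    Dense ((Submodule.span ℂ {v} : Submodule ℂ (Fin n → ℂ)) : Set (Fin n → ℂ))ᶜ := by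
  rw [← interior_eq_empty_iff_dense_compl]
  by_contra h
  have h1 := Submodule.eq_top_of_nonempty_interior' (Submodule.span ℂ {v})
    (Set.nonempty_iff_ne_empty.2 h)
  have h2 := finrank_span_le_card (R := ℂ) ({v} : Set (Fin n → ℂ))
  rw [h1, finrank_top, Module.finrank_fin_fun] at h2
  simp at h2
  omega

lemma crit_isolated (hH : AnalyticAt ℂ H 0) {K : ℕ} (hK : mId n ^ K ≤ Jac n (mkOn H hH)) :
    ∀ᶠ x in 𝓝 (0 : Fin n → ℂ), x ≠ 0 → fderiv ℂ H x ≠ 0 := by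
  have h1 : Jac n (mkOn H hH) ≤ IX n {x | fderiv ℂ H x = 0} := by
    rw [Jac, Ideal.span_le]
    rintro _ ⟨i, rfl⟩
    show pd i (mkOn H hH) ∈ _
    rw [SetLike.mem_coe, pd_mkOn, mem_IX]
    filter_upwards with x hx
    rw [hx]; rfl
  have h2 : ∀ i : Fin n, ∀ᶠ x in 𝓝 (0 : Fin n → ℂ), fderiv ℂ H x = 0 → x i = 0 := by
    intro i
    have h3 : coordG i ^ K ∈ IX n {x | fderiv ℂ H x = 0} :=
      h1 (hK (Ideal.pow_mem_pow (coord_mem i) K))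
    have h4 : coordG i ^ K = mkOn (fun x => x i ^ K) ((an_coord i).pow K) := by
      rw [coordG_def]; rfl
    rw [h4, mem_IX] at h3
    filter_upwards [h3] with x hx h
    exact eq_zero_of_pow_eq_zero (hx h)
  filter_upwards [eventually_all.2 h2] with x hx hx0 h
  exact hx0 (funext fun i => hx i h)

lemma H_freq (hn : 1 ≤ n) (hd : ∀ᶠ x in 𝓝 (0 : Fin n → ℂ), x ≠ 0 → fderiv ℂ H x ≠ 0) :
    ∃ᶠ x in 𝓝 (0 : Fin n → ℂ), H x ≠ 0 := by
  have : NeZero n := ⟨by omega⟩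
  have : Nontrivial (Fin n → ℂ) := inferInstance
  intro h
  have h1 : H =ᶠ[𝓝 0] fun _ => 0 := by
    filter_upwards [h] with x hx; simpa using hx
  have h2 : ∀ᶠ x in 𝓝[≠] (0 : Fin n → ℂ), False := by
    rw [eventually_nhdsWithin_iff]
    filter_upwards [hd, h1.fderiv (𝕜 := ℂ)] with x hx h2 hx0
    apply hx hx0
    rw [h2]; simp
  have : NeBot (𝓝[≠] (0 : Fin n → ℂ)) := inferInstance
  exact h2.exists.elim (fun _ h => h)

theorem IX_eq (hn : 2 ≤ n) (hH : AnalyticAt ℂ H 0) (hH0 : H 0 = 0) {K : ℕ}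
    (hK : mId n ^ K ≤ Jac n (mkOn H hH)) : IX n (H ⁻¹' {0}) = Ideal.span {mkOn H hH} := by
  have hd := crit_isolated hH hK
  apply le_antisymm
  · intro x hx
    obtain ⟨g, hg, rfl⟩ := exists_mkOn x
    rw [mem_IX] at hx
    obtain ⟨q, hq, hqe⟩ := divIso hg hH hH0 (dense_line hn) (H_freq (by omega) hd) hd
      (by filter_upwards [hx] with x hx h using hx h)
    rw [Ideal.mem_span_singleton']
    refine ⟨mkOn q hq, ?_⟩
    rw [mkOn_mul, mkOn_eq_iff]
    exact hqe
  · rw [Ideal.span_singleton_le_iff_mem, mem_IX]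
    filter_upwards with x hx using hx

theorem ThetaX_eq (hn : 2 ≤ n) (hH : AnalyticAt ℂ H 0) (hH0 : H 0 = 0) {K : ℕ}
    (hK : mId n ^ K ≤ Jac n (mkOn H hH)) : ThetaX n (H ⁻¹' {0}) = ThetaF n (mkOn H hH) := by
  ext δ
  have h1 : δ ∈ ThetaX n (H ⁻¹' {0}) ↔ ∀ g ∈ IX n (H ⁻¹' {0}), applyVF δ g ∈ IX n (H ⁻¹' {0}) :=
    Iff.rfl
  have h2 : δ ∈ ThetaF n (mkOn H hH) ↔ applyVF δ (mkOn H hH) ∈ Ideal.span {mkOn H hH} := Iff.rfl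
  rw [h1, h2, IX_eq hn hH hH0 hK]
  constructor
  · intro h
    exact h _ (Ideal.mem_span_singleton_self _)
  · intro h g hg
    obtain ⟨c, rfl⟩ := Ideal.mem_span_singleton'.1 hg
    have e : applyVF δ (c * mkOn H hH) = c * applyVF δ (mkOn H hH) + applyVF δ c * mkOn H hH := by
      simp only [applyVF, pd_mul, mul_add, Finset.sum_add_distrib, Finset.mul_sum, Finset.sum_mul]
      congr 1
      · exact Finset.sum_congr rfl fun i _ => by ring
      · exact Finset.sum_congr rfl fun i _ => by ring
    rw [e]
    exact Ideal.add_mem _ (Ideal.mul_mem_left _ _ h)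
      (Ideal.mul_mem_left _ _ (Ideal.mem_span_singleton_self _))
end BR
end

section
namespace BR
section nak
variable {A : Type*} [CommRing A] (m : Ideal A)

lemma nak (hm : m.FG) (hu : ∀ x ∈ m, ∀ y, IsUnit (x * y + 1)) (I : Ideal A) (K : ℕ)
    (h : m ^ K ≤ I ⊔ m ^ (K + 1)) : m ^ K ≤ I := by
  refine Submodule.le_of_le_smul_of_le_jacobson_bot (I := m) (Ideal.FG.pow hm) ?_ ?_
  · intro x hx
    rw [Ideal.mem_jacobson_bot]
    exact hu x hx
  · rw [smul_eq_mul, ← pow_succ']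
    exact h

/-- ideals agreeing modulo a power -/
def Close (L : ℕ) (I I' : Ideal A) : Prop := I ≤ I' ⊔ m ^ L ∧ I' ≤ I ⊔ m ^ L

variable {m}
lemma Close.sup {L : ℕ} {I I' J J' : Ideal A} (h : Close m L I I') (h' : Close m L J J') :
    Close m L (I ⊔ J) (I' ⊔ J') := by
  constructor
  · refine sup_le (h.1.trans ?_) (h'.1.trans ?_)
    · exact sup_le_sup_right le_sup_left _
    · exact sup_le_sup_right le_sup_right _
  · refine sup_le (h.2.trans ?_) (h'.2.trans ?_)
    · exact sup_le_sup_right le_sup_left _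
    · exact sup_le_sup_right le_sup_right _

lemma Close.span {L : ℕ} {κ : Type*} (a a' : κ → A) (h : ∀ i, a i - a' i ∈ m ^ L) :
    Close m L (Ideal.span (Set.range a)) (Ideal.span (Set.range a')) := by
  have aux : ∀ a a' : κ → A, (∀ i, a i - a' i ∈ m ^ L) →
      Ideal.span (Set.range a) ≤ Ideal.span (Set.range a') ⊔ m ^ L := by
    intro a a' h
    rw [Ideal.span_le]
    rintro _ ⟨i, rfl⟩
    rw [show a i = a' i + (a i - a' i) by ring]
    exact Submodule.add_mem_sup (Ideal.subset_span ⟨i, rfl⟩) (h i)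
  refine ⟨aux a a' h, aux a' a fun i => ?_⟩
  rw [← neg_sub]
  exact neg_mem (h i)

lemma Close.single {L : ℕ} (a a' : A) (h : a - a' ∈ m ^ L) :
    Close m L (Ideal.span {a}) (Ideal.span {a'}) := by
  have := Close.span (m := m) (L := L) (fun _ : Unit => a) (fun _ => a') (fun _ => h)
  simpa using this

lemma Close.minors {L : ℕ} (a b a' b' : Fin n → A) (ha : ∀ i, a i - a' i ∈ m ^ L)
    (hb : ∀ i, b i - b' i ∈ m ^ L) : Close m L (minors a b) (minors a' b') := by
  refine Close.span _ _ fun kl => ?_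
  have e : (a kl.1 * b kl.2 - a kl.2 * b kl.1) - (a' kl.1 * b' kl.2 - a' kl.2 * b' kl.1) =
    b kl.2 * (a kl.1 - a' kl.1) + a' kl.1 * (b kl.2 - b' kl.2)
     - (b kl.1 * (a kl.2 - a' kl.2) + a' kl.2 * (b kl.1 - b' kl.1)) := by ring
  show _ - _ ∈ _
  rw [e]
  exact sub_mem (add_mem (Ideal.mul_mem_left _ _ (ha _)) (Ideal.mul_mem_left _ _ (hb _)))
    (add_mem (Ideal.mul_mem_left _ _ (ha _)) (Ideal.mul_mem_left _ _ (hb _)))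

lemma Close.eq (hm : m.FG) (hu : ∀ x ∈ m, ∀ y, IsUnit (x * y + 1)) {I I' : Ideal A} {K : ℕ}
    (h : Close m (K + 1) I I') (hK : m ^ K ≤ I) : I = I' := by
  have h1 : m ^ K ≤ I' := nak m hm hu I' K (hK.trans h.1)
  have h2 : m ^ (K + 1) ≤ m ^ K := Ideal.pow_le_pow_right (Nat.le_succ K)
  exact le_antisymm (h.1.trans (sup_le le_rfl (h2.trans h1)))
    (h.2.trans (sup_le le_rfl (h2.trans hK)))

lemma map_minors {B : Type*} [CommRing B] [Algebra ℂ A] [Algebra ℂ B] (φ : A →ₐ[ℂ] B) (a b : Fin n → A) :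
    (minors a b).map φ = BR.minors (fun i => φ (a i)) (fun i => φ (b i)) := by
  unfold BR.minors
  rw [Ideal.map_span, ← Set.range_comp]
  congr 2
  funext kl
  simp

lemma map_spanr {B : Type*} [CommRing B] [Algebra ℂ A] [Algebra ℂ B] (φ : A →ₐ[ℂ] B) (a : Fin n → A) :
    (Ideal.span (Set.range a)).map φ = Ideal.span (Set.range fun i => φ (a i)) := by
  rw [Ideal.map_span, ← Set.range_comp]
  rfl

lemma map_sm {B : Type*} [CommRing B] [Algebra ℂ A] [Algebra ℂ B] (φ : A →ₐ[ℂ] B) (f : A) (a b : Fin n → A) :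
    (Ideal.span {f} ⊔ minors a b).map φ =
      Ideal.span {φ f} ⊔ BR.minors (fun i => φ (a i)) (fun i => φ (b i)) := by
  rw [Ideal.map_sup, map_minors, Ideal.map_span, Set.image_singleton]
end nak

lemma mId_fg : (mId n).FG := by
  rw [mId_eq]
  exact Submodule.fg_span (Set.finite_range _)

lemma mR_fg : (mR n).FG := by
  rw [mR]
  exact Submodule.fg_span (Set.finite_range _)

lemma mR_unit (x : RR n) (hx : x ∈ mR n) (y : RR n) : IsUnit (x * y + 1) := by
  rw [MvPowerSeries.isUnit_iff_constantCoeff]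
  have : MvPowerSeries.constantCoeff x = 0 := by
    have h : mR n ≤ RingHom.ker (MvPowerSeries.constantCoeff (σ := Fin n) (R := ℂ)) := by
      rw [mR, Ideal.span_le]
      rintro _ ⟨i, rfl⟩
      simp
    exact h hx
  simp [this]

lemma transfer_le (I : Ideal (PP n)) (K : ℕ) (h : mId n ^ K ≤ I.map (ιO n)) :
    mR n ^ K ≤ I.map (ιR n) := by
  refine nak _ mR_fg mR_unit _ K ?_
  have h1 : m0 n ^ K ≤ I ⊔ m0 n ^ (K + 1) := by
    intro p hp
    exact (goodO.map_mem_iff I (K + 1) ((Ideal.pow_le_pow_right (Nat.le_succ K)).trans h) p).1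
      (h ((goodO.mem K p).2 hp))
  rw [goodR.pow_eq mR_map, goodR.pow_eq mR_map, ← Ideal.map_sup]
  exact Ideal.map_mono h1

lemma transfer_len (I : Ideal (PP n)) (K : ℕ) (h : mId n ^ K ≤ I.map (ιO n)) :
    len (I.map (ιO n)) = len (I.map (ιR n)) := by
  rw [goodO.len_map I K h, goodR.len_map I K (transfer_le I K h)]
end BR
end

section
namespace BR

lemma Jmin_def (f h : On n) : Jmin n f h = minors (fun i => pd i f) (fun i => pd i h) := rfl
lemma Jac_def (f : On n) : Jac n f = Ideal.span (Set.range fun i => pd i f) := rfl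

/-- the running hypotheses -/
structure HypO (f h : On n) (K : ℕ) : Prop where
  fc : f ∈ mId n
  hc : h ∈ mId n
  jf : mId n ^ K ≤ Jac n f
  jh : mId n ^ K ≤ Jac n h
  kf : mId n ^ K ≤ Ideal.span {f} ⊔ Jmin n f h
  kh : mId n ^ K ≤ Ideal.span {h} ⊔ Jmin n f h

/-- the gradient of a polynomial -/
def dP (p : PP n) (i : Fin n) : PP n := MvPolynomial.pderiv i p

lemma dR_eq (p : PP n) : dR p = fun i => ιR n (dP p i) := by
  funext i
  rw [ιR_apply]; rfl

/-- polynomial truncation -/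
structure Trunc (f h : On n) (K : ℕ) (p q : PP n) : Prop where
  hyp : HypR p q K
  pf : ∀ i, pd i f - ιO n (dP p i) ∈ mId n ^ (2 * K + 1)
  qh : ∀ i, pd i h - ιO n (dP q i) ∈ mId n ^ (2 * K + 1)
  jf : Jac n f = (Ideal.span (Set.range (dP p))).map (ιO n)
  jh : Jac n h = (Ideal.span (Set.range (dP q))).map (ιO n)
  kf : Ideal.span {f} ⊔ Jmin n f h = (Ideal.span {p} ⊔ minors (dP p) (dP q)).map (ιO n)
  kh : Ideal.span {h} ⊔ Jmin n f h = (Ideal.span {q} ⊔ minors (dP p) (dP q)).map (ιO n)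

lemma pd_sub (i : Fin n) (x y : On n) : pd i (x - y) = pd i x - pd i y := by
  have := pd_add i (x - y) y
  rw [sub_add_cancel] at this
  rw [this, add_sub_cancel_right]

section abs
variable {A B : Type*} [CommRing A] [CommRing B] [Algebra ℂ A] [Algebra ℂ B] (φ : A →ₐ[ℂ] B)
  {m : Ideal B}

lemma abs_span (hm : m.FG) (hu : ∀ x ∈ m, ∀ y, IsUnit (x * y + 1)) {K : ℕ} (a : Fin n → B)
    (a' : Fin n → A) (h : ∀ i, a i - φ (a' i) ∈ m ^ (K + 1))
    (hK : m ^ K ≤ Ideal.span (Set.range a)) :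
    Ideal.span (Set.range a) = (Ideal.span (Set.range a')).map φ := by
  rw [map_spanr]
  exact Close.eq hm hu (Close.span _ _ h) hK

lemma abs_sm (hm : m.FG) (hu : ∀ x ∈ m, ∀ y, IsUnit (x * y + 1)) {K : ℕ} (a b : Fin n → B)
    (a' b' : Fin n → A) (g : B) (r : A) (hg : g - φ r ∈ m ^ (K + 1))
    (h : ∀ i, a i - φ (a' i) ∈ m ^ (K + 1)) (h' : ∀ i, b i - φ (b' i) ∈ m ^ (K + 1))
    (hK : m ^ K ≤ Ideal.span {g} ⊔ minors a b) :
    Ideal.span {g} ⊔ minors a b = (Ideal.span {r} ⊔ minors a' b').map φ := by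
  rw [map_sm]
  exact Close.eq hm hu ((Close.single _ _ hg).sup (Close.minors _ _ _ _ h h')) hK
end abs

lemma tJ (p : PP n) :
    Ideal.span (Set.range (dR p)) = (Ideal.span (Set.range (dP p))).map (ιR n) := by
  rw [map_spanr, dR_eq]
lemma tK (p q r : PP n) : Ideal.span {(r : RR n)} ⊔ minors (dR p) (dR q) =
      (Ideal.span {r} ⊔ minors (dP p) (dP q)).map (ιR n) := by
  rw [map_sm, dR_eq, dR_eq, ← ιR_apply]

lemma aux_pd {K : ℕ} (f : On n) (p : PP n) (hp : f - ιO n p ∈ mId n ^ (2 * K + 2)) (i : Fin n) :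
    pd i f - ιO n (dP p i) ∈ mId n ^ (2 * K + 1) := by
  rw [dP, ← pd_ιO, ← pd_sub]
  exact pd_pow_mem i _ _ hp

lemma aux_J {K : ℕ} (f : On n) (p : PP n) (pf : ∀ i, pd i f - ιO n (dP p i) ∈ mId n ^ (K + 1))
    (jf : mId n ^ K ≤ Jac n f) : Jac n f = (Ideal.span (Set.range (dP p))).map (ιO n) :=
  abs_span (ιO n) mId_fg isUnit_mul_add_one _ _ pf jf

lemma aux_K {K : ℕ} (f h g : On n) (p q r : PP n)
    (pf : ∀ i, pd i f - ιO n (dP p i) ∈ mId n ^ (K + 1))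
    (qh : ∀ i, pd i h - ιO n (dP q i) ∈ mId n ^ (K + 1))
    (hr : g - ιO n r ∈ mId n ^ (K + 1)) (hk : mId n ^ K ≤ Ideal.span {g} ⊔ Jmin n f h) :
    Ideal.span {g} ⊔ Jmin n f h = (Ideal.span {r} ⊔ minors (dP p) (dP q)).map (ιO n) := by
  rw [Jmin_def] at hk ⊢
  have := abs_sm (m := mId n) (ιO n) mId_fg isUnit_mul_add_one (K := K) (fun i => pd i f) (fun i => pd i h) (dP p) (dP q) g r hr pf qh
  exact this hk

lemma aux_c {K : ℕ} (f : On n) (p : PP n) (hp : f - ιO n p ∈ mId n ^ (2 * K + 2))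
    (hf : f ∈ mId n) : MvPolynomial.constantCoeff p = 0 := by
  rw [← ιO_mem_mId]
  have le3 : mId n ^ (2 * K + 2) ≤ mId n := Ideal.pow_le_self (by omega)
  have := sub_mem hf (le3 hp)
  rwa [sub_sub_cancel] at this

lemma exists_trunc {f h : On n} {K : ℕ} (H : HypO f h K) : ∃ p q, Trunc f h K p q := by
  obtain ⟨p, hp⟩ := mId_approx (2 * K + 2) f
  obtain ⟨q, hq⟩ := mId_approx (2 * K + 2) h
  have le1 : mId n ^ (2 * K + 1) ≤ mId n ^ (K + 1) := Ideal.pow_le_pow_right (by omega)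
  have le2 : mId n ^ (2 * K + 2) ≤ mId n ^ (K + 1) := Ideal.pow_le_pow_right (by omega)
  have pf := aux_pd f p hp
  have qh := aux_pd h q hq
  have pf' := fun i => le1 (pf i)
  have qh' := fun i => le1 (qh i)
  have jf := aux_J f p pf' H.jf
  have jh := aux_J h q qh' H.jh
  have kf := aux_K f h f p q p pf' qh' (le2 hp) H.kf
  have kh := aux_K f h h p q q pf' qh' (le2 hq) H.kh
  refine ⟨p, q, ⟨⟨aux_c f p hp H.fc, aux_c h q hq H.hc, ?_, ?_, ?_, ?_⟩, pf, qh, jf, jh, kf, kh⟩⟩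
  · rw [tJ]; exact transfer_le _ _ (jf ▸ H.jf)
  · rw [tJ]; exact transfer_le _ _ (jh ▸ H.jh)
  · rw [tK]; exact transfer_le _ _ (kf ▸ H.kf)
  · rw [tK]; exact transfer_le _ _ (kh ▸ H.kh)

theorem B4O {m : ℕ} (hm : 1 ≤ m) {f h : On (m + 1)} {K : ℕ} (H : HypO f h K) :
    len (Jac _ h) + len (Ideal.span {f} ⊔ Jmin _ f h) =
    len (Jac _ f) + len (Ideal.span {h} ⊔ Jmin _ f h) := by
  obtain ⟨p, q, T⟩ := exists_trunc H
  rw [T.jh, T.kf, T.jf, T.kh, transfer_len _ K (T.jh ▸ H.jh), transfer_len _ K (T.kf ▸ H.kf),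
    transfer_len _ K (T.jf ▸ H.jf), transfer_len _ K (T.kh ▸ H.kh), ← tJ, ← tJ, ← tK, ← tK]
  exact B4R hm T.hyp

lemma mem_pow_mul_span {A : Type*} [CommRing A] (I : Ideal A) (a : Fin n → A) (s : A)
    (hs : s ∈ I * Ideal.span (Set.range a)) : ∃ ε : Fin n → A, (∀ i, ε i ∈ I) ∧ s = ∑ i, ε i * a i := by
  rw [← smul_eq_mul] at hs
  obtain ⟨ε, hε⟩ := (Submodule.mem_ideal_smul_span_iff_exists_sum I a s).1 hs
  obtain ⟨h1, h2⟩ := hε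
  refine ⟨fun i => ε i, h1, ?_⟩
  rw [← h2, Finsupp.sum_fintype]
  · rfl
  · simp

theorem B3O {m : ℕ} (hm : 1 ≤ m) {f h : On (m + 1)} {K : ℕ} (H : HypO f h K)
    (δ : Fin (m + 1) → On (m + 1)) (hδ : ∑ i, δ i * pd i f = 0) :
    ∑ i, δ i * pd i h ∈ Ideal.span {h} ⊔ Jmin _ f h := by
  obtain ⟨p, q, T⟩ := exists_trunc H
  choose d hd using fun i => mId_approx (2 * K) (δ i)
  have le1 : mId (m + 1) ^ (2 * K + 1) ≤ mId (m + 1) ^ (2 * K) := Ideal.pow_le_pow_right (by omega)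
  have diff : ∀ (f : On (m + 1)) (p : PP (m + 1)),
      (∀ i, pd i f - ιO _ (dP p i) ∈ mId (m + 1) ^ (2 * K + 1)) →
      ∑ i, δ i * pd i f - ιO _ (∑ i, d i * dP p i) ∈ mId (m + 1) ^ (2 * K) := by
    intro f p h
    rw [map_sum, ← Finset.sum_sub_distrib]
    refine sum_mem fun i _ => ?_
    rw [map_mul]
    have e : δ i * pd i f - ιO _ (d i) * ιO _ (dP p i) =
      pd i f * (δ i - ιO _ (d i)) + ιO _ (d i) * (pd i f - ιO _ (dP p i)) := by ring
    rw [e]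
    exact add_mem (Ideal.mul_mem_left _ _ (hd i)) (Ideal.mul_mem_left _ _ (le1 (h i)))
  have h1 := diff f p T.pf
  rw [hδ, zero_sub, neg_mem_iff, goodO.mem, ← goodR.mem] at h1
  have h2 : ιR (m + 1) (∑ i, d i * dP p i) ∈ mR (m + 1) ^ K * Ideal.span (Set.range (dR p)) := by
    rw [two_mul, pow_add] at h1
    exact Ideal.mul_mono_right T.hyp.jf h1
  obtain ⟨ε, hε, hs⟩ := mem_pow_mul_span _ _ _ h2
  have h3 := T.hyp.ham' hm (fun i => ιR _ (d i) - ε i) (by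
    rw [map_sum] at hs
    simp only [sub_mul, Finset.sum_sub_distrib]
    rw [← hs, dR_eq, sub_eq_zero]
    exact Finset.sum_congr rfl fun i _ => (map_mul _ _ _).symm)
  have h4 : ιR (m + 1) (∑ i, d i * dP q i) ∈
      (Ideal.span {q} ⊔ minors (dP p) (dP q)).map (ιR _) := by
    rw [← tK]
    have e : ιR (m + 1) (∑ i, d i * dP q i) = ∑ i, (ιR _ (d i) - ε i) * dR q i
        + ∑ i, ε i * dR q i := by
      rw [← Finset.sum_add_distrib, map_sum, dR_eq]
      exact Finset.sum_congr rfl fun i _ => by rw [map_mul]; ring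
    rw [e]
    refine add_mem (Ideal.mem_sup_right h3) (T.hyp.kh ?_)
    exact sum_mem fun i _ => Ideal.mul_mem_right _ _ (hε i)
  have h5 := (goodR.map_mem_iff _ K (transfer_le _ K (T.kh ▸ H.kh)) _).1 h4
  have h6 := (goodO.map_mem_iff _ K (T.kh ▸ H.kh) _).2 h5
  rw [← T.kh] at h6
  have h7 := diff h q T.qh
  have h8 : mId (m + 1) ^ (2 * K) ≤ mId (m + 1) ^ K := Ideal.pow_le_pow_right (by omega)
  have h9 := add_mem (H.kh (h8 h7)) h6
  rwa [sub_add_cancel] at h9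
end BR
end

section
namespace BR
section gen9
variable {A : Type*} [CommRing A] [Algebra ℂ A]
variable {M : Type*} [AddCommGroup M] [Module A M] [Module ℂ M] [IsScalarTower ℂ A M]

lemma B1g (φ : M →ₗ[A] A) (T : Submodule A M) (J : Ideal A) :
    len (T.map φ ⊔ J) = len (T ⊔ Submodule.comap φ J) + len (LinearMap.range φ ⊔ J) := by
  rw [len_star φ (T.map φ ⊔ J)]
  congr 2
  · ext x
    rw [Submodule.mem_comap, Submodule.mem_sup, Submodule.mem_sup]
    constructor
    · rintro ⟨_, ⟨t, ht, rfl⟩, j, hj, e⟩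
      refine ⟨t, ht, x - t, ?_, by abel⟩
      rw [Submodule.mem_comap, map_sub, ← e, add_sub_cancel_left]
      exact hj
    · rintro ⟨t, ht, y, hy, rfl⟩
      exact ⟨φ t, ⟨t, ht, rfl⟩, φ y, hy, (map_add _ _ _).symm⟩
  · apply le_antisymm
    · refine sup_le (sup_le ?_ le_sup_right) le_sup_left
      exact le_sup_of_le_left LinearMap.map_le_range
    · exact sup_le le_sup_right (le_sup_of_le_left le_sup_right)

lemma B2g (φ ψ : M →ₗ[A] A) (h : A) :
    len ((Submodule.comap ψ (Ideal.span {h})).map φ) + len (LinearMap.range ψ ⊔ Ideal.span {h}) =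
    len (Ideal.span {h} ⊔ (LinearMap.ker φ).map ψ) + len (LinearMap.range φ) := by
  have key : ∃ Q : Submodule A (A × A), ∀ z, z ∈ Q ↔ ∃ δ c, φ δ = z.1 ∧ ψ δ + c * h = z.2 := by
    refine ⟨LinearMap.range ((φ.comp (LinearMap.fst A M A)).prod
      (ψ.comp (LinearMap.fst A M A) + (LinearMap.mulRight A h).comp (LinearMap.snd A M A))), ?_⟩
    rintro ⟨x, y⟩
    constructor
    · rintro ⟨⟨δ, c⟩, e⟩
      exact ⟨δ, c, congrArg Prod.fst e, congrArg Prod.snd e⟩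
    · rintro ⟨δ, c, e1, e2⟩
      exact ⟨(δ, c), Prod.ext e1 e2⟩
  obtain ⟨Q, hQ⟩ := key
  have e1 : Q.comap (LinearMap.inl A A A) = (Submodule.comap ψ (Ideal.span {h})).map φ := by
    ext x
    rw [Submodule.mem_comap, hQ, Submodule.mem_map]
    constructor
    · rintro ⟨δ, c, e1, e2⟩
      refine ⟨δ, ?_, e1⟩
      rw [Submodule.mem_comap, Ideal.mem_span_singleton']
      refine ⟨-c, ?_⟩
      have e2' : ψ δ + c * h = 0 := e2
      rw [neg_mul]
      exact (eq_neg_of_add_eq_zero_left e2').symm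
    · rintro ⟨δ, hδ, e⟩
      rw [Submodule.mem_comap, Ideal.mem_span_singleton'] at hδ
      obtain ⟨c, hc⟩ := hδ
      refine ⟨δ, -c, e, ?_⟩
      show ψ δ + -c * h = 0
      rw [← hc]; ring
  have e2 : Q.map (LinearMap.snd A A A) = LinearMap.range ψ ⊔ Ideal.span {h} := by
    ext y
    rw [Submodule.mem_map, Submodule.mem_sup]
    constructor
    · rintro ⟨⟨x, y⟩, hz, rfl⟩
      obtain ⟨δ, c, e1, e2⟩ := (hQ _).1 hz
      exact ⟨ψ δ, ⟨δ, rfl⟩, c * h, Ideal.mem_span_singleton'.2 ⟨c, rfl⟩, e2⟩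
    · rintro ⟨_, ⟨δ, rfl⟩, z, hz, rfl⟩
      obtain ⟨c, rfl⟩ := Ideal.mem_span_singleton'.1 hz
      exact ⟨(φ δ, ψ δ + c * h), (hQ _).2 ⟨δ, c, rfl, rfl⟩, rfl⟩
  have e3 : Q.comap (LinearMap.inr A A A) = Ideal.span {h} ⊔ (LinearMap.ker φ).map ψ := by
    ext y
    rw [Submodule.mem_comap, hQ, Submodule.mem_sup]
    constructor
    · rintro ⟨δ, c, e1, e2⟩
      exact ⟨c * h, Ideal.mem_span_singleton'.2 ⟨c, rfl⟩, ψ δ, ⟨δ, e1, rfl⟩, (add_comm _ _).trans e2⟩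
    · rintro ⟨z, hz, _, ⟨δ, hδ, rfl⟩, rfl⟩
      obtain ⟨c, rfl⟩ := Ideal.mem_span_singleton'.1 hz
      exact ⟨δ, c, hδ, add_comm _ _⟩
  have e4 : Q.map (LinearMap.fst A A A) = LinearMap.range φ := by
    ext x
    rw [Submodule.mem_map]
    constructor
    · rintro ⟨⟨x, y⟩, hz, rfl⟩
      obtain ⟨δ, c, e1, e2⟩ := (hQ _).1 hz
      exact ⟨δ, e1⟩
    · rintro ⟨δ, rfl⟩
      exact ⟨(φ δ, ψ δ + 0 * h), (hQ _).2 ⟨δ, 0, rfl, rfl⟩, rfl⟩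
  rw [← e1, ← e2, ← e3, ← e4, ← len_prod, ← len_prod']

lemma kosz_le (a b : Fin n → A) (φ ψ : (Fin n → A) →ₗ[A] A) (hφ : ∀ δ, φ δ = ∑ i, δ i * a i)
    (hψ : ∀ δ, ψ δ = ∑ i, δ i * b i) : minors a b ≤ (LinearMap.ker φ).map ψ := by
  intro x hx
  obtain ⟨δ, hδ⟩ := minors_le_inr a b hx
  rw [rowMap_apply] at hδ
  refine ⟨δ, ?_, ?_⟩
  · show φ δ = 0
    rw [hφ]; exact congrArg Prod.fst hδ
  · rw [hψ]; exact congrArg Prod.snd hδ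

lemma kosz_mul (a b : Fin n → A) (φ ψ : (Fin n → A) →ₗ[A] A) (hφ : ∀ δ, φ δ = ∑ i, δ i * a i)
    (hψ : ∀ δ, ψ δ = ∑ i, δ i * b i) (h : A) :
    Ideal.span (Set.range a) * (Ideal.span {h} ⊔ (LinearMap.ker φ).map ψ) ≤
      Ideal.span {h} ⊔ minors a b := by
  rw [Ideal.mul_sup]
  refine sup_le (le_sup_of_le_left Ideal.mul_le_right) (le_sup_of_le_right ?_)
  rw [Ideal.mul_le]
  intro r hr s hs
  obtain ⟨δ, hδ, rfl⟩ := hs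
  have hδ' : ∑ i, δ i * a i = 0 := by rw [← hφ]; exact hδ
  rw [hψ]
  revert r
  show Ideal.span (Set.range a) ≤ Submodule.comap (LinearMap.mulRight A (∑ i, δ i * b i)) (minors a b)
  rw [Ideal.span_le]
  rintro _ ⟨k, rfl⟩
  show a k * ∑ i, δ i * b i ∈ minors a b
  have e : a k * ∑ i, δ i * b i = ∑ i, δ i * (a k * b i - a i * b k) := by
    have : ∑ i, δ i * (a k * b i - a i * b k) = a k * ∑ i, δ i * b i - b k * ∑ i, δ i * a i := by
      rw [Finset.mul_sum, Finset.mul_sum, ← Finset.sum_sub_distrib]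
      exact Finset.sum_congr rfl fun i _ => by ring
    rw [this, hδ', mul_zero, sub_zero]
  rw [e]
  exact sum_mem fun i _ => Ideal.mul_mem_left _ _ (minor_mem a b k i)

lemma range_of (a : Fin n → A) (φ : (Fin n → A) →ₗ[A] A) (hφ : ∀ δ, φ δ = ∑ i, δ i * a i) :
    LinearMap.range φ = Ideal.span (Set.range a) := by
  rw [← range_span]
  congr 1
  ext1 δ
  ext
  simp [hφ, Fintype.linearCombination_apply]

lemma pow_sq_le {m I J P : Ideal A} {K L : ℕ} (h : I * J ≤ P) (hI : m ^ K ≤ I) (hJ : m ^ L ≤ J) :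
    m ^ (K + L) ≤ P := by
  rw [pow_add]
  exact (Ideal.mul_mono hI hJ).trans h
end gen9
end BR
end

section
namespace BR
lemma gradMap_apply (f : On n) (δ : Fin n → On n) : gradMap n f δ = ∑ i, δ i * pd i f := rfl

lemma range_grad (f : On n) : LinearMap.range (gradMap n f) = Jac n f :=
  range_of (fun i => pd i f) (gradMap n f) (gradMap_apply f)

lemma B2O (f h : On n) :
    len ((ThetaF n h).map (gradMap n f)) + len (Jac n h ⊔ Ideal.span {h}) =
    len (Ideal.span {h} ⊔ (LinearMap.ker (gradMap n f)).map (gradMap n h)) + len (Jac n f) := by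
  rw [← range_grad, ← range_grad]
  exact B2g (gradMap n f) (gradMap n h) h

lemma Jmin_comm (f h : On n) : Jmin n f h = Jmin n h f := by
  rw [Jmin_def, Jmin_def, minors_comm]

lemma pow_min {f h : On n} {K : ℕ} (jf : mId n ^ K ≤ Jac n f)
    (jh : mId n ^ K ≤ Jac n h)
    (hX : len ((ThetaF n h).map (gradMap n f)) ≠ ⊤) :
    ∃ L, mId n ^ L ≤ Ideal.span {h} ⊔ Jmin n f h := by
  have h1 := B2O f h
  have h2 : len (Jac n h ⊔ Ideal.span {h}) ≠ ⊤ := lenO_ne_top _ K (jh.trans le_sup_left)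
  have h3 : len (Ideal.span {h} ⊔ (LinearMap.ker (gradMap n f)).map (gradMap n h)) ≠ ⊤ := by
    intro h4
    rw [h4, top_add] at h1
    exact enat_add hX h2 h1
  obtain ⟨L, hL⟩ := exists_pow_le_of_len _ h3
  exact ⟨K + L, pow_sq_le (kosz_mul (fun i => pd i f) (fun i => pd i h) (gradMap n f)
    (gradMap n h) (gradMap_apply f) (gradMap_apply h) h) jf hL⟩

theorem red {m : ℕ} (hm : 1 ≤ m) {f h : On (m + 1)} {K : ℕ} (fc : f ∈ mId (m + 1))
    (hc : h ∈ mId (m + 1)) (jf : mId (m + 1) ^ K ≤ Jac (m + 1) f)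
    (jh : mId (m + 1) ^ K ≤ Jac (m + 1) h)
    (hX : len ((ThetaF (m + 1) h).map (gradMap (m + 1) f)) ≠ ⊤)
    (hY : len ((ThetaF (m + 1) f).map (gradMap (m + 1) h)) ≠ ⊤) :
    len (Ideal.span {f} ⊔ Jmin (m + 1) f h) ≠ ⊤ ∧
    len ((ThetaF (m + 1) h).map (gradMap (m + 1) f)) + len (Jac (m + 1) h ⊔ Ideal.span {h}) =
    len (Jac (m + 1) h) + len (Ideal.span {f} ⊔ Jmin (m + 1) f h) := by
  obtain ⟨L, hL⟩ := pow_min jf jh hX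
  obtain ⟨L', hL'⟩ := pow_min jh jf hY
  rw [Jmin_comm] at hL'
  have hyp : HypO f h (K + L + L') :=
    ⟨fc, hc, (Ideal.pow_le_pow_right (by omega)).trans jf,
      (Ideal.pow_le_pow_right (by omega)).trans jh,
      (Ideal.pow_le_pow_right (by omega)).trans hL',
      (Ideal.pow_le_pow_right (by omega)).trans hL⟩
  refine ⟨lenO_ne_top _ _ hL', ?_⟩
  rw [B2O, B4O hm hyp, add_comm]
  congr 2
  apply le_antisymm
  · refine sup_le le_sup_left ?_
    rintro _ ⟨δ, hδ, rfl⟩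
    exact B3O hm hyp δ hδ
  · refine sup_le le_sup_left (le_sup_of_le_right ?_)
    exact kosz_le (fun i => pd i f) (fun i => pd i h) (gradMap _ f)
      (gradMap _ h) (gradMap_apply f) (gradMap_apply h)

section fin
variable {A : Type*} [CommRing A] [Algebra ℂ A]
variable {M : Type*} [AddCommGroup M] [Module A M] [Module ℂ M] [IsScalarTower ℂ A M]
lemma finish (φ : M →ₗ[A] A) (T : Submodule A M) (f : A) (J Jh th tf : Ideal A)
    (etf : tf = LinearMap.range φ ⊔ Ideal.span {f})
    (h1 : len J ≠ ⊤) (h2 : len Jh ≠ ⊤) (h3 : len tf ≠ ⊤) (h4 : Jh ≤ th) (hX : len (T.map φ) ≠ ⊤)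
    (h : len (T.map φ) + len th = len Jh + len J) :
    (Module.finrank ℂ (A ⧸ (T.map φ : Ideal A)) : ℤ)
      - Module.finrank ℂ (A ⧸ ((T.map φ : Ideal A) + Ideal.span {f})) =
      Module.finrank ℂ (A ⧸ J) - Module.finrank ℂ (A ⧸ tf) + Module.finrank ℂ (A ⧸ Jh)
      - Module.finrank ℂ (A ⧸ th)
      - Module.finrank ℂ (M ⧸ (T ⊔ Submodule.comap φ (Ideal.span {f}))) := by
  have b1 := B1g φ T (Ideal.span {f})
  rw [← etf] at b1
  have h5 : len th ≠ ⊤ := ne_top_of_le_ne_top h2 (len_mono h4)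
  have h6 : len (T.map φ ⊔ Ideal.span {f}) ≠ ⊤ := ne_top_of_le_ne_top hX (len_mono le_sup_left)
  have h7 : len (T ⊔ Submodule.comap φ (Ideal.span {f})) ≠ ⊤ := by
    intro h8
    rw [h8, top_add] at b1
    exact h6 b1
  rw [← len_eq h5, ← len_eq h1, ← len_eq h2, ← len_eq hX] at h
  rw [← len_eq h6, ← len_eq h7, ← len_eq h3] at b1
  norm_cast at h b1
  rw [← Submodule.add_eq_sup] at b1
  have h' : ((Module.finrank ℂ (A ⧸ (T.map φ : Ideal A)) : ℕ) : ℤ) + Module.finrank ℂ (A ⧸ th) =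
    Module.finrank ℂ (A ⧸ Jh) + Module.finrank ℂ (A ⧸ J) := by exact_mod_cast h
  have b1' : ((Module.finrank ℂ (A ⧸ ((T.map φ : Ideal A) + Ideal.span {f})) : ℕ) : ℤ) =
    Module.finrank ℂ (M ⧸ (T ⊔ Submodule.comap φ (Ideal.span {f}))) + Module.finrank ℂ (A ⧸ tf) := by
    exact_mod_cast b1
  linarith
end fin

theorem main2 {m : ℕ} (hm : 1 ≤ m)
    (F : (Fin (m + 1) → ℂ) → ℂ) (hF : AnalyticAt ℂ F 0) (hF0 : F 0 = 0)
    (H : (Fin (m + 1) → ℂ) → ℂ) (hH : AnalyticAt ℂ H 0) (hH0 : H 0 = 0)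
    (hFiso : FiniteDimensional ℂ (On (m + 1) ⧸ Jac (m + 1) (mkOn F hF)))
    (hHiso : FiniteDimensional ℂ (On (m + 1) ⧸ Jac (m + 1) (mkOn H hH)))
    (hfinX : FiniteDimensional ℂ (On (m + 1) ⧸ BRIdeal (m + 1) (H ⁻¹' {0}) (mkOn F hF)))
    (hfinY : FiniteDimensional ℂ (On (m + 1) ⧸ BRIdeal (m + 1) (F ⁻¹' {0}) (mkOn H hH))) :
    (muX (m + 1) (H ⁻¹' {0}) (mkOn F hF) : ℤ) - tauX (m + 1) (H ⁻¹' {0}) (mkOn F hF) =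
      Module.finrank ℂ (On (m + 1) ⧸ (Ideal.span {mkOn F hF} + Jmin (m + 1) (mkOn F hF) (mkOn H hH)))
        - tau (m + 1) (mkOn F hF) + mu (m + 1) (mkOn H hH) - tau (m + 1) (mkOn H hH)
        - Module.finrank ℂ
            ((Fin (m + 1) → On (m + 1)) ⧸
              (ThetaX (m + 1) (H ⁻¹' {0}) ⊔ ThetaF (m + 1) (mkOn F hF))) := by
  have lX := len_ne_top hfinX
  have lY := len_ne_top hfinY
  have lF := len_ne_top hFiso
  have lH := len_ne_top hHiso
  obtain ⟨K, hK⟩ := exists_pow_le_of_len _ lF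
  obtain ⟨L, hL⟩ := exists_pow_le_of_len _ lH
  have eX := ThetaX_eq (by omega) hH hH0 hL
  have eY := ThetaX_eq (by omega) hF hF0 hK
  unfold BRIdeal at lX lY
  rw [eX] at lX
  rw [eY] at lY
  unfold muX tauX mu tau BRIdeal
  rw [eX]
  obtain ⟨r1, r2⟩ := red hm ((mem_mId hF).2 hF0) ((mem_mId hH).2 hH0)
    (K := K + L) ((Ideal.pow_le_pow_right (by omega)).trans hK)
    ((Ideal.pow_le_pow_right (by omega)).trans hL) lX lY
  refine finish (gradMap (m + 1) (mkOn F hF)) (ThetaF (m + 1) (mkOn H hH)) (mkOn F hF)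
    (Ideal.span {mkOn F hF} + Jmin (m + 1) (mkOn F hF) (mkOn H hH)) (Jac (m + 1) (mkOn H hH))
    (Jac (m + 1) (mkOn H hH) + Ideal.span {mkOn H hH}) (Jac (m + 1) (mkOn F hF) + Ideal.span {mkOn F hF})
    ?_ r1 lH ?_ le_sup_left lX r2
  · rw [range_grad]; rfl
  · exact ne_top_of_le_ne_top lF (len_mono le_sup_left)
end BR
end

section
namespace BR
/-- the coordinate in dimension one -/
def xx : On 1 := coordG 0

lemma mId_xx : mId 1 = Ideal.span {xx} := by
  rw [mId_eq, Set.range_unique]; rfl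

lemma mId_xx_pow (k : ℕ) : mId 1 ^ k = Ideal.span {xx ^ k} := by
  rw [mId_xx, Ideal.span_singleton_pow]

lemma pd_xx : pd 0 xx = 1 := by
  rw [xx, pd_coord, if_pos rfl]

lemma pd_xx_pow (k : ℕ) : pd 0 (xx ^ (k + 1)) = ((k : On 1) + 1) * xx ^ k := by
  induction k with
  | zero => simp [pd_xx]
  | succ k ih =>
    rw [pow_succ, pd_mul, ih, pd_xx]
    push_cast
    ring

lemma natCast_unit (k : ℕ) : IsUnit ((k : On 1) + 1) := by
  have h : IsUnit ((k : ℂ) + 1) := (Nat.cast_add_one_ne_zero k).isUnit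
  have := h.map (algebraMap ℂ (On 1))
  simpa using this

lemma xx_pow_ne (k : ℕ) : xx ^ k ≠ 0 := by
  induction k with
  | zero =>
    rw [pow_zero]
    intro h
    apply mId_ne_top (n := 1)
    rw [Ideal.eq_top_iff_one, h]
    exact zero_mem _
  | succ k ih =>
    intro h
    have h1 := pd_xx_pow k
    rw [h, pd_zero] at h1
    exact ih ((natCast_unit k).mul_right_eq_zero.1 h1.symm)

lemma xx_pow_not_mem (k : ℕ) : xx ^ k ∉ mId 1 ^ (k + 1) := by
  rw [mId_xx_pow, Ideal.mem_span_singleton']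
  rintro ⟨c, hc⟩
  have h1 := isUnit_mul_add_one xx (coord_mem 0) (-c)
  have h2 : (xx * -c + 1) * xx ^ k = 0 := by
    have : (xx * -c + 1) * xx ^ k = xx ^ k - c * xx ^ (k + 1) := by ring
    rw [this, hc, sub_self]
  exact xx_pow_ne k (h1.mul_right_eq_zero.1 h2)

lemma Jac_one (f : On 1) : Jac 1 f = Ideal.span {pd 0 f} := by
  rw [Jac_def, Set.range_unique]; rfl

lemma factor_one (f : On 1) (fc : f ∈ mId 1) {L : ℕ} (hL : mId 1 ^ L ≤ Jac 1 f) :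
    ∃ b v, IsUnit v ∧ f = xx ^ (b + 1) * v := by
  have h1 : ∃ k, f ∉ mId 1 ^ k := by
    refine ⟨L + 2, fun h => ?_⟩
    have h2 := pd_pow_mem 0 (L + 1) f h
    have h3 : Jac 1 f ≤ mId 1 ^ (L + 1) := by
      rw [Jac_one, Ideal.span_singleton_le_iff_mem]; exact h2
    apply xx_pow_not_mem L
    apply h3
    apply hL
    rw [mId_xx_pow]
    exact Ideal.mem_span_singleton_self _
  classical
  have h2 := Nat.find_spec h1
  have h3 : ∀ k < Nat.find h1, f ∈ mId 1 ^ k := fun k hk => not_not.1 (Nat.find_min h1 hk)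
  generalize Nat.find h1 = k at h2 h3
  match k, h2, h3 with
  | 0, h2, h3 => exact absurd (by simp) h2
  | 1, h2, h3 => exact absurd (by simpa using fc) h2
  | b + 2, h2, h3 =>
    have h4 := h3 (b + 1) (by omega)
    rw [mId_xx_pow, Ideal.mem_span_singleton'] at h4
    obtain ⟨v, hv⟩ := h4
    refine ⟨b, v, isUnit_of_not_mem v fun hv' => h2 ?_, by rw [← hv, mul_comm]⟩
    rw [← hv, pow_succ' (mId 1) (b + 1)]
    refine Ideal.mul_mem_mul hv' ?_
    rw [mId_xx_pow]
    exact Ideal.mem_span_singleton_self _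

lemma euler_one (f : On 1) (b : ℕ) (v : On 1) (hv : IsUnit v) (hf : f = xx ^ (b + 1) * v) :
    ∃ w, IsUnit w ∧ xx * pd 0 f = w * f := by
  obtain ⟨u, rfl⟩ := hv
  have h : pd 0 f = xx ^ b * (((b : On 1) + 1) * u + xx * pd 0 (u : On 1)) := by
    rw [hf, pd_mul, pd_xx_pow]; ring
  refine ⟨(((b : On 1) + 1) * u + xx * pd 0 (u : On 1)) * (u⁻¹ : (On 1)ˣ), ?_, ?_⟩
  · refine IsUnit.mul ?_ (Units.isUnit _)
    obtain ⟨c, hc⟩ := (natCast_unit b).mul u.isUnit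
    have h1 := isUnit_mul_add_one xx (coord_mem 0) ((c⁻¹ : (On 1)ˣ) * pd 0 (u : On 1))
    have e : ((b : On 1) + 1) * u + xx * pd 0 (u : On 1) =
      c * (xx * ((c⁻¹ : (On 1)ˣ) * pd 0 (u : On 1)) + 1) := by
      rw [← hc]
      have : (c : On 1) * (c⁻¹ : (On 1)ˣ) = 1 := c.mul_inv
      linear_combination (-xx * pd 0 (u : On 1)) * this
    rw [e]
    exact c.isUnit.mul h1
  · rw [h, hf]
    have : (u : On 1) * (u⁻¹ : (On 1)ˣ) = 1 := u.mul_inv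
    linear_combination (-xx ^ (b + 1) * (((b : On 1) + 1) * u + xx * pd 0 (u : On 1))) * this

variable {H : (Fin 1 → ℂ) → ℂ}

lemma IX_one (hH : AnalyticAt ℂ H 0) (hH0 : H 0 = 0) (b : ℕ) (v : On 1) (hv : IsUnit v)
    (hf : mkOn H hH = xx ^ (b + 1) * v) : IX 1 (H ⁻¹' {0}) = mId 1 := by
  obtain ⟨w, hw⟩ := hv.exists_right_inv
  obtain ⟨W, hW, rfl⟩ := exists_mkOn w
  have e : xx ^ (b + 1) = mkOn H hH * mkOn W hW := by rw [hf, mul_assoc, hw, mul_one]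
  have hp : xx ^ (b + 1) = mkOn (fun x : Fin 1 → ℂ => x 0 ^ (b + 1)) ((an_coord 0).pow _) := by
    rw [xx, coordG_def]; rfl
  rw [hp, mkOn_mul, mkOn_eq_iff] at e
  ext x
  obtain ⟨G, hG, rfl⟩ := exists_mkOn x
  rw [mem_IX, mem_mId]
  constructor
  · intro h
    exact h.self_of_nhds hH0
  · intro h
    filter_upwards [e] with y hy hy0
    have hy0' : H y = 0 := hy0
    have h2 : y 0 ^ (b + 1) = H y * W y := hy
    rw [hy0', zero_mul] at h2
    have h3 : y 0 = 0 := pow_eq_zero_iff (by omega) |>.1 h2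
    have h4 : y = 0 := by
      funext i
      rw [Subsingleton.elim i 0]; exact h3
    rw [h4]; exact h

lemma map_Theta_one (X : Set (Fin 1 → ℂ)) (hX : IX 1 X = mId 1) (f : On 1) :
    (ThetaX 1 X).map (gradMap 1 f) = Ideal.span {xx * pd 0 f} := by
  have h1 : ∀ (δ : Fin 1 → On 1) (g : On 1), applyVF δ g = δ 0 * pd 0 g := by
    intro δ g
    show ∑ i, δ i * pd i g = _
    rw [Fin.sum_univ_one]
  have h2 : ∀ δ, δ ∈ ThetaX 1 X ↔ δ 0 ∈ mId 1 := by
    intro δ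
    have h3 : δ ∈ ThetaX 1 X ↔ ∀ g ∈ IX 1 X, applyVF δ g ∈ IX 1 X := Iff.rfl
    rw [h3, hX]
    constructor
    · intro h
      have := h xx (coord_mem 0)
      rwa [h1, pd_xx, mul_one] at this
    · intro h g hg
      rw [h1]
      exact Ideal.mul_mem_right _ _ h
  ext y
  rw [Ideal.mem_span_singleton', Submodule.mem_map]
  constructor
  · rintro ⟨δ, hδ, rfl⟩
    have h4 := (h2 δ).1 hδ
    rw [mId_xx, Ideal.mem_span_singleton'] at h4
    obtain ⟨c, hc⟩ := h4
    refine ⟨c, ?_⟩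
    show _ = applyVF δ f
    rw [h1, ← hc, mul_assoc]
  · rintro ⟨c, rfl⟩
    refine ⟨fun _ => c * xx, (h2 _).2 (Ideal.mul_mem_left _ _ (coord_mem 0)), ?_⟩
    show applyVF _ f = _
    rw [h1, mul_assoc]

lemma Jmin_one (f h : On 1) : Jmin 1 f h = ⊥ := by
  rw [Jmin_def, minors, Ideal.span_eq_bot]
  rintro _ ⟨⟨i, j⟩, rfl⟩
  rw [Subsingleton.elim i j]
  exact sub_self _

theorem main1
    (F : (Fin 1 → ℂ) → ℂ) (hF : AnalyticAt ℂ F 0) (hF0 : F 0 = 0)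
    (H : (Fin 1 → ℂ) → ℂ) (hH : AnalyticAt ℂ H 0) (hH0 : H 0 = 0)
    (hFiso : FiniteDimensional ℂ (On 1 ⧸ Jac 1 (mkOn F hF)))
    (hHiso : FiniteDimensional ℂ (On 1 ⧸ Jac 1 (mkOn H hH)))
    (hfinX : FiniteDimensional ℂ (On 1 ⧸ BRIdeal 1 (H ⁻¹' {0}) (mkOn F hF))) :
    (muX 1 (H ⁻¹' {0}) (mkOn F hF) : ℤ) - tauX 1 (H ⁻¹' {0}) (mkOn F hF) =
      Module.finrank ℂ (On 1 ⧸ (Ideal.span {mkOn F hF} + Jmin 1 (mkOn F hF) (mkOn H hH)))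
        - tau 1 (mkOn F hF) + mu 1 (mkOn H hH) - tau 1 (mkOn H hH)
        - Module.finrank ℂ
            ((Fin 1 → On 1) ⧸ (ThetaX 1 (H ⁻¹' {0}) ⊔ ThetaF 1 (mkOn F hF))) := by
  have lX := len_ne_top hfinX
  have lF := len_ne_top hFiso
  have lH := len_ne_top hHiso
  obtain ⟨K, hK⟩ := exists_pow_le_of_len _ lF
  obtain ⟨L, hL⟩ := exists_pow_le_of_len _ lH
  obtain ⟨b, v, hv, e⟩ := factor_one _ ((mem_mId hF).2 hF0) hK
  obtain ⟨b', v', hv', e'⟩ := factor_one _ ((mem_mId hH).2 hH0) hL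
  obtain ⟨w, hw, ew⟩ := euler_one _ b v hv e
  obtain ⟨w', hw', ew'⟩ := euler_one _ b' v' hv' e'
  have eX := map_Theta_one _ (IX_one hH hH0 b' v' hv' e') (mkOn F hF)
  rw [ew, Ideal.span_singleton_mul_left_unit hw] at eX
  have eJ : Ideal.span {mkOn F hF} + Jmin 1 (mkOn F hF) (mkOn H hH) = Ideal.span {mkOn F hF} := by
    rw [Jmin_one]; exact sup_bot_eq _
  have hmem : mkOn H hH ∈ Jac 1 (mkOn H hH) := by
    rw [Jac_one, Ideal.mem_span_singleton']
    obtain ⟨u, rfl⟩ := hw'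
    refine ⟨(u⁻¹ : (On 1)ˣ) * xx, ?_⟩
    rw [mul_assoc, ew', ← mul_assoc, Units.inv_mul, one_mul]
  have eT : Jac 1 (mkOn H hH) + Ideal.span {mkOn H hH} = Jac 1 (mkOn H hH) :=
    sup_eq_left.2 ((Ideal.span_singleton_le_iff_mem _).2 hmem)
  unfold BRIdeal at lX
  have lJ := lX
  rw [eX] at lJ
  unfold muX tauX mu tau BRIdeal
  refine finish (gradMap 1 (mkOn F hF)) (ThetaX 1 (H ⁻¹' {0})) (mkOn F hF)
    (Ideal.span {mkOn F hF} + Jmin 1 (mkOn F hF) (mkOn H hH)) (Jac 1 (mkOn H hH))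
    (Jac 1 (mkOn H hH) + Ideal.span {mkOn H hH}) (Jac 1 (mkOn F hF) + Ideal.span {mkOn F hF})
    ?_ ?_ lH ?_ le_sup_left lX ?_
  · rw [range_grad]; rfl
  · rw [eJ]; exact lJ
  · exact ne_top_of_le_ne_top lF (len_mono le_sup_left)
  · rw [eJ, eT, eX, add_comm]

theorem main0
    (F : (Fin 0 → ℂ) → ℂ) (hF : AnalyticAt ℂ F 0) (hF0 : F 0 = 0)
    (H : (Fin 0 → ℂ) → ℂ) (hH : AnalyticAt ℂ H 0) (hH0 : H 0 = 0)
    (hFiso : FiniteDimensional ℂ (On 0 ⧸ Jac 0 (mkOn F hF)))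
    (hHiso : FiniteDimensional ℂ (On 0 ⧸ Jac 0 (mkOn H hH)))
    (hfinX : FiniteDimensional ℂ (On 0 ⧸ BRIdeal 0 (H ⁻¹' {0}) (mkOn F hF))) :
    (muX 0 (H ⁻¹' {0}) (mkOn F hF) : ℤ) - tauX 0 (H ⁻¹' {0}) (mkOn F hF) =
      Module.finrank ℂ (On 0 ⧸ (Ideal.span {mkOn F hF} + Jmin 0 (mkOn F hF) (mkOn H hH)))
        - tau 0 (mkOn F hF) + mu 0 (mkOn H hH) - tau 0 (mkOn H hH)
        - Module.finrank ℂ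
            ((Fin 0 → On 0) ⧸ (ThetaX 0 (H ⁻¹' {0}) ⊔ ThetaF 0 (mkOn F hF))) := by
  have lX := len_ne_top hfinX
  have lF := len_ne_top hFiso
  have lH := len_ne_top hHiso
  have m0 : ∀ (F : (Fin 0 → ℂ) → ℂ) (hF : AnalyticAt ℂ F 0), F 0 = 0 → mkOn F hF = 0 := by
    intro F hF h
    have := (mem_mId hF).2 h
    rw [mId_eq, Set.range_eq_empty, Ideal.span_empty] at this
    exact this
  have f0 := m0 F hF hF0
  have h0 := m0 H hH hH0
  rw [f0] at lX lF ⊢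
  rw [h0] at lH ⊢
  have J0 : ∀ f : On 0, Jac 0 f = ⊥ := by
    intro f
    rw [Jac_def, Set.range_eq_empty, Ideal.span_empty]
  have s0 : Ideal.span {(0 : On 0)} = ⊥ := Ideal.span_singleton_eq_bot.2 rfl
  have Jm : Jmin 0 (0 : On 0) 0 = ⊥ := by
    rw [Jmin_def, minors, Set.range_eq_empty, Ideal.span_empty]
  have eX : (ThetaX 0 (H ⁻¹' {0})).map (gradMap 0 0) = ⊥ := by
    rw [eq_bot_iff, ← J0 0, ← range_grad]
    exact LinearMap.map_le_range
  have bb : (⊥ : Ideal (On 0)) + ⊥ = ⊥ := sup_idem _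
  unfold BRIdeal at lX
  unfold muX tauX mu tau BRIdeal
  refine finish (gradMap 0 0) (ThetaX 0 (H ⁻¹' {0})) 0
    (Ideal.span {0} + Jmin 0 0 0) (Jac 0 0)
    (Jac 0 0 + Ideal.span {0}) (Jac 0 0 + Ideal.span {0})
    ?_ ?_ lH ?_ le_sup_left lX ?_
  · rw [range_grad]; rfl
  · rw [s0, Jm, bb, ← J0 0]; exact lF
  · exact ne_top_of_le_ne_top lF (len_mono le_sup_left)
  · rw [eX, s0, Jm, J0, bb]
end BR
end

/-- Formula (9) of Proposition 2.5 (via the Lê–Greuel formula):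
`μ_X(f) − τ_X(f) = dim_ℂ 𝒪ₙ/(⟨f⟩ + J(f,h)) − τ(f) + μ(h) − τ(h) − dim_ℂ Θ/(Θ_X + Θ_Y)`. -/
theorem muX_sub_tauX_formula (n : ℕ)
    (F : (Fin n → ℂ) → ℂ) (hF : AnalyticAt ℂ F 0) (hF0 : F 0 = 0)
    (H : (Fin n → ℂ) → ℂ) (hH : AnalyticAt ℂ H 0) (hH0 : H 0 = 0)
    (hFsing : mkOn F hF ∈ (mId n) ^ 2) (hHsing : mkOn H hH ∈ (mId n) ^ 2)
    (hFiso : FiniteDimensional ℂ (On n ⧸ Jac n (mkOn F hF)))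
    (hHiso : FiniteDimensional ℂ (On n ⧸ Jac n (mkOn H hH)))
    (hfinX : FiniteDimensional ℂ (On n ⧸ BRIdeal n (H ⁻¹' {0}) (mkOn F hF)))
    (hfinY : FiniteDimensional ℂ (On n ⧸ BRIdeal n (F ⁻¹' {0}) (mkOn H hH))) :
    (muX n (H ⁻¹' {0}) (mkOn F hF) : ℤ) - tauX n (H ⁻¹' {0}) (mkOn F hF) =
      Module.finrank ℂ (On n ⧸ (Ideal.span {mkOn F hF} + Jmin n (mkOn F hF) (mkOn H hH)))
        - tau n (mkOn F hF) + mu n (mkOn H hH) - tau n (mkOn H hH)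
        - Module.finrank ℂ
            ((Fin n → On n) ⧸ (ThetaX n (H ⁻¹' {0}) ⊔ ThetaF n (mkOn F hF))) := by
  match n, F, hF, hF0, H, hH, hH0, hFiso, hHiso, hfinX, hfinY with
  | 0, F, hF, hF0, H, hH, hH0, hFiso, hHiso, hfinX, _ =>
    exact BR.main0 F hF hF0 H hH hH0 hFiso hHiso hfinX
  | 1, F, hF, hF0, H, hH, hH0, hFiso, hHiso, hfinX, _ =>
    exact BR.main1 F hF hF0 H hH hH0 hFiso hHiso hfinX
  | m + 2, F, hF, hF0, H, hH, hH0, hFiso, hHiso, hfinX, hfinY =>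
    exact BR.main2 (m := m + 1) (by omega) F hF hF0 H hH hH0 hFiso hHiso hfinX hfinY

end
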